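/- Assume [H1] and [H2], and let ψ be the maximal L^p-solution on (0,T_max) of the nonlocal Fokker–Planck equation. Then ψ is a classical solution: ψ ∈ C¹((0,T_max), C²(𝕋ⁿ)). -/

import Mathlib

open MeasureTheory ENNReal Set Filter

noncomputable section

/-- Ambient space `ℝ × ℝ^m`: the universal cover of the torus `𝕋^{m+1}` (so `n = m + 1`). -/
abbrev Spc (m : ℕ) : Type := ℝ × (Fin m → ℝ)

/-- Unit cube in the last `m` coordinates: a fundamental domain for `𝕋^m`. -/
def cube1 (m : ℕ) : Set (Fin m → ℝ) := Set.pi Set.univ fun _ => Set.Ico (0 : ℝ) 1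

/-- A fundamental domain for the torus `𝕋^{m+1}`. -/
def cube (m : ℕ) : Set (Spc m) := Set.Ico (0 : ℝ) 1 ×ˢ cube1 m

/-- The measure of the torus: Lebesgue measure restricted to a fundamental domain. -/
def μT (m : ℕ) : Measure (Spc m) := volume.restrict (cube m)

/-- `ℤ^{m+1}`-periodicity: `f` is a function on the torus `𝕋^{m+1}`. -/
def IsPeriodic {m : ℕ} (f : Spc m → ℝ) : Prop :=
  ∀ (x : Spc m) (k : ℤ) (j : Fin m → ℤ), f (x.1 + k, fun i => x.2 i + j i) = f x

/-- The first coordinate direction. -/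
def e1 (m : ℕ) : Spc m := (1, 0)

/-- The remaining coordinate directions. -/
def eC (m : ℕ) (i : Fin m) : Spc m := (0, Pi.single i 1)

/-- Partial derivative in the direction `v`. -/
def pd {m : ℕ} (v : Spc m) (f : Spc m → ℝ) (x : Spc m) : ℝ := fderiv ℝ f x v

/-- `∇f ⋅ ∇g`. -/
def gradDot {m : ℕ} (f g : Spc m → ℝ) (x : Spc m) : ℝ :=
  pd (e1 m) f x * pd (e1 m) g x + ∑ i, pd (eC m i) f x * pd (eC m i) g x

/-- The Laplacian. -/
def lap {m : ℕ} (f : Spc m → ℝ) (x : Spc m) : ℝ :=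
  pd (e1 m) (pd (e1 m) f) x + ∑ i, pd (eC m i) (pd (eC m i) f) x

/-- The marginal `ψ̄(x₁) = ∫_{𝕋^m} ψ(x₁, ⋅)`. -/
def marg {m : ℕ} (ψ : Spc m → ℝ) (x1 : ℝ) : ℝ := ∫ y in cube1 m, ψ (x1, y)

/-- The nonlocal coefficient `φ_ψ = (∫ ∂_{x₁}V ψ dx₂…dxₙ) / ψ̄`. -/
def phiF {m : ℕ} (V ψ : Spc m → ℝ) (x1 : ℝ) : ℝ :=
  (∫ y in cube1 m, pd (e1 m) V (x1, y) * ψ (x1, y)) / marg ψ x1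

/-- `F(ψ) = ∇V⋅∇ψ + ΔV ψ − ∂_{x₁}(φ_ψ ψ)`. -/
def Fop {m : ℕ} (V ψ : Spc m → ℝ) (x : Spc m) : ℝ :=
  gradDot V ψ x + lap V x * ψ x - pd (e1 m) (fun z => phiF V ψ z.1 * ψ z) x

/-- `L^p`-norm on the torus. -/
def LpN {m : ℕ} (p : ℝ) (f : Spc m → ℝ) : ℝ≥0∞ := eLpNorm f (ENNReal.ofReal p) (μT m)

/-- Gagliardo (Sobolev–Slobodeckij) seminorm of fractional order `s`. -/
def gagl {m : ℕ} {F : Type*} [NormedAddCommGroup F] (s p : ℝ) (f : Spc m → F) : ℝ≥0∞ :=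
  (∫⁻ x in cube m, ∫⁻ y in cube m,
      ENNReal.ofReal (‖f x - f y‖ ^ p / ‖x - y‖ ^ ((m : ℝ) + 1 + s * p))) ^ (1 / p)

/-- The differential of `f`. -/
def grd {m : ℕ} (f : Spc m → ℝ) (x : Spc m) : Spc m →L[ℝ] ℝ := fderiv ℝ f x

/-- The `W^{σ,p}`-norm on the torus, for `0 ≤ σ ≤ 2`. -/
def WNorm {m : ℕ} (σ p : ℝ) (f : Spc m → ℝ) : ℝ≥0∞ :=
  if σ ≤ 0 then LpN p f
  else if σ < 1 then LpN p f + gagl σ p f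
  else if σ < 2 then
    LpN p f + eLpNorm (fun x => ‖grd f x‖) (ENNReal.ofReal p) (μT m)
      + (if σ = 1 then 0 else gagl (σ - 1) p (grd f))
  else
    LpN p f + eLpNorm (fun x => ‖grd f x‖) (ENNReal.ofReal p) (μT m)
      + eLpNorm (fun x => ‖iteratedFDeriv ℝ 2 f x‖) (ENNReal.ofReal p) (μT m)

/-- Membership in `W^{σ,p}(𝕋^{m+1})`, for `0 ≤ σ ≤ 2`. -/
def MemW {m : ℕ} (σ p : ℝ) (f : Spc m → ℝ) : Prop :=
  IsPeriodic f ∧ Measurable f ∧ (1 ≤ σ → Differentiable ℝ f) ∧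
    (2 ≤ σ → Differentiable ℝ (grd f)) ∧ WNorm σ p f < ⊤

/-- Membership in `𝒟^{σ,p}(𝕋^{m+1}) = {ψ ∈ W^{σ,p} | ψ̄ > 0}`. -/
def MemD {m : ℕ} (σ p : ℝ) (f : Spc m → ℝ) : Prop :=
  MemW σ p f ∧ ∀ x1 : ℝ, 0 < marg f x1

/-- Hypothesis `[H₁]`: `ψ₀ ∈ 𝒟^{σ,p}`, `ψ₀ ≥ 0`, `∫ ψ₀ = 1`. -/
def Hyp1 {m : ℕ} (σ p : ℝ) (ψ0 : Spc m → ℝ) : Prop :=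
  MemD σ p ψ0 ∧ (∀ x, 0 ≤ ψ0 x) ∧ (∫ x in cube m, ψ0 x) = 1

/-- Hypothesis `[H₂]`: `n = m + 1 ≥ 2`, `p > n`, `σ ∈ (1 + n/p, 2)`. -/
def Hyp2 (m : ℕ) (σ p : ℝ) : Prop :=
  1 ≤ m ∧ (m : ℝ) + 1 < p ∧ 1 + ((m : ℝ) + 1) / p < σ ∧ σ < 2

/-- The real interval `[0, Tmax)`, where `Tmax ∈ (0, ∞]`. -/
def Ico0 (Tmax : ℝ≥0∞) : Set ℝ := {t : ℝ | 0 ≤ t ∧ ENNReal.ofReal t < Tmax}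

/-- The real interval `(0, Tmax)`, where `Tmax ∈ (0, ∞]`. -/
def Ioo0 (Tmax : ℝ≥0∞) : Set ℝ := {t : ℝ | 0 < t ∧ ENNReal.ofReal t < Tmax}

/-- Continuity in `W^{σ,p}`-norm of a curve, on a time set `s`. -/
def ContW {m : ℕ} (σ p : ℝ) (s : Set ℝ) (ψ : ℝ → Spc m → ℝ) : Prop :=
  ∀ t ∈ s, ∀ ε : ℝ, 0 < ε → ∃ δ > 0, ∀ t' ∈ s, |t' - t| < δ →
    WNorm σ p (fun x => ψ t' x - ψ t x) < ENNReal.ofReal ε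

/-- Hölder continuity (exponent `α`) in `W^{σ,p}`-norm of a curve, on a time set `s`. -/
def HolderW {m : ℕ} (α σ p : ℝ) (s : Set ℝ) (ψ : ℝ → Spc m → ℝ) : Prop :=
  ∃ C : ℝ, ∀ t ∈ s, ∀ t' ∈ s,
    WNorm σ p (fun x => ψ t' x - ψ t x) ≤ ENNReal.ofReal (C * |t' - t| ^ α)

/-- `ψ` is an `L^p`-solution on `[0, Tmax)` of the nonlocal Fokker–Planck equation
`∂ₜψ = div(∇V ψ + β⁻¹∇ψ) − ∂_{x₁}(φ_ψ ψ) = β⁻¹Δψ + F(ψ)`, `ψ(0) = ψ₀`. -/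
structure IsLpSolution {m : ℕ} (V : Spc m → ℝ) (β σ p : ℝ) (ψ0 : Spc m → ℝ)
    (Tmax : ℝ≥0∞) (ψ : ℝ → Spc m → ℝ) : Prop where
  init : ∀ x, ψ 0 x = ψ0 x
  contLp : ContW 0 p (Ico0 Tmax) ψ
  regW2 : ∀ t ∈ Ioo0 Tmax, MemW 2 p (ψ t)
  regD : ∀ t ∈ Ioo0 Tmax, MemD σ p (ψ t)
  eqn : ∀ t ∈ Ioo0 Tmax,
    Tendsto (fun h : ℝ => LpN p
        (fun x => (ψ (t + h) x - ψ t x) / h - (β⁻¹ * lap (ψ t) x + Fop V (ψ t) x)))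
      (nhdsWithin 0 {h : ℝ | h ≠ 0}) (nhds 0)
  derivCont : ContW 0 p (Ioo0 Tmax)
    (fun t x => β⁻¹ * lap (ψ t) x + Fop V (ψ t) x)

/-- A maximal `L^p`-solution: an `L^p`-solution admitting no proper extension. -/
def IsMaximalLpSolution {m : ℕ} (V : Spc m → ℝ) (β σ p : ℝ) (ψ0 : Spc m → ℝ)
    (Tmax : ℝ≥0∞) (ψ : ℝ → Spc m → ℝ) : Prop :=
  IsLpSolution V β σ p ψ0 Tmax ψ ∧ 0 < Tmax ∧
    ∀ (Tmax' : ℝ≥0∞) (ψ' : ℝ → Spc m → ℝ), IsLpSolution V β σ p ψ0 Tmax' ψ' →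
      (∀ t ∈ Ico0 Tmax, ψ' t = ψ t) → Tmax' ≤ Tmax

/-- The Euclidean quadratic form on `Spc m`. -/
def qd {m : ℕ} (z : Spc m) : ℝ := z.1 ^ 2 + ∑ i, z.2 i ^ 2

/-- The heat semigroup `e^{β⁻¹ t Δ}` on the torus, realized by convolution with the Gaussian
heat kernel on the universal cover (and the identity for `t ≤ 0`). -/
def heatSG {m : ℕ} (β t : ℝ) (f : Spc m → ℝ) (x : Spc m) : ℝ :=
  if t ≤ 0 then f x
  else ∫ y : Spc m, (4 * Real.pi * (t / β)) ^ (-((m : ℝ) + 1) / 2) *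
      Real.exp (-qd (x - y) / (4 * (t / β))) * f y

/-- `ψ` is a mild solution of the nonlocal Fokker–Planck equation on `[0, Tmax)`:
`ψ ∈ C([0,Tmax), 𝒟^{σ,p})` and `ψ(t) = e^{β⁻¹tΔ}ψ₀ + ∫₀ᵗ e^{β⁻¹(t−s)Δ} F(ψ(s)) ds`. -/
def IsMildSolution {m : ℕ} (V : Spc m → ℝ) (β σ p : ℝ) (ψ0 : Spc m → ℝ)
    (Tmax : ℝ≥0∞) (ψ : ℝ → Spc m → ℝ) : Prop :=
  (∀ x, ψ 0 x = ψ0 x) ∧ (∀ t ∈ Ico0 Tmax, MemD σ p (ψ t)) ∧ ContW σ p (Ico0 Tmax) ψ ∧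
    ∀ t ∈ Ico0 Tmax, ∀ᵐ x ∂(volume : Measure (Spc m)),
      ψ t x = heatSG β t ψ0 x + ∫ s in Set.Ioc (0 : ℝ) t, heatSG β (t - s) (Fop V (ψ s)) x

/-- A maximal mild solution. -/
def IsMaximalMildSolution {m : ℕ} (V : Spc m → ℝ) (β σ p : ℝ) (ψ0 : Spc m → ℝ)
    (Tmax : ℝ≥0∞) (ψ : ℝ → Spc m → ℝ) : Prop :=
  IsMildSolution V β σ p ψ0 Tmax ψ ∧ 0 < Tmax ∧
    ∀ (Tmax' : ℝ≥0∞) (ψ' : ℝ → Spc m → ℝ), IsMildSolution V β σ p ψ0 Tmax' ψ' →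
      (∀ t ∈ Ico0 Tmax, ψ' t = ψ t) → Tmax' ≤ Tmax

/-- `L^p`-norm on the one-dimensional torus `𝕋`. -/
def LpN1 (p : ℝ) (g : ℝ → ℝ) : ℝ≥0∞ :=
  eLpNorm g (ENNReal.ofReal p) (volume.restrict (Set.Ico (0 : ℝ) 1))

/-- Membership in `L^p₀(𝕋^{m+1})`: periodic, `L^p` and of mean zero. -/
def MemL0 {m : ℕ} (p : ℝ) (f : Spc m → ℝ) : Prop :=
  IsPeriodic f ∧ Measurable f ∧ LpN p f < ⊤ ∧ (∫ x in cube m, f x) = 0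

/-- The `C²(𝕋^{m+1})`-norm. -/
def C2Norm {m : ℕ} (f : Spc m → ℝ) : ℝ≥0∞ :=
  (⨆ x : Spc m, ENNReal.ofReal |f x|) + (⨆ x : Spc m, ENNReal.ofReal ‖grd f x‖) +
    ⨆ x : Spc m, ENNReal.ofReal ‖iteratedFDeriv ℝ 2 f x‖

/-- `ψ ∈ C¹((0,Tmax), C²(𝕋^{m+1}))`: each `ψ(t)` is `C²` with finite `C²`-norm, and `t ↦ ψ(t)`
is differentiable in the `C²`-norm with continuous derivative. -/
def IsC1intoC2 {m : ℕ} (Tmax : ℝ≥0∞) (ψ : ℝ → Spc m → ℝ) : Prop :=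
  (∀ t ∈ Ioo0 Tmax, ContDiff ℝ 2 (ψ t) ∧ C2Norm (ψ t) < ⊤) ∧
    ∃ dψ : ℝ → Spc m → ℝ,
      (∀ t ∈ Ioo0 Tmax, C2Norm (dψ t) < ⊤) ∧
      (∀ t ∈ Ioo0 Tmax,
        Tendsto (fun h : ℝ => C2Norm (fun x => (ψ (t + h) x - ψ t x) / h - dψ t x))
          (nhdsWithin 0 {h : ℝ | h ≠ 0}) (nhds 0)) ∧
      (∀ t ∈ Ioo0 Tmax, ∀ ε : ℝ, 0 < ε → ∃ δ > 0, ∀ t' ∈ Ioo0 Tmax, |t' - t| < δ →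
        C2Norm (fun x => dψ t' x - dψ t x) < ENNReal.ofReal ε)


section
set_option linter.all false
variable {m : ℕ}

def co {m : ℕ} : Option (Fin m) → (Spc m →L[ℝ] ℝ)
  | none => ContinuousLinearMap.fst ℝ ℝ (Fin m → ℝ)
  | some i => (ContinuousLinearMap.proj i).comp (ContinuousLinearMap.snd ℝ ℝ (Fin m → ℝ))

def ee {m : ℕ} : Option (Fin m) → Spc m
  | none => e1 m
  | some i => eC m i

lemma co_none (z : Spc m) : co none z = z.1 := rfl
lemma co_some (i : Fin m) (z : Spc m) : co (some i) z = z.2 i := rfl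

lemma co_ee (i j : Option (Fin m)) : co i (ee j : Spc m) = if i = j then 1 else 0 := by
  rcases i with _ | i <;> rcases j with _ | j <;> simp [co, ee, e1, eC, Pi.single_apply]

lemma sum_co_ee (z : Spc m) : ∑ i, co i z • (ee i : Spc m) = z := by
  rw [Fintype.sum_option]
  ext j
  · simp [co, ee, e1, eC, Prod.fst_sum]
  · simp [co, ee, e1, eC, Prod.snd_sum, Finset.sum_apply, Pi.single_apply]

lemma clm_eq_sum (L : Spc m →L[ℝ] ℝ) (v : Spc m) : L v = ∑ i, co i v * L (ee i) := by
  conv_lhs => rw [← sum_co_ee v]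
  simp [map_sum]

lemma qd_eq (z : Spc m) : qd z = ∑ i, co i z ^ 2 := by
  simp [qd, Fintype.sum_option, co]

lemma qd_nonneg (z : Spc m) : 0 ≤ qd z := by
  rw [qd_eq]; exact Finset.sum_nonneg fun i _ => sq_nonneg _

lemma co_sq_le (i) (z : Spc m) : co i z ^ 2 ≤ qd z := by
  rw [qd_eq]
  exact Finset.single_le_sum (f := fun i => co i z ^ 2) (fun i _ => sq_nonneg _) (Finset.mem_univ i)

lemma abs_co_le (i) (z : Spc m) : |co i z| ≤ ‖z‖ := by
  rcases i with _ | i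
  · exact norm_fst_le z
  · exact (norm_le_pi_norm z.2 i).trans (norm_snd_le z)

lemma norm_le_of_co {z : Spc m} {r : ℝ} (hr : 0 ≤ r) (h : ∀ i, |co i z| ≤ r) : ‖z‖ ≤ r := by
  rw [Prod.norm_def]
  exact max_le (h none) ((pi_norm_le_iff_of_nonneg hr).2 fun i => h (some i))

lemma qd_le (z : Spc m) : qd z ≤ (m + 1) * ‖z‖ ^ 2 := by
  rw [qd_eq]
  calc ∑ i, co i z ^ 2 ≤ ∑ i : Option (Fin m), ‖z‖ ^ 2 := by
        refine Finset.sum_le_sum fun i _ => ?_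
        rw [← sq_abs]; gcongr; exact abs_co_le i z
    _ = _ := by simp

lemma qd_smul (c : ℝ) (z : Spc m) : qd (c • z) = c ^ 2 * qd z := by
  simp only [qd_eq, map_smul, smul_eq_mul, mul_pow, Finset.mul_sum]

lemma qd_shift (z w : Spc m) : qd z ≤ 2 * qd (z + w) + 2 * qd w := by
  simp only [qd_eq, Finset.mul_sum, ← Finset.sum_add_distrib]
  refine Finset.sum_le_sum fun i _ => ?_
  rw [map_add]; nlinarith [sq_nonneg (co i z + 2 * co i w)]

lemma continuous_qd : Continuous (qd : Spc m → ℝ) := by unfold qd; fun_prop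

lemma hasFDerivAt_qd (z : Spc m) : HasFDerivAt qd (∑ i, (2 * co i z) • (co i : Spc m →L[ℝ] ℝ)) z := by
  have : (qd : Spc m → ℝ) = fun z => ∑ i, co i z ^ 2 := funext qd_eq
  rw [this]
  refine (HasFDerivAt.fun_sum fun i _ => ((co i).hasFDerivAt (x := z)).pow 2).congr_fderiv ?_
  simp

lemma integrable_gauss {a : ℝ} (ha : 0 < a) : Integrable (fun z : Spc m => Real.exp (-a * qd z)) := by
  have h1 : Integrable (fun x : ℝ => Real.exp (-a * x ^ 2)) := integrable_exp_neg_mul_sq ha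
  have h2 : Integrable (fun y : Fin m → ℝ => ∏ i, Real.exp (-a * y i ^ 2)) :=
    Integrable.fintype_prod (fun _ => h1)
  refine (h1.mul_prod h2).congr (Eventually.of_forall fun z => ?_)
  simp only [qd, ← Real.exp_sum, ← Real.exp_add]
  congr 1
  rw [mul_add, Finset.mul_sum]

def c0 (m : ℕ) : ℝ := (∫ z : Spc m, Real.exp (-(1/4) * qd z))⁻¹

def kap (z : Spc m) : ℝ := c0 m * Real.exp (-(1/4) * qd z)
def kap1 (i : Option (Fin m)) (z : Spc m) : ℝ := -(co i z / 2) * kap z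
def kap2 (i j : Option (Fin m)) (z : Spc m) : ℝ :=
  (co i z * co j z / 4 - (if i = j then 1 else 0) / 2) * kap z

def gam (z : Spc m) : ℝ := Real.exp (-(1/16) * qd z)

lemma gam_pos (z : Spc m) : 0 < gam z := Real.exp_pos _
lemma integrable_gam : Integrable (gam : Spc m → ℝ) := integrable_gauss (by norm_num)
lemma continuous_gam : Continuous (gam : Spc m → ℝ) := by
  unfold gam; exact Real.continuous_exp.comp (continuous_const.mul continuous_qd)

lemma c0_pos : 0 < c0 m := inv_pos.2 (by
  refine integral_pos_of_integrable_nonneg_nonzero (x := 0) ?_ (integrable_gauss (by norm_num))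
    (fun z => (Real.exp_pos _).le) (Real.exp_pos _).ne'
  exact Real.continuous_exp.comp (continuous_const.mul continuous_qd))

lemma integral_kap : ∫ z : Spc m, kap z = 1 := by
  unfold kap
  rw [integral_const_mul]
  exact inv_mul_cancel₀ (fun h => (c0_pos (m := m)).ne' (by simp only [c0, h, _root_.inv_zero]))

lemma kap_pos (z : Spc m) : 0 < kap z := mul_pos c0_pos (Real.exp_pos _)

lemma continuous_kap : Continuous (kap : Spc m → ℝ) := by
  unfold kap
  exact continuous_const.mul (Real.continuous_exp.comp (continuous_const.mul continuous_qd))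
lemma continuous_kap1 (i) : Continuous (kap1 i : Spc m → ℝ) := by
  unfold kap1; exact (((co i).continuous.div_const _).neg).mul continuous_kap
lemma continuous_kap2 (i j) : Continuous (kap2 i j : Spc m → ℝ) := by
  unfold kap2
  exact ((((co i).continuous.mul (co j).continuous).div_const _).sub continuous_const).mul
    continuous_kap

lemma hasFDerivAt_kap (z : Spc m) : HasFDerivAt kap (∑ i, kap1 i z • (co i : Spc m →L[ℝ] ℝ)) z := by
  unfold kap
  refine ((((hasFDerivAt_qd z).const_mul (-(1/4))).exp).const_mul (c0 m)).congr_fderiv ?_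
  refine ContinuousLinearMap.ext fun v => ?_
  simp only [ContinuousLinearMap.smul_apply, ContinuousLinearMap.sum_apply, Finset.mul_sum,
    smul_eq_mul, kap1, kap]
  refine Finset.sum_congr rfl fun i _ => ?_
  ring

lemma hasFDerivAt_kap1 (i) (z : Spc m) :
    HasFDerivAt (kap1 i) (∑ j, kap2 i j z • (co j : Spc m →L[ℝ] ℝ)) z := by
  have h := ((((co i).hasFDerivAt (x := z)).mul_const (-1/2))).mul (hasFDerivAt_kap z)
  have e : (kap1 i : Spc m → ℝ) = (fun z => co i z * (-1/2)) * kap := by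
    funext z; simp only [kap1, Pi.mul_apply]; ring
  rw [e]
  refine h.congr_fderiv ?_
  refine ContinuousLinearMap.ext fun v => ?_
  simp only [ContinuousLinearMap.add_apply, ContinuousLinearMap.smul_apply,
    ContinuousLinearMap.sum_apply, Finset.mul_sum, smul_eq_mul, kap1, kap2]
  have : ∀ j, (co i z * co j z / 4 - (if i = j then 1 else 0) / 2) * kap z * co j v =
    co i z * (-1/2) * (-(co j z / 2) * kap z * co j v)
      + if i = j then kap z * (-1/2 * co j v) else 0 := by
    intro j; split_ifs <;> ring
  simp only [this, Finset.sum_add_distrib, Finset.sum_ite_eq, Finset.mem_univ, if_true]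

def GB (g : Spc m → ℝ) : Prop := ∃ C, 0 ≤ C ∧ ∀ z, |g z| ≤ C * Real.exp (-(1/8) * qd z)

lemma GB_aux {C : ℝ} {g : Spc m → ℝ} (hC : 0 ≤ C) (h : ∀ z, |g z| ≤ C * (1 + qd z) * kap z) : GB g := by
  refine ⟨C * 8 * c0 m, by have := c0_pos (m := m); positivity, fun z => (h z).trans ?_⟩
  have h1 : 1 + qd z ≤ 8 * Real.exp ((1/8) * qd z) := by
    have := Real.add_one_le_exp ((1/8) * qd z); linarith [qd_nonneg z]
  have h2 : Real.exp (-(1/8) * qd z) = Real.exp ((1/8) * qd z) * Real.exp (-(1/4) * qd z) := by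
    rw [← Real.exp_add]; congr 1; ring
  unfold kap
  rw [h2]
  have := c0_pos (m := m)
  calc C * (1 + qd z) * (c0 m * Real.exp (-(1/4) * qd z))
      ≤ C * (8 * Real.exp ((1/8) * qd z)) * (c0 m * Real.exp (-(1/4) * qd z)) := by gcongr
    _ = _ := by ring

lemma GB_kap : GB (kap : Spc m → ℝ) := GB_aux zero_le_one fun z => by
  rw [abs_of_pos (kap_pos z)]; nlinarith [kap_pos z, qd_nonneg z]
lemma abs_co_le_qd (i) (z : Spc m) : |co i z| ≤ 1 + qd z := by
  have := co_sq_le i z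
  rw [← sq_abs] at this; nlinarith [sq_nonneg (|co i z| - 1), abs_nonneg (co i z)]
lemma GB_kap1 (i) : GB (kap1 i : Spc m → ℝ) := GB_aux zero_le_one fun z => by
  unfold kap1
  rw [abs_mul, abs_of_pos (kap_pos z), one_mul, abs_neg, abs_div, abs_two]
  have := kap_pos z
  gcongr
  linarith [abs_co_le_qd i z, abs_nonneg (co i z)]
lemma GB_kap2 (i j) : GB (kap2 i j : Spc m → ℝ) := GB_aux zero_le_one fun z => by
  unfold kap2
  rw [abs_mul, abs_of_pos (kap_pos z), one_mul]
  have := kap_pos z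
  gcongr
  have h1 := co_sq_le i z
  have h2 := co_sq_le j z
  rw [abs_le]
  constructor <;> split_ifs <;> nlinarith [sq_nonneg (co i z + co j z), sq_nonneg (co i z - co j z)]

lemma GB.shift {g : Spc m → ℝ} (h : GB g) : ∃ C, 0 ≤ C ∧ ∀ z w, ‖w‖ ≤ 1 → |g (z + w)| ≤ C * gam z := by
  obtain ⟨C, hC, h⟩ := h
  refine ⟨C * Real.exp ((m + 1) / 8), by positivity, fun z w hw => (h _).trans ?_⟩
  rw [mul_assoc, gam, ← Real.exp_add]
  gcongr
  have h1 := qd_shift z w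
  have h2 := qd_le w
  have : ‖w‖ ^ 2 ≤ 1 := by nlinarith [norm_nonneg w]
  have : (m + 1 : ℝ) * ‖w‖ ^ 2 ≤ (m + 1) * 1 := by gcongr
  linarith

lemma GB.gam {g : Spc m → ℝ} (h : GB g) : ∃ C, 0 ≤ C ∧ ∀ z, |g z| ≤ C * gam z := by
  obtain ⟨C, hC, h⟩ := h.shift
  exact ⟨C, hC, fun z => by simpa using h z 0 (by simp)⟩

lemma GB.integrable {g : Spc m → ℝ} (h : GB g) (hc : Continuous g) : Integrable g := by
  obtain ⟨C, hC, h⟩ := h.gam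
  exact (integrable_gam.const_mul C).mono' hc.aestronglyMeasurable (Eventually.of_forall h)

structure AK (g : Spc m → ℝ) (g' : Option (Fin m) → Spc m → ℝ) : Prop where
  c : Continuous g
  c' : ∀ i, Continuous (g' i)
  b : GB g
  b' : ∀ i, GB (g' i)
  d : ∀ z, HasFDerivAt g (∑ i, g' i z • (co i : Spc m →L[ℝ] ℝ)) z

lemma AK_kap : AK (kap : Spc m → ℝ) kap1 :=
  ⟨continuous_kap, continuous_kap1, GB_kap, GB_kap1, hasFDerivAt_kap⟩
lemma AK_kap1 (i) : AK (kap1 i : Spc m → ℝ) (kap2 i) :=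
  ⟨continuous_kap1 i, continuous_kap2 i, GB_kap1 i, GB_kap2 i, hasFDerivAt_kap1 i⟩

end

section
set_option linter.all false
variable {m : ℕ}

instance instHaarSpc : (volume : Measure (Spc m)).IsAddHaarMeasure :=
  inferInstanceAs (((volume : Measure ℝ).prod (volume : Measure (Fin m → ℝ))).IsAddHaarMeasure)

def Tk (g : Spc m → ℝ) (τ : ℝ) (f : Spc m → ℝ) (x : Spc m) : ℝ := ∫ ζ, g ζ * f (x - √τ • ζ)

lemma Tk_integrable {g f : Spc m → ℝ} (hg : Integrable g) (hf : Measurable f) {C : ℝ}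
    (hb : ∀ x, |f x| ≤ C) (τ : ℝ) (x : Spc m) : Integrable (fun ζ => g ζ * f (x - √τ • ζ)) :=
  hg.mul_bdd (c := C) ((hf.comp (by fun_prop)).aestronglyMeasurable) (Eventually.of_forall fun ζ => hb _)

lemma Tk_bound {g f : Spc m → ℝ} (hg : Integrable g) (hf : Measurable f) {C : ℝ}
    (hb : ∀ x, |f x| ≤ C) (τ : ℝ) (x : Spc m) : |Tk g τ f x| ≤ (∫ ζ, |g ζ|) * C := by
  unfold Tk
  rw [← Real.norm_eq_abs, ← integral_mul_const]
  refine norm_integral_le_of_norm_le (hg.abs.mul_const C) (Eventually.of_forall fun ζ => ?_)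
  rw [norm_mul]
  exact mul_le_mul_of_nonneg_left (hb _) (norm_nonneg _)

lemma norm_ee_le (k : Option (Fin m)) : ‖(ee k : Spc m)‖ ≤ 1 :=
  norm_le_of_co zero_le_one fun i => by rw [co_ee]; split_ifs <;> simp

lemma AK.int {g : Spc m → ℝ} {g'} (h : AK g g') : Integrable g := h.b.integrable h.c
lemma DK0 {g : Spc m → ℝ} {g'} (h : AK g g') {f : Spc m → ℝ} (hf : Measurable f) {C : ℝ}
    (hb : ∀ x, |f x| ≤ C) {τ : ℝ} (hτ : 0 < τ) (x : Spc m) (k) :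
    HasDerivAt (fun s : ℝ => Tk g τ f (x + s • ee k)) ((√τ)⁻¹ * Tk (g' k) τ f x) 0 := by
  have hr : 0 < √τ := Real.sqrt_pos.2 hτ
  have hC : 0 ≤ C := (abs_nonneg _).trans (hb 0)
  have e : (fun s : ℝ => Tk g τ f (x + s • ee k)) =
      fun s => ∫ ζ, g (ζ + (s * (√τ)⁻¹) • ee k) * f (x - √τ • ζ) := by
    funext s
    unfold Tk
    rw [← integral_add_right_eq_self _ ((s * (√τ)⁻¹) • ee k)]
    congr 1; funext ζ; congr 2
    rw [smul_add, smul_smul]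
    have : √τ * (s * (√τ)⁻¹) = s := by field_simp
    rw [this]; abel
  rw [e]
  obtain ⟨D, hD, hDb⟩ := (h.b' k).shift
  have hm : Measurable fun ζ => f (x - √τ • ζ) := hf.comp (by fun_prop)
  have key := hasDerivAt_integral_of_dominated_loc_of_deriv_le (μ := volume)
    (F := fun (s : ℝ) ζ => g (ζ + (s * (√τ)⁻¹) • ee k) * f (x - √τ • ζ))
    (F' := fun s ζ => (√τ)⁻¹ * g' k (ζ + (s * (√τ)⁻¹) • ee k) * f (x - √τ • ζ))
    (x₀ := (0:ℝ)) (s := Metric.ball 0 (√τ)) (bound := fun ζ => (√τ)⁻¹ * (D * gam ζ) * C)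
    (Metric.ball_mem_nhds _ hr) ?_ ?_ ?_ ?_ ?_ ?_
  · refine key.2.congr_deriv ?_
    simp only [zero_mul, zero_smul, add_zero, Tk, mul_assoc, integral_const_mul]
  · refine Eventually.of_forall fun s => ?_
    exact ((h.c.comp (by fun_prop)).measurable.mul hm).aestronglyMeasurable
  · simpa using Tk_integrable h.int hf hb τ x
  · exact (((h.c' k).comp (by fun_prop)).measurable.const_mul _ |>.mul hm).aestronglyMeasurable
  · refine Eventually.of_forall fun ζ s hs => ?_
    rw [norm_mul, norm_mul, norm_inv, Real.norm_of_nonneg hr.le]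
    have h1 : ‖(s * (√τ)⁻¹) • (ee k : Spc m)‖ ≤ 1 := by
      rw [norm_smul]
      have : ‖s * (√τ)⁻¹‖ ≤ 1 := by
        rw [norm_mul, norm_inv, Real.norm_of_nonneg hr.le, ← div_eq_mul_inv, div_le_one hr]
        simpa using (mem_ball_zero_iff.1 hs).le
      exact mul_le_one₀ this (norm_nonneg _) (norm_ee_le k)
    have := hDb ζ _ h1
    have := hb (x - √τ • ζ)
    rw [Real.norm_eq_abs, Real.norm_eq_abs]
    have := gam_pos ζ
    have h0 : 0 ≤ (√τ)⁻¹ * (D * gam ζ) := by positivity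
    gcongr
  · exact ((integrable_gam.const_mul D).const_mul _).mul_const C
  · refine Eventually.of_forall fun ζ s hs => ?_
    refine HasDerivAt.mul_const ?_ _
    have h1 : HasDerivAt (fun s : ℝ => ζ + (s * (√τ)⁻¹) • (ee k : Spc m)) ((√τ)⁻¹ • ee k) s := by
      have := (((hasDerivAt_id s).mul_const ((√τ)⁻¹)).smul_const (ee k : Spc m)).const_add ζ
      simpa using this
    refine ((h.d _).comp_hasDerivAt s h1).congr_deriv ?_
    simp only [ContinuousLinearMap.sum_apply, ContinuousLinearMap.smul_apply, map_smul, smul_eq_mul,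
      co_ee, mul_ite, mul_one, mul_zero, Finset.sum_ite_eq', Finset.mem_univ, if_true]

lemma shift_hasDerivAt {F : Spc m → ℝ} {G : Spc m → ℝ} {v : Spc m}
    (h : ∀ x, HasDerivAt (fun s : ℝ => F (x + s • v)) (G x) 0) (x : Spc m) (s : ℝ) :
    HasDerivAt (fun s : ℝ => F (x + s • v)) (G (x + s • v)) s := by
  have h1 := h (x + s • v)
  rw [← sub_self s] at h1
  refine (h1.comp_sub_const s s).congr_of_eventuallyEq (Eventually.of_forall fun r => ?_)
  simp only [add_assoc, ← add_smul]; congr 3; ring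

lemma continuous_Tk_tau {g : Spc m → ℝ} (hg : Integrable g) {f : Spc m → ℝ} (hf : Continuous f) {C : ℝ}
    (hb : ∀ x, |f x| ≤ C) : Continuous (fun p : ℝ × Spc m => Tk g p.1 f p.2) := by
  unfold Tk
  refine continuous_of_dominated (bound := fun ζ => |g ζ| * C) ?_ ?_ (hg.abs.mul_const C) ?_
  · exact fun p => (Tk_integrable hg hf.measurable hb p.1 p.2).aestronglyMeasurable
  · refine fun p => Eventually.of_forall fun ζ => ?_
    rw [norm_mul]; exact mul_le_mul_of_nonneg_left (hb _) (norm_nonneg _)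
  · exact Eventually.of_forall fun ζ => by fun_prop

lemma Tk_zero {f : Spc m → ℝ} (x : Spc m) : Tk kap 0 f x = f x := by
  simp [Tk, integral_mul_const, integral_kap]

lemma int_kap : Integrable (kap : Spc m → ℝ) := AK_kap.int
lemma int_kap1 (i) : Integrable (kap1 i : Spc m → ℝ) := (AK_kap1 i).int

lemma Tk_tau_deriv {f : Spc m → ℝ} {fi : Option (Fin m) → Spc m → ℝ}
    (hd : ∀ x, HasFDerivAt f (∑ i, fi i x • (co i : Spc m →L[ℝ] ℝ)) x)
    {C : ℝ} (hb : ∀ x, |f x| ≤ C) (hc : ∀ i, Continuous (fi i)) {C' : ℝ} (hb' : ∀ i x, |fi i x| ≤ C')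
    {τ : ℝ} (hτ : 0 < τ) (x : Spc m) :
    HasDerivAt (fun τ => Tk kap τ f x) ((√τ)⁻¹ * ∑ i, Tk (kap1 i) τ (fi i) x) τ := by
  have hf : Continuous f := continuous_iff_continuousAt.2 fun x => (hd x).continuousAt
  have key := hasDerivAt_integral_of_dominated_loc_of_deriv_le (μ := volume)
    (F := fun (τ : ℝ) ζ => kap ζ * f (x - √τ • ζ))
    (F' := fun τ ζ => (√τ)⁻¹ * ∑ i, kap1 i ζ * fi i (x - √τ • ζ))
    (x₀ := τ) (s := Ioi (τ/2)) (bound := fun ζ => (√(τ/2))⁻¹ * ∑ i, |kap1 i ζ| * C')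
    (Ioi_mem_nhds (by linarith)) ?_ ?_ ?_ ?_ ?_ ?_
  · refine key.2.congr_deriv ?_
    simp only [Tk]
    rw [integral_const_mul, integral_finset_sum]
    exact fun i _ => Tk_integrable (int_kap1 i) (hc i).measurable (hb' i) τ x
  · exact Eventually.of_forall fun s => (Tk_integrable int_kap hf.measurable hb s x).aestronglyMeasurable
  · exact Tk_integrable int_kap hf.measurable hb τ x
  · refine ((integrable_finset_sum _ fun i _ => ?_).const_mul _).aestronglyMeasurable
    exact Tk_integrable (int_kap1 i) (hc i).measurable (hb' i) τ x
  · refine Eventually.of_forall fun ζ s hs => ?_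
    have hs' : τ / 2 < s := hs
    have h1 : 0 < √(τ/2) := Real.sqrt_pos.2 (by linarith)
    have h2 : √(τ/2) ≤ √s := Real.sqrt_le_sqrt hs'.le
    rw [norm_mul, norm_inv, Real.norm_of_nonneg (Real.sqrt_nonneg s)]
    refine mul_le_mul (inv_anti₀ h1 h2) ?_ (norm_nonneg _) (by positivity)
    refine norm_sum_le_of_le _ fun i _ => ?_
    rw [norm_mul]; exact mul_le_mul_of_nonneg_left (hb' _ _) (norm_nonneg _)
  · exact (integrable_finset_sum _ fun i _ => (int_kap1 i).abs.mul_const C').const_mul _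
  · refine Eventually.of_forall fun ζ s hs => ?_
    have hs' : 0 < s := lt_trans (by linarith) (show τ / 2 < s from hs)
    have h1 : HasDerivAt (fun s : ℝ => x - √s • ζ) (-((1 / (2 * √s)) • ζ)) s :=
      ((Real.hasDerivAt_sqrt hs'.ne').smul_const ζ).const_sub x
    refine (((hd _).comp_hasDerivAt s h1).const_mul (kap ζ)).congr_deriv ?_
    simp only [ContinuousLinearMap.sum_apply, ContinuousLinearMap.smul_apply, map_neg, map_smul, smul_eq_mul,
      Finset.mul_sum, kap1]
    rw [mul_neg, Finset.mul_sum, ← Finset.sum_neg_distrib]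
    refine Finset.sum_congr rfl fun i _ => ?_
    field_simp

end

section
set_option linter.all false
variable {m : ℕ}

section per
variable {ι F X : Type*} [Finite ι] [NormedAddCommGroup F] [NormedSpace ℝ F] [MeasureSpace F] [BorelSpace F]
  [FiniteDimensional ℝ F] [(volume : Measure F).IsAddHaarMeasure]

lemma per_span (b : Module.Basis ι ℝ F) (f : F → X) (hf : ∀ i x, f (x + b i) = f x)
    (g : F) (hg : g ∈ Submodule.span ℤ (Set.range b)) : ∀ x, f (g + x) = f x := by
  induction hg using Submodule.span_induction with
  | mem g h => obtain ⟨i, rfl⟩ := h; intro x; rw [add_comm]; exact hf i x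
  | zero => simp
  | add g h _ _ ihg ihh => intro x; rw [add_assoc, ihg, ihh]
  | smul a g _ ih =>
    have hneg : ∀ x, f (-g + x) = f x := fun x => by rw [← ih (-g + x)]; simp
    have hn : ∀ n : ℕ, ∀ x, f ((n • g) + x) = f x := by
      intro n; induction n with
      | zero => simp
      | succ n ihn => intro x; rw [succ_nsmul, add_assoc, ihn, ih]
    have hn' : ∀ n : ℕ, ∀ x, f ((-(n • g)) + x) = f x := by
      intro n x
      rw [← hn n (-(n • g) + x)]; simp
    rcases Int.eq_nat_or_neg a with ⟨n, rfl | rfl⟩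
    · simpa using hn n
    · simpa using hn' n

lemma fd_vadd (b : Module.Basis ι ℝ F) (v : F) : IsAddFundamentalDomain (Submodule.span ℤ (Set.range b)).toAddSubgroup
    ((fun w => v + w) '' ZSpan.fundamentalDomain b) := by
  exact (ZSpan.isAddFundamentalDomain' b (volume : Measure F)).vadd_of_comm v

lemma cntb (b : Module.Basis ι ℝ F) : Countable (Submodule.span ℤ (Set.range b)).toAddSubgroup :=
  inferInstanceAs (Countable (Submodule.span ℤ (Set.range b)))

lemma per_lint (b : Module.Basis ι ℝ F) (f : F → ℝ≥0∞) (hf : ∀ i x, f (x + b i) = f x) (v : F) :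
    ∫⁻ w in ZSpan.fundamentalDomain b, f (v + w) = ∫⁻ w in ZSpan.fundamentalDomain b, f w := by
  rw [(measurePreserving_add_left volume v).setLIntegral_comp_emb (measurableEmbedding_addLeft v) f]
  haveI := cntb b
  refine (fd_vadd b v).setLIntegral_eq (ZSpan.isAddFundamentalDomain' b (volume : Measure F)) f ?_
  exact fun g x => per_span b f hf g g.2 x

lemma per_int (b : Module.Basis ι ℝ F) (f : F → ℝ) (hf : ∀ i x, f (x + b i) = f x) (v : F) :
    ∫ w in ZSpan.fundamentalDomain b, f (v + w) = ∫ w in ZSpan.fundamentalDomain b, f w := by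
  rw [← (measurePreserving_add_left volume v).setIntegral_image_emb (measurableEmbedding_addLeft v) f]
  haveI := cntb b
  refine (fd_vadd b v).setIntegral_eq (ZSpan.isAddFundamentalDomain' b (volume : Measure F)) ?_
  exact fun g x => per_span b f hf g g.2 x
end per

def bS (m : ℕ) : Module.Basis (Unit ⊕ Fin m) ℝ (Spc m) :=
  (Module.Basis.singleton Unit ℝ).prod (Pi.basisFun ℝ (Fin m))

lemma fd_bS : ZSpan.fundamentalDomain (bS m) = cube m := by
  ext z
  simp [ZSpan.mem_fundamentalDomain, cube, cube1, bS]

lemma fd_b1 : ZSpan.fundamentalDomain (Pi.basisFun ℝ (Fin m)) = cube1 m := by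
  ext z
  simp [ZSpan.mem_fundamentalDomain, cube1]

def Per {X : Type*} (f : Spc m → X) : Prop := ∀ i x, f (x + ee i) = f x

lemma IsPeriodic.per {f : Spc m → ℝ} (h : IsPeriodic f) : Per f := by
  intro i x
  rcases i with _ | i
  · have := h x 1 0
    rw [← this]; congr 1; ext <;> simp [ee, e1]
  · have := h x 0 (Pi.single i 1)
    rw [← this]; congr 1; ext j <;> simp [ee, eC, Pi.single_apply]

lemma Per.pbS {X : Type*} {f : Spc m → X} (h : Per f) (i x) : f (x + bS m i) = f x := by
  rcases i with _ | i
  · rw [← h none x]; congr 2; ext <;> simp [bS, ee, e1]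
  · rw [← h (some i) x]; congr 2; ext j <;> simp [bS, ee, eC, Pi.single_apply]

lemma cube_lint {f : Spc m → ℝ≥0∞} (h : Per f) (v : Spc m) :
    ∫⁻ w in cube m, f (v + w) = ∫⁻ w in cube m, f w := by
  rw [← fd_bS]; exact per_lint _ f h.pbS v

lemma Per.b1 {X : Type*} {f : Spc m → X} (h : Per f) (x1 : ℝ) (i : Fin m) (y : Fin m → ℝ) :
    f (x1, y + Pi.basisFun ℝ (Fin m) i) = f (x1, y) := by
  rw [← h (some i) (x1, y)]; congr 1; ext j <;> simp [ee, eC, Pi.single_apply]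

lemma cube1_int {f : Spc m → ℝ} (h : Per f) (x1 : ℝ) (v : Fin m → ℝ) :
    ∫ w in cube1 m, f (x1, v + w) = ∫ w in cube1 m, f (x1, w) := by
  rw [← fd_b1]; exact per_int _ (fun y => f (x1, y)) (h.b1 x1) v

lemma measurableSet_cube1 : MeasurableSet (cube1 m) := MeasurableSet.univ_pi fun _ => measurableSet_Ico
lemma measurableSet_cube : MeasurableSet (cube m) := measurableSet_Ico.prod measurableSet_cube1
lemma vol_cube1 : volume (cube1 m) = 1 := by
  simp [cube1, volume_pi_pi]
lemma vol_cube : volume (cube m) = 1 := by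
  rw [cube, Measure.volume_eq_prod, Measure.prod_prod, vol_cube1]; simp

lemma norm_le_of_mem_cube {w : Spc m} (hw : w ∈ cube m) : ‖w‖ ≤ 1 := by
  refine norm_le_of_co zero_le_one fun i => ?_
  have h1 := hw.1
  have h2 := hw.2
  rcases i with _ | i
  · rw [co_none, abs_of_nonneg h1.1]; exact h1.2.le
  · have := h2 i (mem_univ i)
    rw [co_some, abs_of_nonneg this.1]; exact this.2.le

lemma Per.exists_cube {X : Type*} {f : Spc m → X} (h : Per f) (x : Spc m) : ∃ y ∈ cube m, f y = f x := by
  refine ⟨ZSpan.fract (bS m) x, ?_, ?_⟩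
  · rw [← fd_bS]; exact ZSpan.fract_mem_fundamentalDomain _ x
  · rw [ZSpan.fract_apply, sub_eq_add_neg, add_comm]
    exact per_span (bS m) f h.pbS _ (neg_mem (ZSpan.floor (bS m) x).2) x

lemma Per.bounded {f : Spc m → ℝ} (h : Per f) (hc : Continuous f) : ∃ C, 0 ≤ C ∧ ∀ x, |f x| ≤ C := by
  obtain ⟨C, hC⟩ := (isCompact_closedBall (0 : Spc m) 1).exists_bound_of_continuousOn hc.continuousOn
  refine ⟨C, (norm_nonneg _).trans (hC 0 (by simp)), fun x => ?_⟩
  obtain ⟨y, hy, e⟩ := h.exists_cube x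
  rw [← e]
  exact hC y (by simpa using norm_le_of_mem_cube hy)

def gam2 (z : Spc m) : ℝ := Real.exp (-(1/32) * qd z)

lemma gam_le_int (z : Spc m) : ENNReal.ofReal (gam z) ≤
    ENNReal.ofReal (Real.exp ((m+1)/16)) * ∫⁻ w in cube m, ENNReal.ofReal (gam2 (z + w)) := by
  rw [← lintegral_const_mul' _ _ ENNReal.ofReal_ne_top]
  calc ENNReal.ofReal (gam z) = ∫⁻ w in cube m, ENNReal.ofReal (gam z) := by
        simp [vol_cube]
    _ ≤ _ := by
        refine setLIntegral_mono' measurableSet_cube fun w hw => ?_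
        rw [← ENNReal.ofReal_mul (Real.exp_pos _).le, gam2, gam, ← Real.exp_add]
        refine ENNReal.ofReal_le_ofReal (Real.exp_le_exp.2 ?_)
        have h1 := qd_shift (z + w) (-w)
        rw [add_neg_cancel_right] at h1
        have h2 := qd_le (-w)
        rw [norm_neg] at h2
        have h3 := norm_le_of_mem_cube hw
        have : ‖w‖ ^ 2 ≤ 1 := by nlinarith [norm_nonneg w]
        have : (m + 1 : ℝ) * ‖w‖ ^ 2 ≤ (m + 1) * 1 := by gcongr
        linarith

@[fun_prop]
lemma measurable_gam2 : Measurable (gam2 : Spc m → ℝ) :=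
  (Real.continuous_exp.comp (continuous_const.mul continuous_qd)).measurable

def CU (m : ℕ) : ℝ≥0∞ := ENNReal.ofReal (Real.exp ((m+1)/16)) * ∫⁻ z : Spc m, ENNReal.ofReal (gam2 z)

lemma CU_lt : CU m < ⊤ := by
  refine ENNReal.mul_lt_top ENNReal.ofReal_lt_top ?_
  have : Integrable (gam2 : Spc m → ℝ) := integrable_gauss (by norm_num)
  have h := this.2
  refine lt_of_le_of_lt (lintegral_mono fun z => ?_) h
  exact ENNReal.ofReal_le_of_le_toReal (by simp [gam2, abs_of_pos, Real.exp_pos])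

lemma unfold1 {f : Spc m → ℝ≥0∞} (h : Per f) (hm : Measurable f) (x : Spc m) :
    ∫⁻ z, ENNReal.ofReal (gam z) * f (x - z) ≤ CU m * ∫⁻ w in cube m, f w := by
  have mg : Measurable fun z : Spc m => ENNReal.ofReal (gam2 z) := measurable_gam2.ennreal_ofReal
  calc ∫⁻ z, ENNReal.ofReal (gam z) * f (x - z)
      ≤ ∫⁻ z, ENNReal.ofReal (Real.exp ((m+1)/16)) *
          ∫⁻ w in cube m, ENNReal.ofReal (gam2 (z + w)) * f (x - z) := by
        refine lintegral_mono fun z => ?_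
        refine (mul_le_mul_left (gam_le_int z) _).trans ?_
        rw [mul_assoc, lintegral_mul_const _ (by fun_prop)]
    _ = ENNReal.ofReal (Real.exp ((m+1)/16)) *
          ∫⁻ w in cube m, ∫⁻ z, ENNReal.ofReal (gam2 (z + w)) * f (x - z) := by
        rw [lintegral_const_mul' _ _ ENNReal.ofReal_ne_top, lintegral_lintegral_swap]
        exact (Measurable.mul (by fun_prop) (by fun_prop)).aemeasurable
    _ = ENNReal.ofReal (Real.exp ((m+1)/16)) *
          ∫⁻ w in cube m, ∫⁻ z, ENNReal.ofReal (gam2 z) * f ((x - z) + w) := by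
        congr 2; funext w
        rw [← lintegral_add_right_eq_self (fun z => ENNReal.ofReal (gam2 z) * f ((x - z) + w)) w]
        congr 1; funext z; congr 2; abel
    _ = ENNReal.ofReal (Real.exp ((m+1)/16)) *
          ∫⁻ z, ENNReal.ofReal (gam2 z) * ∫⁻ w in cube m, f ((x - z) + w) := by
        rw [lintegral_lintegral_swap]
        · congr 2; funext z
          rw [lintegral_const_mul _ (by fun_prop)]
        · exact (Measurable.mul (by fun_prop) (by fun_prop)).aemeasurable
    _ = _ := by
        simp only [cube_lint h]
        rw [lintegral_mul_const _ mg, CU, mul_assoc]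

end

section
set_option linter.all false
variable {m : ℕ}

lemma finrank_Spc : Module.finrank ℝ (Spc m) = m + 1 := by
  rw [Module.finrank_prod]; simp [add_comm]

lemma unfold2 {f : Spc m → ℝ≥0∞} (h : Per f) (hm : Measurable f) (x : Spc m) {τ : ℝ} (h0 : 0 < τ)
    (h1 : τ ≤ 1) :
    ∫⁻ z, ENNReal.ofReal (gam z) * f (x - √τ • z) ≤
      ENNReal.ofReal (τ ^ (-((m:ℝ)+1)/2)) * (CU m * ∫⁻ w in cube m, f w) := by
  have hr : 0 < √τ := Real.sqrt_pos.2 h0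
  have mg : Measurable fun z : Spc m => ENNReal.ofReal (gam z) := continuous_gam.measurable.ennreal_ofReal
  calc ∫⁻ z, ENNReal.ofReal (gam z) * f (x - √τ • z)
      ≤ ∫⁻ z, ENNReal.ofReal (gam (√τ • z)) * f (x - √τ • z) := by
        refine lintegral_mono fun z => ?_
        refine mul_le_mul_left (ENNReal.ofReal_le_ofReal (Real.exp_le_exp.2 ?_)) _
        rw [qd_smul, Real.sq_sqrt h0.le]; nlinarith [qd_nonneg z]
    _ = ∫⁻ z, ENNReal.ofReal (gam z) * f (x - z) ∂(Measure.map (√τ • ·) volume) := by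
        have mz : Measurable fun z => ENNReal.ofReal (gam z) * f (x - z) := by fun_prop
        rw [lintegral_map mz (by fun_prop)]
    _ = ENNReal.ofReal (τ ^ (-((m:ℝ)+1)/2)) * ∫⁻ z, ENNReal.ofReal (gam z) * f (x - z) := by
        rw [Measure.map_addHaar_smul _ hr.ne', lintegral_smul_measure, finrank_Spc]
        congr 2
        rw [abs_of_pos (by positivity), Real.sqrt_eq_rpow, ← Real.rpow_natCast, ← Real.rpow_mul h0.le,
          ← Real.rpow_neg h0.le]
        congr 1; push_cast; ring
    _ ≤ _ := by gcongr; exact unfold1 h hm x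

def ex (m : ℕ) (p : ℝ) : ℝ := ((m:ℝ)+1)/(2*p)
def CS (m : ℕ) (p : ℝ) : ℝ≥0∞ := (∫⁻ z : Spc m, ENNReal.ofReal (gam z)) ^ (1 - 1/p) * CU m ^ (1/p)

lemma lint_gam_lt : ∫⁻ z : Spc m, ENNReal.ofReal (gam z) < ⊤ := by
  refine lt_of_le_of_lt (lintegral_mono fun z => ?_) (integrable_gam (m := m)).2
  exact ENNReal.ofReal_le_of_le_toReal (by simp [gam, abs_of_pos, Real.exp_pos])

lemma CS_lt {p : ℝ} (hp : 1 ≤ p) : CS m p < ⊤ := by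
  refine ENNReal.mul_lt_top (ENNReal.rpow_lt_top_of_nonneg ?_ lint_gam_lt.ne)
    (ENNReal.rpow_lt_top_of_nonneg (by positivity) CU_lt.ne)
  have : 1 / p ≤ 1 := by rw [div_le_one (by linarith)]; exact hp
  linarith

lemma smooth_lint {f : Spc m → ℝ} (h : Per f) (hm : Measurable f) {p : ℝ} (hp : 1 ≤ p) (x : Spc m)
    {τ : ℝ} (h0 : 0 < τ) (h1 : τ ≤ 1) :
    ∫⁻ z, ENNReal.ofReal (gam z) * ‖f (x - √τ • z)‖ₑ ≤ CS m p * ENNReal.ofReal (τ ^ (-ex m p)) * LpN p f := by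
  have mg : Measurable fun z : Spc m => ENNReal.ofReal (gam z) := continuous_gam.measurable.ennreal_ofReal
  have hp0 : 0 < p := by linarith
  set ν : Measure (Spc m) := volume.withDensity fun z => ENNReal.ofReal (gam z)
  have hν : ν univ = ∫⁻ z : Spc m, ENNReal.ofReal (gam z) := by simp [ν, withDensity_apply]
  have mf : Measurable fun z => f (x - √τ • z) := hm.comp (by fun_prop)
  have key := eLpNorm'_le_eLpNorm'_mul_rpow_measure_univ (μ := ν) (f := fun z => f (x - √τ • z))
    one_pos hp mf.aestronglyMeasurable
  simp only [eLpNorm', ENNReal.rpow_one, div_one, hν] at key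
  rw [lintegral_withDensity_eq_lintegral_mul _ mg (by fun_prop),
    lintegral_withDensity_eq_lintegral_mul _ mg (by fun_prop)] at key
  refine key.trans ?_
  have h2 := unfold2 (f := fun y => ‖f y‖ₑ ^ p) (fun i y => by simp only [h i y]) (by fun_prop) x h0 h1
  have h3 : LpN p f = (∫⁻ w in cube m, ‖f w‖ₑ ^ p) ^ (1/p) := by
    rw [LpN, eLpNorm_eq_lintegral_rpow_enorm_toReal (by simpa using hp0) ENNReal.ofReal_ne_top,
      ENNReal.toReal_ofReal hp0.le]
    rfl
  calc _ ≤ (ENNReal.ofReal (τ ^ (-((m:ℝ)+1)/2)) * (CU m * ∫⁻ w in cube m, ‖f w‖ₑ ^ p)) ^ (1/p)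
        * (∫⁻ z : Spc m, ENNReal.ofReal (gam z)) ^ (1 - 1/p) := by
        gcongr
        exact h2
    _ = _ := by
        rw [ENNReal.mul_rpow_of_nonneg _ _ (by positivity), ENNReal.mul_rpow_of_nonneg _ _ (by positivity),
          ← h3, ENNReal.ofReal_rpow_of_pos (by positivity), ← Real.rpow_mul h0.le, CS, ex]
        have : -((m:ℝ)+1)/2 * (1/p) = -(((m:ℝ)+1)/(2*p)) := by field_simp
        rw [this]; ring

structure PL (p : ℝ) (f : Spc m → ℝ) : Prop where
  per : Per f
  meas : Measurable f
  fin : LpN p f < ⊤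

def nL (p : ℝ) (f : Spc m → ℝ) : ℝ := (LpN p f).toReal

lemma nL_nonneg (p : ℝ) (f : Spc m → ℝ) : 0 ≤ nL p f := ENNReal.toReal_nonneg

lemma gam_int {p : ℝ} (hp : 1 ≤ p) {f : Spc m → ℝ} (h : PL p f) (x : Spc m) {τ : ℝ} (h0 : 0 < τ) (h1 : τ ≤ 1) :
    Integrable (fun z => gam z * f (x - √τ • z)) ∧
    ∫ z, gam z * |f (x - √τ • z)| ≤ (CS m p).toReal * τ ^ (-ex m p) * nL p f := by
  have e : ∀ z, ‖gam z * f (x - √τ • z)‖ₑ = ENNReal.ofReal (gam z) * ‖f (x - √τ • z)‖ₑ := fun z => by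
    rw [enorm_mul, Real.enorm_of_nonneg (gam_pos z).le]
  have hs := smooth_lint h.per h.meas hp x h0 h1
  have hfin : CS m p * ENNReal.ofReal (τ ^ (-ex m p)) * LpN p f < ⊤ :=
    ENNReal.mul_lt_top (ENNReal.mul_lt_top (CS_lt hp) ENNReal.ofReal_lt_top) h.fin
  have mf : Measurable fun z => f (x - √τ • z) := h.meas.comp (by fun_prop)
  have hi : Integrable (fun z => gam z * f (x - √τ • z)) := by
    refine ⟨(continuous_gam.measurable.mul mf).aestronglyMeasurable, ?_⟩
    rw [HasFiniteIntegral]; simp only [e]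
    exact lt_of_le_of_lt hs hfin
  refine ⟨hi, ?_⟩
  have : ∫ z, gam z * |f (x - √τ • z)| = (∫⁻ z, ENNReal.ofReal (gam z) * ‖f (x - √τ • z)‖ₑ).toReal := by
    rw [← funext e, ← integral_norm_eq_lintegral_enorm hi.1]
    congr 1; funext z; rw [norm_mul, Real.norm_of_nonneg (gam_pos z).le, Real.norm_eq_abs]
  rw [this]
  refine (ENNReal.toReal_mono hfin.ne hs).trans (le_of_eq ?_)
  rw [ENNReal.toReal_mul, ENNReal.toReal_mul, ENNReal.toReal_ofReal (by positivity), nL]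

lemma Tk_PL {p : ℝ} (hp : 1 ≤ p) {g : Spc m → ℝ} (hg : GB g) (hc : Continuous g) : ∃ C, 0 ≤ C ∧
    ∀ f, PL p f → ∀ x : Spc m, ∀ τ : ℝ, 0 < τ → τ ≤ 1 →
      Integrable (fun z => g z * f (x - √τ • z)) ∧ |Tk g τ f x| ≤ C * τ ^ (-ex m p) * nL p f := by
  obtain ⟨C, hC, hb⟩ := hg.gam
  refine ⟨C * (CS m p).toReal, by positivity, fun f hf x τ h0 h1 => ?_⟩
  obtain ⟨hi, hn⟩ := gam_int hp hf x h0 h1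
  have mf : Measurable fun z => f (x - √τ • z) := hf.meas.comp (by fun_prop)
  have hle : ∀ z, ‖g z * f (x - √τ • z)‖ ≤ C * (gam z * |f (x - √τ • z)|) := fun z => by
    rw [norm_mul, ← mul_assoc]; exact mul_le_mul_of_nonneg_right (hb z) (norm_nonneg _)
  have hi' : Integrable (fun z => gam z * |f (x - √τ • z)|) := hi.norm.congr (Eventually.of_forall fun z => by
    simp [abs_of_pos (gam_pos z)])
  refine ⟨(hi'.const_mul C).mono' (hc.measurable.mul mf).aestronglyMeasurable (Eventually.of_forall hle), ?_⟩
  refine (norm_integral_le_of_norm_le (hi'.const_mul C) (Eventually.of_forall hle)).trans ?_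
  rw [integral_const_mul, mul_assoc, mul_assoc]
  refine mul_le_mul_of_nonneg_left (hn.trans (le_of_eq (by ring))) hC

lemma Tk_meas {g f : Spc m → ℝ} (hc : Measurable g) (hf : Measurable f) (x : Spc m) :
    StronglyMeasurable (fun τ => Tk g τ f x) := by
  unfold Tk
  refine StronglyMeasurable.integral_prod_right' (f := fun p : ℝ × Spc m => g p.2 * f (x - √p.1 • p.2)) ?_
  exact Measurable.stronglyMeasurable (by fun_prop)

lemma Tk_cont {p : ℝ} (hp : 1 ≤ p) {g : Spc m → ℝ} (hg : GB g) (hc : Continuous g) {f} (hf : PL p f)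
    {τ : ℝ} (h0 : 0 < τ) (h1 : τ ≤ 1) : Continuous (Tk g τ f) := by
  have hr : 0 < √τ := Real.sqrt_pos.2 h0
  refine continuous_iff_continuousAt.2 fun x0 => ?_
  have e : Tk g τ f = fun x => ∫ ζ, g (ζ + (√τ)⁻¹ • (x - x0)) * f (x0 - √τ • ζ) := by
    funext x
    unfold Tk
    rw [← integral_add_right_eq_self _ ((√τ)⁻¹ • (x - x0))]
    congr 1; funext ζ; congr 2
    rw [smul_add, smul_smul, mul_inv_cancel₀ hr.ne', one_smul]; abel
  rw [e]
  obtain ⟨C, hC, hb⟩ := hg.shift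
  have mf : Measurable fun z => f (x0 - √τ • z) := hf.meas.comp (by fun_prop)
  refine continuousAt_of_dominated (bound := fun ζ => C * (gam ζ * |f (x0 - √τ • ζ)|)) ?_ ?_ ?_ ?_
  · exact Eventually.of_forall fun x =>
      ((hc.comp (by fun_prop)).measurable.mul mf).aestronglyMeasurable
  · filter_upwards [Metric.ball_mem_nhds x0 hr] with x hx
    refine Eventually.of_forall fun ζ => ?_
    rw [norm_mul, ← mul_assoc]
    refine mul_le_mul_of_nonneg_right (hb _ _ ?_) (norm_nonneg _)
    rw [norm_smul, norm_inv, Real.norm_of_nonneg hr.le, inv_mul_le_iff₀ hr, mul_one]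
    exact (mem_ball_iff_norm.1 hx).le
  · refine ((gam_int hp hf x0 h0 h1).1.norm.congr (Eventually.of_forall fun z => ?_)).const_mul C
    simp [abs_of_pos (gam_pos z)]
  · exact Eventually.of_forall fun ζ => by
      refine ContinuousAt.mul ?_ continuousAt_const
      exact (hc.comp (by fun_prop)).continuousAt

def LD (k : Option (Fin m)) (f fk : Spc m → ℝ) : Prop :=
  ∀ x, HasDerivAt (fun s : ℝ => f (x + s • ee k)) (fk x) 0

lemma LCd {p : ℝ} (hp : 1 ≤ p) {g : Spc m → ℝ} (hg : GB g) (hc : Continuous g) {k} {f fk : Spc m → ℝ}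
    (hfc : Continuous f) {K : ℝ} (hfb : ∀ x, |f x| ≤ K)
    (hd : LD k f fk) (hf : PL p fk) {τ : ℝ} (h0 : 0 < τ) (h1 : τ ≤ 1) :
    LD k (Tk g τ f) (Tk g τ fk) := by
  intro x
  have hi : Integrable g := hg.integrable hc
  obtain ⟨C, hC, hb⟩ := hg.gam
  have hcont : Continuous fun s : ℝ => Tk g τ fk (x + s • ee k) :=
    (Tk_cont hp hg hc hf h0 h1).comp (by fun_prop)
  have key : ∀ h : ℝ, Tk g τ f (x + h • ee k) = Tk g τ f x + ∫ s in (0:ℝ)..h, Tk g τ fk (x + s • ee k) := by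
    intro h
    set μ1 : Measure ℝ := volume.restrict (uIoc 0 h)
    haveI : IsFiniteMeasure μ1 := ⟨by simp [μ1, uIoc]⟩
    have mfk := hf.meas
    have mgam := (continuous_gam (m := m)).measurable
    have hgam : Integrable (fun q : ℝ × Spc m => gam q.2 * fk (x + q.1 • ee k - √τ • q.2)) (μ1.prod volume) := by
      refine (integrable_prod_iff (Measurable.aestronglyMeasurable (by fun_prop))).2 ⟨?_, ?_⟩
      · exact Eventually.of_forall fun s => (gam_int hp hf (x + s • ee k) h0 h1).1
      · refine Integrable.mono' (integrable_const ((CS m p).toReal * τ ^ (-ex m p) * nL p fk)) ?_ ?_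
        · refine (StronglyMeasurable.integral_prod_right' (f := fun q : ℝ × Spc m =>
            ‖gam q.2 * fk (x + q.1 • ee k - √τ • q.2)‖) ?_).aestronglyMeasurable
          exact Measurable.stronglyMeasurable (by fun_prop)
        · refine Eventually.of_forall fun s => ?_
          rw [Real.norm_of_nonneg (integral_nonneg fun _ => norm_nonneg _)]
          refine le_trans (le_of_eq ?_) (gam_int hp hf (x + s • ee k) h0 h1).2
          congr 1; funext z; rw [norm_mul, Real.norm_of_nonneg (gam_pos z).le, Real.norm_eq_abs]
    have hgi : Integrable (fun q : ℝ × Spc m => g q.2 * fk (x + q.1 • ee k - √τ • q.2)) (μ1.prod volume) := by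
      refine (hgam.norm.const_mul C).mono' (Measurable.aestronglyMeasurable ?_) (Eventually.of_forall fun q => ?_)
      · have := hc.measurable
        fun_prop
      · rw [norm_mul, norm_mul, ← mul_assoc]
        refine mul_le_mul_of_nonneg_right ?_ (norm_nonneg _)
        rw [Real.norm_of_nonneg (gam_pos _).le]; exact hb _
    have hae : ∀ᵐ ζ : Spc m, g ζ * f (x + h • ee k - √τ • ζ) - g ζ * f (x - √τ • ζ)
        = ∫ s in (0:ℝ)..h, g ζ * fk (x + s • ee k - √τ • ζ) := by
      filter_upwards [hgam.prod_left_ae] with ζ hζ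
      have h2 : IntervalIntegrable (fun s => fk (x + s • ee k - √τ • ζ)) volume 0 h := by
        rw [intervalIntegrable_iff]
        refine (hζ.const_mul (gam ζ)⁻¹).congr (Eventually.of_forall fun s => ?_)
        simp only
        rw [← mul_assoc, inv_mul_cancel₀ (gam_pos ζ).ne', one_mul]
      have h3 := intervalIntegral.integral_eq_sub_of_hasDerivAt
        (fun s _ => shift_hasDerivAt hd (x - √τ • ζ) s) (a := 0) (b := h) (by
          convert h2 using 3; abel)
      rw [intervalIntegral.integral_const_mul, ← mul_sub]
      congr 1
      simp only [zero_smul, add_zero] at h3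
      rw [show x + h • ee k - √τ • ζ = x - √τ • ζ + h • ee k by abel, ← h3]
      congr 1; funext s; congr 1; abel
    have h4 : Tk g τ f (x + h • ee k) - Tk g τ f x =
        ∫ ζ, ∫ s in (0:ℝ)..h, g ζ * fk (x + s • ee k - √τ • ζ) := by
      unfold Tk
      rw [← integral_sub (Tk_integrable hi hfc.measurable hfb τ _) (Tk_integrable hi hfc.measurable hfb τ _)]
      exact integral_congr_ae hae
    rw [← sub_eq_iff_eq_add', h4]
    unfold Tk
    simp only [intervalIntegral.intervalIntegral_eq_integral_uIoc]
    rw [integral_smul]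
    congr 1
    exact (integral_integral_swap hgi).symm
  have e : (fun h : ℝ => Tk g τ f (x + h • ee k)) =
    fun h => Tk g τ f x + ∫ s in (0:ℝ)..h, Tk g τ fk (x + s • ee k) := funext key
  rw [e]
  have := (intervalIntegral.integral_hasDerivAt_right (hcont.intervalIntegrable 0 0)
    (hcont.stronglyMeasurableAtFilter _ _) hcont.continuousAt).const_add (Tk g τ f x)
  simpa using this

lemma IBP {p : ℝ} (hp : 1 ≤ p) {g : Spc m → ℝ} {g'} (h : AK g g') {k} {f fk : Spc m → ℝ}
    (hfc : Continuous f) {K : ℝ} (hfb : ∀ x, |f x| ≤ K)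
    (hd : LD k f fk) (hf : PL p fk) {τ : ℝ} (h0 : 0 < τ) (h1 : τ ≤ 1) (x : Spc m) :
    Tk g τ fk x = (√τ)⁻¹ * Tk (g' k) τ f x :=
  (LCd hp h.b h.c hfc hfb hd hf h0 h1 x).unique (DK0 h hfc.measurable hfb h0 x k)

end

section
set_option linter.all false
variable {m : ℕ}

def Wop (a : ℝ) (g : Spc m → ℝ) (ε : ℝ) (f : Spc m → ℝ) (x : Spc m) : ℝ :=
  ∫ τ in (0:ℝ)..ε, τ ^ (-a) * Tk g τ f x

lemma sqrt_inv_eq {τ : ℝ} (h0 : 0 < τ) : (√τ)⁻¹ = τ ^ (-(1/2:ℝ)) := by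
  rw [Real.sqrt_eq_rpow, Real.rpow_neg h0.le]

lemma W_meas {g f : Spc m → ℝ} (a : ℝ) (hc : Measurable g) (hf : Measurable f) (x : Spc m) (μ : Measure ℝ) :
    AEStronglyMeasurable (fun τ => τ ^ (-a) * Tk g τ f x) μ :=
  (Measurable.mul (by fun_prop) (Tk_meas hc hf x).measurable).aestronglyMeasurable

lemma W_all {p : ℝ} (hp : 1 ≤ p) {a : ℝ} (ha : a + ex m p < 1) {g : Spc m → ℝ} (hg : GB g) (hc : Continuous g) :
    ∃ C, 0 ≤ C ∧ ∀ f, PL p f → ∀ x : Spc m, ∀ ε : ℝ, 0 < ε → ε ≤ 1 →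
      IntervalIntegrable (fun τ => τ ^ (-a) * Tk g τ f x) volume 0 ε ∧
      |Wop a g ε f x| ≤ C * ε ^ (1 - a - ex m p) * nL p f := by
  obtain ⟨C, hC, hb⟩ := Tk_PL (m := m) hp hg hc
  refine ⟨C / (1 - a - ex m p), div_nonneg hC (by linarith), fun f hf x ε h0 h1 => ?_⟩
  have hbd : ∀ τ ∈ Ioc (0:ℝ) ε, ‖τ ^ (-a) * Tk g τ f x‖ ≤ (C * nL p f) * τ ^ (-a - ex m p) := by
    intro τ hτ
    rw [norm_mul, Real.norm_of_nonneg (Real.rpow_nonneg hτ.1.le _), sub_eq_add_neg, Real.rpow_add hτ.1]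
    have := mul_le_mul_of_nonneg_left (hb f hf x τ hτ.1 (hτ.2.trans h1)).2 (Real.rpow_nonneg hτ.1.le (-a))
    refine this.trans (le_of_eq (by ring))
  have hr : IntervalIntegrable (fun τ : ℝ => (C * nL p f) * τ ^ (-a - ex m p)) volume 0 ε :=
    (intervalIntegral.intervalIntegrable_rpow' (by linarith)).const_mul _
  have hI : IntervalIntegrable (fun τ => τ ^ (-a) * Tk g τ f x) volume 0 ε := by
    refine hr.mono_fun (W_meas a hc.measurable hf.meas x _) ?_
    rw [uIoc_of_le h0.le]
    refine (ae_restrict_iff' measurableSet_Ioc).2 (Eventually.of_forall fun τ hτ => ?_)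
    exact (hbd τ hτ).trans (le_abs_self _)
  refine ⟨hI, ?_⟩
  have := intervalIntegral.norm_integral_le_of_norm_le h0.le (Eventually.of_forall hbd) hr
  refine this.trans (le_of_eq ?_)
  rw [intervalIntegral.integral_const_mul, integral_rpow (Or.inl (by linarith)),
    Real.zero_rpow (by linarith), show -a - ex m p + 1 = 1 - a - ex m p by ring]
  field_simp
  ring

lemma W_dom {p : ℝ} (hp : 1 ≤ p) {a : ℝ} (ha : a + ex m p < 1) {g : Spc m → ℝ} (hg : GB g) (hc : Continuous g)
    {f} (hf : PL p f) {ε : ℝ} (h0 : 0 < ε) (h1 : ε ≤ 1) :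
    ∃ b : ℝ → ℝ, IntervalIntegrable b volume 0 ε ∧
      ∀ τ ∈ Ioc (0:ℝ) ε, ∀ x : Spc m, ‖τ ^ (-a) * Tk g τ f x‖ ≤ b τ := by
  obtain ⟨C, hC, hb⟩ := Tk_PL (m := m) hp hg hc
  refine ⟨fun τ => (C * nL p f) * τ ^ (-a - ex m p),
    (intervalIntegral.intervalIntegrable_rpow' (by linarith)).const_mul _, fun τ hτ x => ?_⟩
  show _ ≤ (C * nL p f) * τ ^ (-a - ex m p)
  rw [norm_mul, Real.norm_of_nonneg (Real.rpow_nonneg hτ.1.le _), sub_eq_add_neg, Real.rpow_add hτ.1]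
  have := mul_le_mul_of_nonneg_left (hb f hf x τ hτ.1 (hτ.2.trans h1)).2 (Real.rpow_nonneg hτ.1.le (-a))
  refine this.trans (le_of_eq (by ring))

lemma W_cont {p : ℝ} (hp : 1 ≤ p) {a : ℝ} (ha : a + ex m p < 1) {g : Spc m → ℝ} (hg : GB g) (hc : Continuous g)
    {f} (hf : PL p f) {ε : ℝ} (h0 : 0 < ε) (h1 : ε ≤ 1) : Continuous (Wop a g ε f) := by
  obtain ⟨b, hb, hle⟩ := W_dom hp ha hg hc hf h0 h1
  unfold Wop
  refine intervalIntegral.continuous_of_dominated_interval (bound := b)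
    (fun x => W_meas a hc.measurable hf.meas x _) (fun x => Eventually.of_forall fun τ hτ => ?_) hb
    (Eventually.of_forall fun τ hτ => ?_)
  · rw [uIoc_of_le h0.le] at hτ; exact hle τ hτ x
  · rw [uIoc_of_le h0.le] at hτ
    exact continuous_const.mul (Tk_cont hp hg hc hf hτ.1 (hτ.2.trans h1))

lemma LD.congr {k : Option (Fin m)} {f fk fk' : Spc m → ℝ} (h : LD k f fk) (e : ∀ x, fk x = fk' x) : LD k f fk' :=
  fun x => e x ▸ h x

lemma W_LD {p : ℝ} (hp : 1 ≤ p) {a : ℝ} (ha : a + ex m p < 1) {g : Spc m → ℝ} (hg : GB g) (hc : Continuous g)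
    {k} {f fk : Spc m → ℝ} (hfc : Continuous f) {K : ℝ} (hfb : ∀ x, |f x| ≤ K) (hpf : PL p f)
    (hd : LD k f fk) (hf : PL p fk) {ε : ℝ} (h0 : 0 < ε) (h1 : ε ≤ 1) :
    LD k (Wop a g ε f) (Wop a g ε fk) := by
  intro x
  obtain ⟨b, hb, hle⟩ := W_dom hp ha hg hc hf h0 h1
  obtain ⟨C, hC, hW⟩ := W_all (m := m) hp ha hg hc
  have := (intervalIntegral.hasDerivAt_integral_of_dominated_loc_of_deriv_le (μ := volume) (a := 0) (b := ε)
    (F := fun s τ => τ ^ (-a) * Tk g τ f (x + s • ee k))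
    (F' := fun s τ => τ ^ (-a) * Tk g τ fk (x + s • ee k)) (x₀ := (0:ℝ)) (s := univ) (bound := b) univ_mem
    (Eventually.of_forall fun s => W_meas a hc.measurable hpf.meas _ _) (hW f hpf _ ε h0 h1).1
    (W_meas a hc.measurable hf.meas _ _) (Eventually.of_forall fun τ hτ s _ => ?_) hb
    (Eventually.of_forall fun τ hτ s _ => ?_)).2
  · simpa [Wop] using this
  · rw [uIoc_of_le h0.le] at hτ; exact hle τ hτ _
  · rw [uIoc_of_le h0.le] at hτ
    exact (shift_hasDerivAt (LCd hp hg hc hfc hfb hd hf hτ.1 (hτ.2.trans h1)) x s).const_mul _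

lemma A_LD {f : Spc m → ℝ} (hfm : Measurable f) {K : ℝ} (hfb : ∀ x, |f x| ≤ K) {ε : ℝ} (h0 : 0 < ε) (k) :
    LD k (Wop 0 kap ε f) (Wop (1/2) (kap1 k) ε f) := by
  intro x
  have i1 := (AK_kap1 (m := m) k).int
  have i0 := (AK_kap (m := m)).int
  set C := (∫ z, |kap1 k z|) * K with hC
  have := (intervalIntegral.hasDerivAt_integral_of_dominated_loc_of_deriv_le (μ := volume) (a := 0) (b := ε)
    (F := fun s τ => τ ^ (-(0:ℝ)) * Tk kap τ f (x + s • ee k))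
    (F' := fun s τ => τ ^ (-(1/2:ℝ)) * Tk (kap1 k) τ f (x + s • ee k)) (x₀ := (0:ℝ)) (s := univ)
    (bound := fun τ => C * τ ^ (-(1/2:ℝ))) univ_mem
    (Eventually.of_forall fun s => W_meas 0 continuous_kap.measurable hfm _ _) ?_
    (W_meas (1/2) (AK_kap1 k).c.measurable hfm _ _) (Eventually.of_forall fun τ hτ s _ => ?_)
    ((intervalIntegral.intervalIntegrable_rpow' (by norm_num)).const_mul _)
    (Eventually.of_forall fun τ hτ s _ => ?_)).2
  · simpa [Wop] using this
  · rw [intervalIntegrable_iff, uIoc_of_le h0.le]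
    refine Integrable.mono' (integrable_const ((∫ z, |kap (m := m) z|) * K))
      (W_meas 0 continuous_kap.measurable hfm _ _) (Eventually.of_forall fun τ => ?_)
    simpa using Tk_bound i0 hfm hfb τ (x + (0:ℝ) • ee k)
  · rw [uIoc_of_le h0.le] at hτ
    rw [norm_mul, Real.norm_of_nonneg (Real.rpow_nonneg hτ.1.le _), mul_comm]
    exact mul_le_mul_of_nonneg_right (Tk_bound i1 hfm hfb τ _) (Real.rpow_nonneg hτ.1.le _)
  · rw [uIoc_of_le h0.le] at hτ
    have h3 : LD k (Tk kap τ f) (fun x => (√τ)⁻¹ * Tk (kap1 k) τ f x) := fun x => DK0 AK_kap hfm hfb hτ.1 x k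
    have := (shift_hasDerivAt h3 x s)
    simpa [sqrt_inv_eq hτ.1] using this

lemma W_ibp {p : ℝ} (hp : 1 ≤ p) {k} {f fk : Spc m → ℝ}
    (hfc : Continuous f) {K : ℝ} (hfb : ∀ x, |f x| ≤ K)
    (hd : LD k f fk) (hf : PL p fk) {ε : ℝ} (h0 : 0 < ε) (h1 : ε ≤ 1) (x : Spc m) :
    Wop (1/2) (kap1 k) ε f x = Wop 0 kap ε fk x := by
  unfold Wop
  refine intervalIntegral.integral_congr_ae (Eventually.of_forall fun τ hτ => ?_)
  rw [uIoc_of_le h0.le] at hτ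
  rw [IBP hp AK_kap hfc hfb hd hf hτ.1 (hτ.2.trans h1), sqrt_inv_eq hτ.1]; simp

end

section
set_option linter.all false
variable {m : ℕ}

lemma fd_of_LD {f : Spc m → ℝ} {fi : Option (Fin m) → Spc m → ℝ} (hd : ∀ i, LD i f (fi i))
    (hc : ∀ i, Continuous (fi i)) (x : Spc m) : HasFDerivAt f (∑ i, fi i x • (co i : Spc m →L[ℝ] ℝ)) x := by
  classical
  have key : ∀ s : Finset (Option (Fin m)), ∀ ε > 0, ∃ δ > 0, ∀ h : Spc m, ‖h‖ < δ →
      |f (x + ∑ i ∈ s, co i h • ee i) - f x - ∑ i ∈ s, co i h * fi i x| ≤ ε * ‖h‖ := by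
    intro s
    induction s using Finset.induction_on with
    | empty => intro ε hε; exact ⟨1, one_pos, fun h _ => by simp; positivity⟩
    | insert k s hk ih =>
      intro ε hε
      obtain ⟨δ, hδ, h1⟩ := ih (ε/2) (by positivity)
      obtain ⟨δ', hδ', h2⟩ := Metric.continuousAt_iff.1 ((hc k).continuousAt (x := x)) (ε/2) (by positivity)
      refine ⟨min δ (δ' / ((s.card : ℝ) + 1)), by positivity, fun h hh => ?_⟩
      have hh1 := lt_of_lt_of_le hh (min_le_left _ _)
      have hh2 := lt_of_lt_of_le hh (min_le_right _ _)
      rw [lt_div_iff₀ (by positivity)] at hh2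
      set v := ∑ i ∈ s, co i h • (ee i : Spc m) with hv
      have hvn : ‖v‖ ≤ s.card * ‖h‖ := by
        refine (norm_sum_le _ _).trans ?_
        rw [← nsmul_eq_mul]
        refine Finset.sum_le_card_nsmul _ _ _ fun i _ => ?_
        rw [norm_smul]
        exact (mul_le_mul (abs_co_le i h) (norm_ee_le i) (norm_nonneg _) (norm_nonneg _)).trans (by simp)
      have h3 : |f (x + v + co k h • ee k) - f (x + v) - co k h * fi k x| ≤ ε/2 * ‖h‖ := by
        have hD : ∀ s ∈ uIcc 0 (co k h), HasDerivWithinAt (fun s : ℝ => f (x + v + s • ee k) - s * fi k x)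
            (fi k (x + v + s • ee k) - fi k x) (uIcc 0 (co k h)) s := fun s _ => by
          have := (shift_hasDerivAt (hd k) (x + v) s).fun_sub ((hasDerivAt_id s).mul_const (fi k x))
          simpa using this.hasDerivWithinAt
        have hB : ∀ s ∈ uIcc 0 (co k h), ‖fi k (x + v + s • ee k) - fi k x‖ ≤ ε/2 := fun s hs => by
          refine (h2 ?_).le
          rw [dist_eq_norm, show x + v + s • ee k - x = v + s • ee k by abel]
          have hs' : |s| ≤ ‖h‖ := by
            have := abs_sub_left_of_mem_uIcc hs
            simp only [sub_zero] at this
            exact this.trans (abs_co_le k h)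
          have h5 : ‖s • (ee k : Spc m)‖ ≤ ‖h‖ := by
            rw [norm_smul]
            exact (mul_le_mul hs' (norm_ee_le k) (norm_nonneg _) (norm_nonneg _)).trans (by simp)
          have := norm_add_le v (s • ee k)
          nlinarith
        have := (convex_uIcc 0 (co k h)).norm_image_sub_le_of_norm_hasDerivWithin_le hD hB
          left_mem_uIcc right_mem_uIcc
        simp only [zero_smul, add_zero, zero_mul, sub_zero, Real.norm_eq_abs] at this
        rw [show f (x + v + co k h • ee k) - f (x + v) - co k h * fi k x =
          f (x + v + co k h • ee k) - co k h * fi k x - f (x + v) by ring]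
        exact this.trans (mul_le_mul_of_nonneg_left (abs_co_le k h) (by positivity))
      rw [Finset.sum_insert hk, Finset.sum_insert hk, show x + (co k h • ee k + v) = x + v + co k h • ee k by abel]
      have := abs_add_le (f (x + v + co k h • ee k) - f (x + v) - co k h * fi k x)
        (f (x + v) - f x - ∑ i ∈ s, co i h * fi i x)
      have h4 := h1 h hh1
      refine le_trans (le_of_eq ?_) (this.trans (show _ ≤ ε * ‖h‖ by linarith))
      congr 1; ring
  rw [hasFDerivAt_iff_isLittleO_nhds_zero, Asymptotics.isLittleO_iff]
  intro ε hε
  obtain ⟨δ, hδ, h1⟩ := key Finset.univ ε hε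
  filter_upwards [Metric.ball_mem_nhds (0 : Spc m) hδ] with h hh
  have := h1 h (by simpa using hh)
  rw [sum_co_ee] at this
  refine le_trans (le_of_eq ?_) this
  rw [Real.norm_eq_abs]; congr 2
  simp [ContinuousLinearMap.sum_apply, mul_comm]

structure C1P (f : Spc m → ℝ) (fi : Option (Fin m) → Spc m → ℝ) : Prop where
  per : Per f
  d : ∀ x, HasFDerivAt f (∑ i, fi i x • (co i : Spc m →L[ℝ] ℝ)) x
  c : ∀ i, Continuous (fi i)

lemma LD_of_fd {f : Spc m → ℝ} {fi : Option (Fin m) → Spc m → ℝ} (d : ∀ x, HasFDerivAt f (∑ i, fi i x • (co i : Spc m →L[ℝ] ℝ)) x) (k) :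
    LD k f (fi k) := by
  intro x
  have h1 : HasDerivAt (fun s : ℝ => x + s • (ee k : Spc m)) (ee k) 0 := by
    simpa using ((hasDerivAt_id (0:ℝ)).smul_const (ee k : Spc m)).const_add x
  have h2 := (d (x + (0:ℝ) • ee k)).comp_hasDerivAt (0:ℝ) h1
  have e : (∑ i, fi i (x + (0:ℝ) • ee k) • (co i : Spc m →L[ℝ] ℝ)) (ee k) = fi k x := by
    rw [ContinuousLinearMap.sum_apply, Finset.sum_eq_single k] <;> simp +contextual [co_ee]
  rwa [e] at h2

lemma LD.per {k : Option (Fin m)} {f fk : Spc m → ℝ} (h : LD k f fk) (hp : Per f) : Per fk := by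
  intro i x
  refine (h (x + ee i)).unique ?_
  refine (h x).congr_of_eventuallyEq (Eventually.of_forall fun s => ?_)
  show f (x + ee i + s • ee k) = f (x + s • ee k)
  rw [add_right_comm, hp]

lemma LD.add {k : Option (Fin m)} {f fk g gk : Spc m → ℝ} (h : LD k f fk) (h' : LD k g gk) :
    LD k (fun x => f x + g x) (fun x => fk x + gk x) := fun x => (h x).add (h' x)
lemma LD.sub {k : Option (Fin m)} {f fk g gk : Spc m → ℝ} (h : LD k f fk) (h' : LD k g gk) :
    LD k (fun x => f x - g x) (fun x => fk x - gk x) := fun x => (h x).sub (h' x)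
lemma LD.cmul {k : Option (Fin m)} {f fk : Spc m → ℝ} (c : ℝ) (h : LD k f fk) :
    LD k (fun x => c * f x) (fun x => c * fk x) := fun x => (h x).const_mul c
lemma LD.mul {k : Option (Fin m)} {f fk g gk : Spc m → ℝ} (h : LD k f fk) (h' : LD k g gk) :
    LD k (fun x => f x * g x) (fun x => fk x * g x + f x * gk x) := fun x => by
  simpa using (h x).fun_mul (h' x)
lemma LD.div {k : Option (Fin m)} {f fk g gk : Spc m → ℝ} (h : LD k f fk) (h' : LD k g gk) (h0 : ∀ x, g x ≠ 0) :
    LD k (fun x => f x / g x) (fun x => (fk x * g x - f x * gk x) / g x ^ 2) := fun x => by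
  simpa using (h x).fun_div (h' x) (by simpa using h0 x)
lemma LD.sum {ι : Type*} [Fintype ι] {k : Option (Fin m)} {f fk : ι → Spc m → ℝ} (h : ∀ i, LD k (f i) (fk i)) :
    LD k (fun x => ∑ i, f i x) (fun x => ∑ i, fk i x) := fun x => HasDerivAt.fun_sum fun i _ => h i x

namespace C1P
variable {f g : Spc m → ℝ} {fi gi : Option (Fin m) → Spc m → ℝ}
lemma ld (h : C1P f fi) (k) : LD k f (fi k) := LD_of_fd h.d k
lemma cont (h : C1P f fi) : Continuous f := continuous_iff_continuousAt.2 fun x => (h.d x).continuousAt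
lemma peri (h : C1P f fi) (k) : Per (fi k) := (h.ld k).per h.per
lemma of_LD (hp : Per f) (hd : ∀ i, LD i f (fi i)) (hc : ∀ i, Continuous (fi i)) : C1P f fi :=
  ⟨hp, fd_of_LD hd hc, hc⟩
lemma mul (h : C1P f fi) (h' : C1P g gi) : C1P (fun x => f x * g x) (fun i x => fi i x * g x + f x * gi i x) :=
  of_LD (fun i x => by simp only [h.per i x, h'.per i x]) (fun i => (h.ld i).mul (h'.ld i))
    (fun i => ((h.c i).mul h'.cont).add (h.cont.mul (h'.c i)))
lemma sub (h : C1P f fi) (h' : C1P g gi) : C1P (fun x => f x - g x) (fun i x => fi i x - gi i x) :=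
  of_LD (fun i x => by simp only [h.per i x, h'.per i x]) (fun i => (h.ld i).sub (h'.ld i))
    (fun i => (h.c i).sub (h'.c i))
lemma div (h : C1P f fi) (h' : C1P g gi) (h0 : ∀ x, g x ≠ 0) :
    C1P (fun x => f x / g x) (fun i x => (fi i x * g x - f x * gi i x) / g x ^ 2) :=
  of_LD (fun i x => by simp only [h.per i x, h'.per i x]) (fun i => (h.ld i).div (h'.ld i) h0)
    (fun i => (((h.c i).mul h'.cont).sub (h.cont.mul (h'.c i))).div (h'.cont.pow 2) fun x => pow_ne_zero 2 (h0 x))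
end C1P

lemma C1P.of_diff {f : Spc m → ℝ} (hp : Per f) (hd : Differentiable ℝ f) (hc : Continuous (fderiv ℝ f)) :
    C1P f (fun i => pd (ee i) f) where
  per := hp
  d x := by
    convert (hd x).hasFDerivAt using 1
    refine ContinuousLinearMap.ext fun v => ?_
    rw [clm_eq_sum (fderiv ℝ f x) v]
    simp [ContinuousLinearMap.sum_apply, pd, mul_comm]
  c i := hc.clm_apply continuous_const

lemma R0 {f : Spc m → ℝ} {fi} (h : C1P f fi) {p : ℝ} (hp : 1 ≤ p) (hex : 1/2 + ex m p < 1)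
    (hPL : ∀ i, PL p (fi i)) {ε : ℝ} (h0 : 0 < ε) (h1 : ε ≤ 1) (x : Spc m) :
    Tk kap ε f x - f x = ∑ i, Wop (1/2) (kap1 i) ε (fi i) x := by
  obtain ⟨C, _, hC⟩ := h.per.bounded h.cont
  choose C' hC'0 hC' using fun i => (h.peri i).bounded (h.c i)
  have hC'' : ∀ i x, |fi i x| ≤ ∑ j, C' j := fun i x =>
    (hC' i x).trans (Finset.single_le_sum (f := C') (fun j _ => hC'0 j) (Finset.mem_univ i))
  have hI : ∀ i, IntervalIntegrable (fun τ => τ ^ (-(1/2:ℝ)) * Tk (kap1 i) τ (fi i) x) volume 0 ε := fun i => by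
    obtain ⟨_, _, hh⟩ := W_all (m := m) hp hex (GB_kap1 i) (continuous_kap1 i)
    exact (hh _ (hPL i) x ε h0 h1).1
  have := intervalIntegral.integral_eq_sub_of_hasDerivAt_of_le h0.le
    (f := fun τ => Tk kap τ f x) (f' := fun τ => ∑ i, τ ^ (-(1/2:ℝ)) * Tk (kap1 i) τ (fi i) x)
    ((continuous_Tk_tau int_kap h.cont hC).comp (by fun_prop : Continuous fun τ : ℝ => (τ, x))).continuousOn
    (fun τ hτ => by
      have := Tk_tau_deriv h.d hC h.c hC'' hτ.1 x
      rwa [sqrt_inv_eq hτ.1, Finset.mul_sum] at this)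
    (by
      have := IntervalIntegrable.sum Finset.univ fun i _ => hI i
      rw [show (∑ i, fun τ => τ ^ (-(1/2:ℝ)) * Tk (kap1 i) τ (fi i) x) =
        fun τ => ∑ i, τ ^ (-(1/2:ℝ)) * Tk (kap1 i) τ (fi i) x by funext τ; rw [Finset.sum_apply]] at this
      exact this)
  rw [Tk_zero] at this
  rw [← this, intervalIntegral.integral_finset_sum fun i _ => hI i]
  rfl

lemma PL.of_bdd {f : Spc m → ℝ} (hp : Per f) (hm : Measurable f) {K : ℝ} (hK : ∀ x, |f x| ≤ K) {p : ℝ} (h1 : 1 ≤ p) :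
    PL p f ∧ nL p f ≤ K := by
  have hK0 : 0 ≤ K := (abs_nonneg _).trans (hK 0)
  have h2 : LpN p f ≤ ENNReal.ofReal K := by
    refine (eLpNorm_le_of_ae_bound (C := K) (Eventually.of_forall fun x => hK x)).trans ?_
    simp [μT, vol_cube]
  exact ⟨⟨hp, hm, lt_of_le_of_lt h2 ENNReal.ofReal_lt_top⟩, ENNReal.toReal_le_of_le_ofReal hK0 h2⟩

lemma PL.of_cont {f : Spc m → ℝ} (hp : Per f) (hm : Continuous f) {p : ℝ} (h1 : 1 ≤ p) : PL p f := by
  obtain ⟨K, _, hK⟩ := hp.bounded hm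
  exact (PL.of_bdd hp hm.measurable hK h1).1

section
variable {p : ℝ} {f g : Spc m → ℝ}
lemma PL.add (h1 : 1 ≤ p) (hf : PL p f) (hg : PL p g) : PL p (fun x => f x + g x) ∧
    nL p (fun x => f x + g x) ≤ nL p f + nL p g := by
  have h2 : LpN p (fun x => f x + g x) ≤ LpN p f + LpN p g :=
    eLpNorm_add_le hf.meas.aestronglyMeasurable hg.meas.aestronglyMeasurable (by simpa using h1)
  have h3 := ENNReal.add_lt_top.2 ⟨hf.fin, hg.fin⟩
  refine ⟨⟨fun i x => by simp only [hf.per i x, hg.per i x], hf.meas.add hg.meas, lt_of_le_of_lt h2 h3⟩, ?_⟩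
  rw [nL, nL, nL, ← ENNReal.toReal_add hf.fin.ne hg.fin.ne]
  exact ENNReal.toReal_mono h3.ne h2

lemma PL.bmul (hf : PL p f) (hp : Per g) (hm : Measurable g) {K : ℝ} (hK : ∀ x, |g x| ≤ K) :
    PL p (fun x => g x * f x) ∧ nL p (fun x => g x * f x) ≤ K * nL p f := by
  have hK0 : 0 ≤ K := (abs_nonneg _).trans (hK 0)
  have h2 : LpN p (fun x => g x * f x) ≤ ENNReal.ofReal K * LpN p f := by
    refine eLpNorm_le_mul_eLpNorm_of_ae_le_mul (Eventually.of_forall fun x => ?_) _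
    rw [norm_mul]; exact mul_le_mul_of_nonneg_right (hK x) (norm_nonneg _)
  have h3 := ENNReal.mul_lt_top (ENNReal.ofReal_lt_top (r := K)) hf.fin
  refine ⟨⟨fun i x => by simp only [hf.per i x, hp i x], hm.mul hf.meas, lt_of_le_of_lt h2 h3⟩, ?_⟩
  have := ENNReal.toReal_mono h3.ne h2
  rwa [ENNReal.toReal_mul, ENNReal.toReal_ofReal hK0] at this

lemma PL.cmul (hf : PL p f) (c : ℝ) : PL p (fun x => c * f x) :=
  (hf.bmul (g := fun _ => c) (fun _ _ => rfl) measurable_const (fun _ => le_rfl)).1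
lemma PL.sub (h1 : 1 ≤ p) (hf : PL p f) (hg : PL p g) : PL p (fun x => f x - g x) := by
  simpa [sub_eq_add_neg] using (hf.add h1 (hg.cmul (-1))).1
lemma PL.cbmul (hf : PL p f) (hp : Per g) (hm : Continuous g) : PL p (fun x => g x * f x) := by
  obtain ⟨K, _, hK⟩ := hp.bounded hm
  exact (hf.bmul hp hm.measurable hK).1
end

lemma PL.sum {ι : Type*} {p : ℝ} (h1 : 1 ≤ p) (s : Finset ι) {f : ι → Spc m → ℝ} (h : ∀ i, PL p (f i)) :
    PL p (fun x => ∑ i ∈ s, f i x) := by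
  classical
  induction s using Finset.induction_on with
  | empty => simpa using (PL.of_cont (f := fun _ : Spc m => (0:ℝ)) (fun _ _ => rfl) continuous_const h1)
  | insert k s hk ih => simpa [Finset.sum_insert hk] using ((h k).add h1 ih).1

end

section
set_option linter.all false
variable {m : ℕ}

def Mop (f : Spc m → ℝ) (x : Spc m) : ℝ := ∫ w in cube1 m, f (x.1, w)

instance instFinC1 : IsFiniteMeasure (volume.restrict (cube1 m)) :=
  ⟨by rw [Measure.restrict_apply_univ, vol_cube1]; exact one_lt_top⟩

lemma Mop_cont {f : Spc m → ℝ} (hp : Per f) (hc : Continuous f) : Continuous (Mop f) := by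
  obtain ⟨K, _, hK⟩ := hp.bounded hc
  exact continuous_of_dominated (bound := fun _ => K)
    (fun x => (hc.comp (by fun_prop)).aestronglyMeasurable) (fun x => Eventually.of_forall fun w => hK _)
    (integrable_const K) (Eventually.of_forall fun w => hc.comp (by fun_prop))

lemma Mop_per {f : Spc m → ℝ} (hp : Per f) : Per (Mop f) := by
  intro i x
  rcases i with _ | i
  · unfold Mop; congr 1; funext w
    rw [← hp none (x.1, w)]; simp [ee, e1]
  · simp [Mop, ee, eC]

def dM (fi : Option (Fin m) → Spc m → ℝ) : Option (Fin m) → Spc m → ℝ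
  | none => Mop (fi none)
  | some _ => fun _ => 0

lemma C1P.M {f : Spc m → ℝ} {fi} (h : C1P f fi) : C1P (Mop f) (dM fi) := by
  refine C1P.of_LD (Mop_per h.per) (fun i => ?_) (fun i => ?_)
  · rcases i with _ | i
    · intro x
      obtain ⟨K, _, hK⟩ := h.per.bounded h.cont
      obtain ⟨K', _, hK'⟩ := (h.peri none).bounded (h.c none)
      have := (hasDerivAt_integral_of_dominated_loc_of_deriv_le (μ := volume.restrict (cube1 m)) (s := univ)
        (F := fun (s : ℝ) w => f (x.1 + s, w)) (F' := fun s w => fi none (x.1 + s, w)) (x₀ := (0:ℝ))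
        (bound := fun _ => K') univ_mem
        (Eventually.of_forall fun s => (h.cont.comp (by fun_prop)).aestronglyMeasurable)
        (Integrable.mono' (integrable_const K) (h.cont.comp (by fun_prop)).aestronglyMeasurable
          (Eventually.of_forall fun w => hK _))
        ((h.c none).comp (by fun_prop)).aestronglyMeasurable
        (Eventually.of_forall fun w s _ => hK' _) (integrable_const K')
        (Eventually.of_forall fun w s _ => ?_)).2
      · simpa [Mop, dM, ee, e1] using this
      · have := shift_hasDerivAt (h.ld none) (x.1, w) s
        simpa [ee, e1] using this
    · intro x
      have : (fun s : ℝ => Mop f (x + s • ee (some i))) = fun _ => Mop f x := by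
        funext s; simp [Mop, ee, eC]
      rw [this]; exact hasDerivAt_const _ _
  · rcases i with _ | i
    · exact Mop_cont (h.peri none) (h.c none)
    · exact continuous_const

structure VH (V : Spc m → ℝ) : Prop where
  cd : ContDiff ℝ 2 V
  per : Per V

namespace VH
variable {V : Spc m → ℝ}
lemma c0 (h : VH V) : C1P V (fun i => pd (ee i) V) :=
  C1P.of_diff h.per (h.cd.differentiable (by norm_num)) (h.cd.continuous_fderiv (by norm_num))
lemma cdi (h : VH V) (i) : ContDiff ℝ 1 (pd (ee i) V) :=
  (h.cd.fderiv_right (m := 1) (by norm_num)).clm_apply contDiff_const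
lemma c1 (h : VH V) (i) : C1P (pd (ee i) V) (fun k => pd (ee k) (pd (ee i) V)) :=
  C1P.of_diff (h.c0.peri i) ((h.cdi i).differentiable (by norm_num)) ((h.cdi i).continuous_fderiv (by norm_num))
lemma symm (h : VH V) (i k) (x : Spc m) : pd (ee k) (pd (ee i) V) x = pd (ee i) (pd (ee k) V) x := by
  have hd : DifferentiableAt ℝ (fderiv ℝ V) x :=
    (h.cd.fderiv_right (m := 1) (by norm_num)).differentiable (by norm_num) x
  have e : ∀ i k, pd (ee k) (pd (ee i) V) x = fderiv ℝ (fderiv ℝ V) x (ee k) (ee i) := fun i k => by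
    show fderiv ℝ (fun y => fderiv ℝ V y (ee i)) x (ee k) = _
    rw [fderiv_clm_apply hd (by fun_prop)]
    simp
  rw [e, e]
  exact (h.cd.contDiffAt.isSymmSndFDerivAt (by simp)).eq _ _
end VH

structure UH (p : ℝ) (u : Spc m → ℝ) : Prop where
  c : C1P u (fun i => pd (ee i) u)
  l : ∀ j k, LD k (pd (ee j) u) (pd (ee k) (pd (ee j) u))
  pl : ∀ j k, PL p (pd (ee k) (pd (ee j) u))
  pos : ∀ x, 0 < Mop u x

lemma UH.mk' {p σ : ℝ} (hp : 1 ≤ p) {u : Spc m → ℝ} (h : MemW 2 p u) (h' : MemD σ p u) : UH p u := by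
  obtain ⟨hper, hm, hd, hd2, hn⟩ := h
  have hd := hd (by norm_num)
  have hd2 : Differentiable ℝ (fderiv ℝ u) := hd2 le_rfl
  have c := C1P.of_diff hper.per hd hd2.continuous
  have e : ∀ i k x, pd (ee k) (pd (ee i) u) x = fderiv ℝ (fderiv ℝ u) x (ee k) (ee i) := fun i k x => by
    show fderiv ℝ (fun y => fderiv ℝ u y (ee i)) x (ee k) = _
    rw [fderiv_clm_apply (hd2 x) (by fun_prop)]
    simp
  have l : ∀ j k, LD k (pd (ee j) u) (pd (ee k) (pd (ee j) u)) := fun j k x => by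
    have h1 : HasDerivAt (fun s : ℝ => x + s • (ee k : Spc m)) (ee k) 0 := by
      simpa using ((hasDerivAt_id (0:ℝ)).smul_const (ee k : Spc m)).const_add x
    have hdj : DifferentiableAt ℝ (pd (ee j) u) (x + (0:ℝ) • ee k) :=
      DifferentiableAt.clm_apply (hd2 _) (by fun_prop)
    have h2 := hdj.hasFDerivAt.comp_hasDerivAt (0:ℝ) h1
    simpa [pd, Function.comp_def] using h2
  refine ⟨c, l, fun j k => ⟨(l j k).per (c.peri j), measurable_fderiv_apply_const ℝ _ _, ?_⟩, fun x => h'.2 x.1⟩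
  have h3 : eLpNorm (fun x => ‖iteratedFDeriv ℝ 2 u x‖) (ENNReal.ofReal p) (μT m) < ⊤ := by
    unfold WNorm at hn
    norm_num at hn
    exact (eLpNorm_norm _).trans_lt hn.2
  refine lt_of_le_of_lt (eLpNorm_mono fun x => ?_) h3
  rw [e, Real.norm_of_nonneg (norm_nonneg _)]
  have := (iteratedFDeriv ℝ 2 u x).le_opNorm ![ee k, ee j]
  rw [iteratedFDeriv_two_apply] at this
  simp only [Matrix.cons_val_zero, Matrix.cons_val_one, Fin.prod_univ_two] at this
  refine this.trans ?_
  refine mul_le_of_le_one_right (norm_nonneg _) ?_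
  exact mul_le_one₀ (norm_ee_le k) (norm_nonneg _) (norm_ee_le j)

def phi (V u : Spc m → ℝ) (x : Spc m) : ℝ := Mop (fun y => pd (ee none) V y * u y) x / Mop u x

def phi1 (V u u1 : Spc m → ℝ) (x : Spc m) : ℝ :=
  (Mop (fun y => pd (ee none) (pd (ee none) V) y * u y + pd (ee none) V y * u1 y) x * Mop u x -
    Mop (fun y => pd (ee none) V y * u y) x * Mop u1 x) / Mop u x ^ 2

def bb (V u : Spc m → ℝ) : Option (Fin m) → Spc m → ℝ
  | none => fun x => pd (ee none) V x - phi V u x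
  | some i => pd (ee (some i)) V

def db (V u u1 : Spc m → ℝ) : Option (Fin m) → Option (Fin m) → Spc m → ℝ
  | none, none => fun x => pd (ee none) (pd (ee none) V) x - phi1 V u u1 x
  | i, k => pd (ee k) (pd (ee i) V)

lemma phi_C1 {V u : Spc m → ℝ} (hV : VH V) {p : ℝ} (hu : UH p u) :
    C1P (phi V u) (fun i x => if i = none then phi1 V u (pd (ee none) u) x else 0) := by
  have h := ((hV.c1 none).mul hu.c).M.div hu.c.M (fun x => (hu.pos x).ne')
  refine C1P.of_LD h.per (fun i => (h.ld i).congr fun x => ?_) (fun i => ?_)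
  · rcases i with _ | i <;> simp [dM, phi1]
  · have := h.c i
    refine this.congr fun x => ?_
    rcases i with _ | i <;> simp [dM, phi1]

lemma bb_C1 {V u : Spc m → ℝ} (hV : VH V) {p : ℝ} (hu : UH p u) (i) :
    C1P (bb V u i) (db V u (pd (ee none) u) i) := by
  rcases i with _ | i
  · have h := (hV.c1 none).sub (phi_C1 hV hu)
    refine C1P.of_LD h.per (fun i => (h.ld i).congr fun x => ?_) (fun i => ?_)
    · rcases i with _ | i <;> simp [db]
    · refine (h.c i).congr fun x => ?_
      rcases i with _ | i <;> simp [db]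
  · exact hV.c1 (some i)

lemma db_symm {V u u1 : Spc m → ℝ} (hV : VH V) (i k) (x) : db V u u1 i k x = db V u u1 k i x := by
  rcases i with _ | i <;> rcases k with _ | k
  · rfl
  all_goals exact hV.symm _ _ _

def rt (V : Spc m → ℝ) (β : ℝ) (u : Spc m → ℝ) (x : Spc m) : ℝ := β⁻¹ * lap u x + Fop V u x

lemma pd_eq {f fk : Spc m → ℝ} {fi} (h : C1P f fi) (k) (x : Spc m) : pd (ee k) f x = fi k x := by
  rw [pd, (h.d x).fderiv, ContinuousLinearMap.sum_apply, Finset.sum_eq_single k] <;> simp +contextual [co_ee]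

lemma rt_eq {V u : Spc m → ℝ} (hV : VH V) {p β : ℝ} (hβ : 0 < β) (hu : UH p u) (x : Spc m) :
    β * rt V β u x = ∑ i, (pd (ee i) (pd (ee i) u) x + β *
      (db V u (pd (ee none) u) i i x * u x + bb V u i x * pd (ee i) u x)) := by
  have h1 : pd (e1 m) (fun z => phiF V u z.1 * u z) x =
      phi1 V u (pd (ee none) u) x * u x + phi V u x * pd (ee none) u x := by
    have := pd_eq (fk := u) ((phi_C1 hV hu).mul hu.c) none x
    simp only [if_true] at this
    exact this
  unfold rt Fop
  rw [h1]
  simp only [lap, gradDot, Fintype.sum_option, db, bb, mul_add, add_mul, sub_mul, Finset.sum_add_distrib, Finset.mul_sum, mul_sub,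
    Finset.sum_mul]
  simp only [show e1 m = ee none from rfl, show ∀ i, eC m i = ee (some i) from fun _ => rfl]
  have hb : ∀ a, β * (β⁻¹ * a) = a := fun a => by field_simp
  simp only [hb]
  ring

lemma rt_PL {V u : Spc m → ℝ} (hV : VH V) {p β : ℝ} (hp : 1 ≤ p) (hβ : 0 < β) (hu : UH p u) : PL p (rt V β u) := by
  have e : rt V β u = fun x => β⁻¹ * ∑ i, (pd (ee i) (pd (ee i) u) x + β *
      (db V u (pd (ee none) u) i i x * u x + bb V u i x * pd (ee i) u x)) := by
    funext x; rw [← rt_eq hV hβ hu]; field_simp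
  rw [e]
  have hG : ∀ i, C1P _ _ := fun i => (bb_C1 hV hu i).mul hu.c
  exact (PL.sum hp _ fun i => ((hu.pl i i).add hp ((PL.of_cont ((hG i).peri i) ((hG i).c i) hp).cmul β)).1).cmul _

lemma star {V u : Spc m → ℝ} (hV : VH V) {p β : ℝ} (hp : 1 ≤ p) (hex : 1/2 + ex m p < 1) (hβ : 0 < β) (hu : UH p u)
    {ε : ℝ} (h0 : 0 < ε) (h1 : ε ≤ 1) (x : Spc m) :
    u x = Tk kap ε u x - β * Wop 0 kap ε (rt V β u) x +
      β * ∑ i, Wop (1/2) (kap1 i) ε (fun y => bb V u i y * u y) x := by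
  have hex0 : 0 + ex m p < 1 := by linarith
  have hG : ∀ i, C1P _ _ := fun i => (bb_C1 hV hu i).mul hu.c
  set G := fun i y => bb V u i y * u y with hGd
  set DG := fun i x => db V u (pd (ee none) u) i i x * u x + bb V u i x * pd (ee i) u x with hDG
  have hGPL : ∀ i, PL p (G i) := fun i => PL.of_cont (hG i).per (hG i).cont hp
  have hDGPL : ∀ i, PL p (DG i) := fun i => PL.of_cont ((hG i).peri i) ((hG i).c i) hp
  have hGLD : ∀ i, LD i (G i) (DG i) := fun i => (hG i).ld i
  have huPL : ∀ i, PL p (pd (ee i) u) := fun i => PL.of_cont (hu.c.peri i) (hu.c.c i) hp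
  have r0 := R0 hu.c hp hex huPL h0 h1 x
  have e1 : ∀ i, Wop (1/2) (kap1 i) ε (pd (ee i) u) x = Wop 0 kap ε (pd (ee i) (pd (ee i) u)) x := fun i => by
    obtain ⟨K, _, hK⟩ := (hu.c.peri i).bounded (hu.c.c i)
    exact W_ibp hp (hu.c.c i) hK (hu.l i i) (hu.pl i i) h0 h1 x
  have e2 : ∀ i, Wop (1/2) (kap1 i) ε (G i) x = Wop 0 kap ε (DG i) x := fun i => by
    obtain ⟨K, _, hK⟩ := (hG i).per.bounded (hG i).cont
    exact W_ibp hp (hG i).cont hK (hGLD i) (hDGPL i) h0 h1 x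
  obtain ⟨_, _, hW⟩ := W_all (m := m) hp hex0 GB_kap continuous_kap
  obtain ⟨_, _, hT⟩ := Tk_PL (m := m) hp GB_kap continuous_kap
  have e3 : β * Wop 0 kap ε (rt V β u) x =
      ∑ i, (Wop 0 kap ε (pd (ee i) (pd (ee i) u)) x + β * Wop 0 kap ε (DG i) x) := by
    unfold Wop
    simp_rw [← intervalIntegral.integral_const_mul]
    rw [Finset.sum_congr rfl fun i _ => (intervalIntegral.integral_add ((hW _ (hu.pl i i) x ε h0 h1).1)
      ((hW _ (hDGPL i) x ε h0 h1).1.const_mul β)).symm, ← intervalIntegral.integral_finset_sum fun i _ =>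
        ((hW _ (hu.pl i i) x ε h0 h1).1).add ((hW _ (hDGPL i) x ε h0 h1).1.const_mul β)]
    refine intervalIntegral.integral_congr_ae (Eventually.of_forall fun τ hτ => ?_)
    rw [uIoc_of_le h0.le] at hτ
    have e4 : β * Tk kap τ (rt V β u) x =
        ∑ i, (Tk kap τ (pd (ee i) (pd (ee i) u)) x + β * Tk kap τ (DG i) x) := by
      have hI := fun f hf => (hT f hf x τ hτ.1 (hτ.2.trans h1)).1
      unfold Tk
      simp_rw [← integral_const_mul]
      rw [Finset.sum_congr rfl fun i _ => (integral_add (hI _ (hu.pl i i)) ((hI _ (hDGPL i)).const_mul β)).symm,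
        ← integral_finset_sum _ fun i _ => show Integrable (fun a => kap a * pd (ee i) (pd (ee i) u) (x - √τ • a) +
          β * (kap a * DG i (x - √τ • a))) from (hI _ (hu.pl i i)).add ((hI _ (hDGPL i)).const_mul β)]
      congr 1; funext z
      rw [mul_left_comm, rt_eq hV hβ hu, Finset.mul_sum]
      refine Finset.sum_congr rfl fun i _ => ?_
      simp only [hDG]; ring
    rw [mul_left_comm, e4, Finset.mul_sum]
    refine Finset.sum_congr rfl fun i _ => by ring
  rw [e3, Finset.sum_add_distrib, ← Finset.mul_sum]
  rw [Finset.sum_congr rfl fun i _ => e1 i] at r0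
  rw [Finset.sum_congr rfl fun i _ => e2 i]
  linarith

end

section
set_option linter.all false
variable {m : ℕ}

lemma bdd_int {f : Spc m → ℝ} (hc : Measurable f) {K : ℝ} (hK : ∀ x, |f x| ≤ K) (x1 : ℝ) :
    Integrable (fun w => f (x1, w)) (volume.restrict (cube1 m)) :=
  Integrable.mono' (integrable_const K) (hc.comp (by fun_prop)).aestronglyMeasurable
    (Eventually.of_forall fun w => hK _)

lemma Mop_le {f : Spc m → ℝ} {K : ℝ} (hK : ∀ x, |f x| ≤ K) (x) : |Mop f x| ≤ K := by
  have := norm_integral_le_of_norm_le_const (μ := volume.restrict (cube1 m)) (f := fun w => f (x.1, w))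
    (Eventually.of_forall fun w => hK _)
  simpa [Mop, Measure.real, vol_cube1] using this

lemma Mop_Tk {g f : Spc m → ℝ} (hg : Integrable g) (hp : Per f) (hc : Continuous f) (τ : ℝ) (x : Spc m) :
    Mop (Tk g τ f) x = Tk g τ (Mop f) x := by
  obtain ⟨K, _, hK⟩ := hp.bounded hc
  unfold Mop Tk
  rw [integral_integral_swap]
  · congr 1; funext z
    rw [integral_const_mul]
    congr 1
    show _ = ∫ w in cube1 m, f ((x - √τ • z).1, w)
    rw [← cube1_int hp _ (-(√τ • z.2))]
    congr 1; funext w; congr 1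
    ext <;> simp; ring
  · have h1 : Integrable (fun q : (Fin m → ℝ) × Spc m => (1:ℝ) * g q.2) ((volume.restrict (cube1 m)).prod volume) :=
      (integrable_const (1:ℝ)).mul_prod hg
    have := h1.mul_bdd (c := K) (g := fun q : (Fin m → ℝ) × Spc m => f ((x.1, q.1) - √τ • q.2))
      (hc.comp (by fun_prop)).aestronglyMeasurable (Eventually.of_forall fun q => hK _)
    simpa [Function.uncurry_def] using this

lemma Mop_W {g f : Spc m → ℝ} (hg : Integrable g) (hp : Per f) (hc : Continuous f) {a ε : ℝ} (ha : a < 1) (h0 : 0 < ε)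
    (x : Spc m) : Mop (Wop a g ε f) x = Wop a g ε (Mop f) x := by
  obtain ⟨K, hK0, hK⟩ := hp.bounded hc
  unfold Wop
  have hT := continuous_Tk_tau hg hc hK
  simp only [Mop, intervalIntegral.integral_of_le h0.le]
  rw [integral_integral_swap]
  · congr 1; funext τ
    rw [integral_const_mul]
    congr 1
    exact Mop_Tk hg hp hc τ x
  · have hI : Integrable (fun τ : ℝ => τ ^ (-a)) (volume.restrict (Ioc 0 ε)) := by
      have := intervalIntegral.intervalIntegrable_rpow' (a := 0) (b := ε) (r := -a) (by linarith)
      rwa [intervalIntegrable_iff, uIoc_of_le h0.le] at this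
    have h1 : Integrable (fun q : (Fin m → ℝ) × ℝ => (1:ℝ) * q.2 ^ (-a))
      ((volume.restrict (cube1 m)).prod (volume.restrict (Ioc 0 ε))) :=
      (integrable_const (1:ℝ)).mul_prod hI
    have := h1.mul_bdd (c := (∫ z, |g z|) * K) (g := fun q : (Fin m → ℝ) × ℝ => Tk g q.2 f (x.1, q.1))
      (hT.comp (by fun_prop : Continuous fun q : (Fin m → ℝ) × ℝ => (q.2, ((x.1, q.1) : Spc m)))).aestronglyMeasurable
      (Eventually.of_forall fun q => Tk_bound hg hc.measurable hK _ _)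
    simpa [Function.uncurry_def] using this

lemma kap1_odd (j : Fin m) (z : Spc m) : kap1 (some j) (z.1, -z.2) = - kap1 (some j) z := by
  simp [kap1, kap, qd, co]; ring

lemma W_odd {f : Spc m → ℝ} (hf : ∀ x y : Spc m, x.1 = y.1 → f x = f y) (j : Fin m) (a ε : ℝ) (x : Spc m) :
    Wop a (kap1 (some j)) ε f x = 0 := by
  have : ∀ τ, Tk (kap1 (some j)) τ f x = 0 := fun τ => by
    have mp : MeasurePreserving (fun z : Spc m => ((z.1, -z.2) : Spc m)) volume volume :=
      (MeasurePreserving.id (volume : Measure ℝ)).prod (Measure.measurePreserving_neg (volume : Measure (Fin m → ℝ)))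
    have me : MeasurableEmbedding (fun z : Spc m => ((z.1, -z.2) : Spc m)) :=
      ((MeasurableEquiv.refl ℝ).prodCongr (MeasurableEquiv.neg (Fin m → ℝ))).measurableEmbedding
    have h := mp.integral_comp me (fun z => kap1 (some j) z * f (x - √τ • z))
    have h2 : ∀ z : Spc m, kap1 (some j) (z.1, -z.2) * f (x - √τ • (z.1, -z.2)) =
      -(kap1 (some j) z * f (x - √τ • z)) := fun z => by
      rw [kap1_odd, hf (x - √τ • (z.1, -z.2)) (x - √τ • z) (by simp)]; ring
    simp only [h2, integral_neg] at h
    unfold Tk; linarith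
  simp [Wop, this]

lemma W_zero (a ε : ℝ) (g : Spc m → ℝ) (x : Spc m) : Wop a g ε (fun _ => 0) x = 0 := by
  simp [Wop, Tk]

lemma Mop_G {V u : Spc m → ℝ} (hV : VH V) {p : ℝ} (hu : UH p u) (i) {ε : ℝ} (h0 : 0 < ε) (x : Spc m) :
    Mop (Wop (1/2) (kap1 i) ε (fun y => bb V u i y * u y)) x = 0 := by
  have hG := (bb_C1 hV hu i).mul hu.c
  rw [Mop_W (int_kap1 i) hG.per hG.cont (by norm_num) h0]
  rcases i with _ | i
  · have : Mop (fun y => bb V u none y * u y) = fun _ => 0 := by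
      funext y
      have hV1 := ((hV.c1 none).mul hu.c)
      obtain ⟨K, _, hK⟩ := hV1.per.bounded hV1.cont
      obtain ⟨K', _, hK'⟩ := hu.c.per.bounded hu.c.cont
      have e : ∀ w, bb V u none (y.1, w) * u (y.1, w) =
        pd (ee none) V (y.1, w) * u (y.1, w) - phi V u y * u (y.1, w) := fun w => by
        show (_ - phi V u (y.1, w)) * _ = _
        rw [sub_mul]; rfl
      show ∫ w in cube1 m, bb V u none (y.1, w) * u (y.1, w) = 0
      simp only [e]
      rw [integral_sub (bdd_int hV1.cont.measurable hK _) ((bdd_int hu.c.cont.measurable hK' _).const_mul _),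
        integral_const_mul, phi]
      have := (hu.pos y).ne'
      rw [show (∫ a in cube1 m, u (y.1, a)) = Mop u y from rfl, div_mul_cancel₀ _ this]
      exact sub_self _
    rw [this, W_zero]
  · exact W_odd (fun x y h => by simp only [Mop, h]) _ _ _ _

lemma jensen {u : Spc m → ℝ} (hm : Measurable u) {p : ℝ} (hp : 1 ≤ p) :
    LpN p (Mop fun y => |u y|) ≤ LpN p u := by
  have hp0 : 0 < p := by linarith
  have h3 : ∀ f : Spc m → ℝ, LpN p f = (∫⁻ w in cube m, ‖f w‖ₑ ^ p) ^ (1/p) := fun f => by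
    rw [LpN, eLpNorm_eq_lintegral_rpow_enorm_toReal (by simpa using hp0) ENNReal.ofReal_ne_top,
      ENNReal.toReal_ofReal hp0.le]
    rfl
  rw [h3, h3]
  refine ENNReal.rpow_le_rpow ?_ (by positivity)
  have hμ : (volume : Measure (Spc m)).restrict (cube m) =
      (volume.restrict (Ico (0:ℝ) 1)).prod (volume.restrict (cube1 m)) := by
    rw [cube, Measure.volume_eq_prod, Measure.prod_restrict]
  haveI : IsProbabilityMeasure (volume.restrict (cube1 m)) := ⟨by rw [Measure.restrict_apply_univ, vol_cube1]⟩
  have j1 : ∀ x1 : ℝ, ‖∫ w in cube1 m, |u (x1, w)|‖ₑ ^ p ≤ ∫⁻ w in cube1 m, ‖u (x1, w)‖ₑ ^ p := fun x1 => by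
    have h4 : ‖∫ w in cube1 m, |u (x1, w)|‖ₑ ≤ ∫⁻ w in cube1 m, ‖u (x1, w)‖ₑ := by
      refine (enorm_integral_le_lintegral_enorm _).trans (le_of_eq ?_)
      simp
    have h5 := eLpNorm'_le_eLpNorm'_of_exponent_le one_pos hp (volume.restrict (cube1 m))
      (f := fun w => u (x1, w)) (hm.comp (by fun_prop)).aestronglyMeasurable
    simp only [eLpNorm', ENNReal.rpow_one, div_one] at h5
    have := ENNReal.rpow_le_rpow (h4.trans h5) hp0.le
    rwa [← ENNReal.rpow_mul, one_div_mul_cancel hp0.ne', ENNReal.rpow_one] at this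
  have hsm : StronglyMeasurable (Mop fun y => |u y|) := by
    refine (StronglyMeasurable.integral_prod_right' (f := fun q : Spc m × (Fin m → ℝ) => |u (q.1.1, q.2)|) ?_)
    exact (Measurable.stronglyMeasurable (by fun_prop))
  have hmm := hsm.measurable
  rw [hμ, lintegral_prod _ (by fun_prop), lintegral_prod _ (by fun_prop)]
  refine lintegral_mono fun x1 => ?_
  show ∫⁻ y in cube1 m, ‖∫ w in cube1 m, |u (x1, w)|‖ₑ ^ p ≤ _
  rw [lintegral_const, measure_univ, mul_one]
  exact j1 x1

lemma phi_nL {V u : Spc m → ℝ} {p : ℝ} (hp : 1 ≤ p) (hV : VH V) (hu : UH p u) {C c : ℝ} (hC0 : 0 ≤ C)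
    (hC : ∀ x, |pd (ee none) V x| ≤ C) (hc0 : 0 < c) (hc : ∀ x, c ≤ Mop u x) :
    PL p (phi V u) ∧ nL p (phi V u) ≤ C / c * nL p u := by
  have hph := phi_C1 hV hu
  have hPL := PL.of_cont hph.per hph.cont hp
  have huPL := PL.of_cont hu.c.per hu.c.cont hp
  refine ⟨hPL, ?_⟩
  have h1 : ∀ x, ‖phi V u x‖ ≤ C / c * ‖Mop (fun y => |u y|) x‖ := fun x => by
    rw [phi, norm_div, div_mul_eq_mul_div]
    rw [Real.norm_of_nonneg (hu.pos x).le, Real.norm_of_nonneg (show 0 ≤ Mop (fun y => |u y|) x from integral_nonneg fun _ => abs_nonneg _)]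
    refine div_le_div₀ (mul_nonneg hC0 (integral_nonneg fun _ => abs_nonneg _)) ?_ hc0 (hc x)
    obtain ⟨K', _, hK'⟩ := hu.c.per.bounded hu.c.cont
    unfold Mop
    rw [← integral_const_mul]
    refine norm_integral_le_of_norm_le ((bdd_int hu.c.cont.measurable hK' x.1).abs.const_mul C)
      (Eventually.of_forall fun w => ?_)
    rw [norm_mul]; exact mul_le_mul_of_nonneg_right (hC _) (norm_nonneg _)
  have h2 : LpN p (phi V u) ≤ ENNReal.ofReal (C/c) * LpN p u :=
    (eLpNorm_le_mul_eLpNorm_of_ae_le_mul (Eventually.of_forall h1) _).trans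
      (by gcongr; exact jensen hu.c.cont.measurable hp)
  have h3 := ENNReal.toReal_mono (ENNReal.mul_lt_top ENNReal.ofReal_lt_top huPL.fin).ne h2
  rwa [ENNReal.toReal_mul, ENNReal.toReal_ofReal (by positivity)] at h3

end

section
set_option linter.all false
variable {m : ℕ}

open scoped Topology

lemma small_eps {a : ℝ} (ha : 0 < a) (M : ℝ) {η : ℝ} (hη : 0 < η) : ∃ ε : ℝ, 0 < ε ∧ ε ≤ 1 ∧ M * ε ^ a ≤ η := by
  have h : Tendsto (fun ε : ℝ => M * ε ^ a) (𝓝[>] 0) (𝓝 (M * 0 ^ a)) :=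
    ((Real.continuousAt_rpow_const 0 a (Or.inr ha.le)).tendsto.const_mul M).mono_left nhdsWithin_le_nhds
  rw [Real.zero_rpow ha.ne', mul_zero] at h
  obtain ⟨ε, h1, h2⟩ := ((h.eventually (gt_mem_nhds hη)).and (Ioc_mem_nhdsGT (zero_lt_one' ℝ))).exists
  exact ⟨ε, h2.1, h2.2, h1.le⟩

lemma gen_small {a b A C : ℝ} (ha : 0 < a) (hC : 0 ≤ C) {N : ℝ → ℝ} {t0 : ℝ} (hN : Tendsto N (𝓝 t0) (𝓝 0)) {d : ℝ → Spc m → ℝ}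
    (h : ∀ ε : ℝ, 0 < ε → ε ≤ 1 → ∀ᶠ t in 𝓝 t0, ∀ x, |d t x| ≤ A * ε ^ a + C * ε ^ (-b) * N t) {η : ℝ} (hη : 0 < η) :
    ∀ᶠ t in 𝓝 t0, ∀ x, |d t x| ≤ η := by
  obtain ⟨ε, h0, h1, h2⟩ := small_eps ha A (half_pos hη)
  have h3 : Tendsto (fun t => C * ε ^ (-b) * N t) (𝓝 t0) (𝓝 0) := by simpa using hN.const_mul (C * ε ^ (-b))
  filter_upwards [h ε h0 h1, h3.eventually (gt_mem_nhds (half_pos hη))] with t h4 h5 x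
  linarith [h4 x]

structure SOL (V : Spc m → ℝ) (β p : ℝ) (I : Set ℝ) (ψ : ℝ → Spc m → ℝ) : Prop where
  hV : VH V
  hβ : 0 < β
  hp : 1 ≤ p
  hex : 1/2 + ex m p < 1
  op : IsOpen I
  u : ∀ t ∈ I, UH p (ψ t)
  c : ∀ t ∈ I, Tendsto (fun s => nL p (fun x => ψ s x - ψ t x)) (𝓝 t) (𝓝 0)
  r : ∀ t ∈ I, Tendsto (fun s => nL p (fun x => rt V β (ψ s) x - rt V β (ψ t) x)) (𝓝 t) (𝓝 0)
  e : ∀ t ∈ I, Tendsto (fun h => nL p (fun x => (ψ (t + h) x - ψ t x) / h - rt V β (ψ t) x)) (𝓝[≠] 0) (𝓝 0)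

lemma isOpen_Ioo0 (T : ℝ≥0∞) : IsOpen (Ioo0 T) :=
  (isOpen_lt continuous_const continuous_id).inter (isOpen_lt ENNReal.continuous_ofReal continuous_const)

lemma contW_tendsto {p : ℝ} {s : Set ℝ} {f : ℝ → Spc m → ℝ} (h : ContW 0 p s f) {t : ℝ} (ht : t ∈ s) (hs : s ∈ 𝓝 t) :
    Tendsto (fun s => nL p (fun x => f s x - f t x)) (𝓝 t) (𝓝 0) := by
  rw [Metric.tendsto_nhds]
  intro ε hε
  obtain ⟨δ, hδ, H⟩ := h t ht ε hε
  filter_upwards [hs, Metric.ball_mem_nhds t hδ] with t' h1 h2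
  have := H t' h1 (by simpa [Real.dist_eq] using h2)
  rw [WNorm, if_pos le_rfl] at this
  rw [Real.dist_eq, sub_zero, abs_of_nonneg (nL_nonneg _ _)]
  exact (ENNReal.toReal_lt_of_lt_ofReal this)

lemma SOL.mk' {V : Spc m → ℝ} {β σ p : ℝ} {ψ0 T ψ} (hV : ContDiff ℝ 2 V) (hVp : IsPeriodic V) (hβ : 0 < β) (h2 : Hyp2 m σ p)
    (h : IsLpSolution V β σ p ψ0 T ψ) : SOL V β p (Ioo0 T) ψ where
  hV := ⟨hV, hVp.per⟩
  hβ := hβ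
  hp := by have := h2.2.1; have : (0:ℝ) ≤ m := by positivity
           linarith
  hex := by
    have := h2.2.1
    have h0 : (0:ℝ) ≤ m := by positivity
    unfold ex
    have : ((m:ℝ)+1)/(2*p) < 1/2 := by rw [div_lt_div_iff₀ (by linarith) (by norm_num)]; linarith
    linarith
  op := isOpen_Ioo0 T
  u := fun t ht => UH.mk' (by have := h2.2.1; have : (0:ℝ) ≤ m := by positivity
                              linarith) (h.regW2 t ht) (h.regD t ht)
  c := fun t ht => contW_tendsto (s := Ico0 T) h.contLp ⟨ht.1.le, ht.2⟩
    (mem_of_superset ((isOpen_Ioo0 T).mem_nhds ht) fun s hs => ⟨hs.1.le, hs.2⟩)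
  r := fun t ht => contW_tendsto h.derivCont ht ((isOpen_Ioo0 T).mem_nhds ht)
  e := fun t ht => by
    have := (ENNReal.tendsto_toReal ENNReal.zero_ne_top).comp (h.eqn t ht)
    exact this

lemma Mop_sub {f g : Spc m → ℝ} (hf : Per f) (hfc : Continuous f) (hg : Per g) (hgc : Continuous g) (x : Spc m) :
    Mop (fun y => f y - g y) x = Mop f x - Mop g x := by
  obtain ⟨K, _, hK⟩ := hf.bounded hfc
  obtain ⟨K', _, hK'⟩ := hg.bounded hgc
  exact integral_sub (bdd_int hfc.measurable hK _) (bdd_int hgc.measurable hK' _)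

lemma Tk_per {g f : Spc m → ℝ} (hf : Per f) (τ : ℝ) : Per (Tk g τ f) := fun i x => by
  unfold Tk; congr 1; funext z; rw [add_sub_right_comm, hf]

lemma Wop_per {g f : Spc m → ℝ} (hf : Per f) (a τ : ℝ) : Per (Wop a g τ f) := fun i x => by
  unfold Wop; simp only [Tk_per hf _ i x]

lemma ap1 {V : Spc m → ℝ} (hV : VH V) {p β : ℝ} (hp : 1 ≤ p) (hex : 1/2 + ex m p < 1) (hβ : 0 < β) :
    ∃ C, 0 ≤ C ∧ ∀ u, UH p u → ∀ ε : ℝ, 0 < ε → ε ≤ 1 → ∀ x : Spc m,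
      |Mop u x - Mop (Tk kap ε u) x| ≤ C * ε ^ (1 - ex m p) * nL p (rt V β u) := by
  obtain ⟨C, hC, H⟩ := W_all (m := m) hp (a := 0) (by linarith) GB_kap continuous_kap
  refine ⟨β * C, by positivity, fun u hu ε h0 h1 x => ?_⟩
  have hrt := rt_PL hV hp hβ hu
  set G : Spc m → ℝ := fun y => ∑ i, Wop (1/2) (kap1 i) ε (fun y => bb V u i y * u y) y with hG
  have hGi : ∀ i, C1P _ _ := fun i => (bb_C1 hV hu i).mul hu.c
  have hci : ∀ i, Continuous (Wop (1/2) (kap1 i) ε (fun y => bb V u i y * u y)) := fun i =>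
    W_cont hp hex (GB_kap1 i) (continuous_kap1 i) (PL.of_cont (hGi i).per (hGi i).cont hp) h0 h1
  have hpi : ∀ i, Per (Wop (1/2) (kap1 i) ε (fun y => bb V u i y * u y)) := fun i => Wop_per (hGi i).per _ _
  have hGc : Continuous G := continuous_finset_sum _ fun i _ => hci i
  have hGp : Per G := fun k x => Finset.sum_congr rfl fun i _ => hpi i k x
  have hMG : Mop G x = 0 := by
    show ∫ w in cube1 m, ∑ i, _ = 0
    rw [integral_finset_sum]
    · exact Finset.sum_eq_zero fun i _ => Mop_G hV hu i h0 x
    · intro i _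
      obtain ⟨K, _, hK⟩ := (hpi i).bounded (hci i)
      exact bdd_int (hci i).measurable hK _
  have hTc := Tk_cont hp GB_kap continuous_kap (PL.of_cont hu.c.per hu.c.cont hp) h0 h1
  have hTp : Per (Tk kap ε u) := Tk_per hu.c.per ε
  have hβG : Mop (fun y => β * G y) x = 0 := by
    show ∫ w in cube1 m, β * _ = 0
    rw [integral_const_mul, show (∫ w in cube1 m, G (x.1, w)) = 0 from hMG, mul_zero]
  have key : Mop (fun y => (u y - Tk kap ε u y) - β * G y) x = Mop u x - Mop (Tk kap ε u) x := by
    rw [Mop_sub (f := fun y => u y - Tk kap ε u y) (g := fun y => β * G y) (fun i x => by simp only [hu.c.per i x, hTp i x]) (hu.c.cont.sub hTc)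
      (fun i x => by simp only [hGp i x]) (by fun_prop), hβG, Mop_sub hu.c.per hu.c.cont hTp hTc, sub_zero]
  rw [← key]
  refine Mop_le (fun y => ?_) x
  have hs := star hV hp hex hβ hu h0 h1 y
  have : u y - Tk kap ε u y - β * G y = -(β * Wop 0 kap ε (rt V β u) y) := by
    rw [hs]; simp only [hG]; ring
  rw [this, abs_neg, abs_mul, abs_of_pos hβ]
  have := (H _ hrt y ε h0 h1).2
  rw [sub_zero] at this
  calc β * _ ≤ β * _ := mul_le_mul_of_nonneg_left this hβ.le
    _ = _ := by ring

lemma bb_nL {V : Spc m → ℝ} (hV : VH V) {p : ℝ} (hp : 1 ≤ p) : ∃ C, 0 ≤ C ∧ ∀ u, UH p u → ∀ K c : ℝ,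
    (∀ x, |u x| ≤ K) → 0 < c → (∀ x, c ≤ Mop u x) → ∀ i, nL p (fun y => bb V u i y * u y) ≤ C * (1 + K / c) * nL p u := by
  choose C hC0 hC using fun i => (hV.c1 i).per.bounded (hV.c1 i).cont
  refine ⟨∑ i, C i, Finset.sum_nonneg fun i _ => hC0 i, fun u hu K c hK hc hcu i => ?_⟩
  have hPL := PL.of_cont hu.c.per hu.c.cont hp
  have hK0 : 0 ≤ K := (abs_nonneg _).trans (hK 0)
  have h1 := hPL.bmul (hV.c1 i).per (hV.c1 i).cont.measurable (hC i)
  have hle : C i ≤ ∑ i, C i := Finset.single_le_sum (fun i _ => hC0 i) (Finset.mem_univ i)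
  have hn := nL_nonneg p u
  have hKc : 0 ≤ K / c := by positivity
  have hfin : C i * (1 + K / c) * nL p u ≤ (∑ i, C i) * (1 + K/c) * nL p u := by gcongr
  refine le_trans ?_ hfin
  rcases i with _ | i
  · obtain ⟨h2, h3⟩ := phi_nL hp hV hu (hC0 none) (hC none) hc hcu
    have h4 := h2.bmul (g := fun y => - u y) (fun i x => by simp only [hu.c.per i x]) (hu.c.cont.neg.measurable) (K := K) (fun x => by rw [abs_neg]; exact hK x)
    have h5 := (h1.1.add hp h4.1).2
    have e : (fun y => bb V u none y * u y) = fun x => pd (ee none) V x * u x + -u x * phi V u x := by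
      funext y; simp only [bb]; ring
    rw [e]
    refine h5.trans ?_
    have := mul_le_mul_of_nonneg_left h3 hK0
    calc _ ≤ C none * nL p u + K * (C none / c * nL p u) := add_le_add h1.2 (h4.2.trans this)
      _ = _ := by ring
  · refine h1.2.trans ?_
    have := hC0 (some i)
    have : 0 ≤ C (some i) * (K/c) * nL p u := by positivity
    linarith [mul_add (C (some i)) 1 (K/c), add_mul (C (some i)) (C (some i) * (K/c)) (nL p u), congrArg (· * nL p u) (mul_add (C (some i)) 1 (K/c))]

lemma ap2 {V : Spc m → ℝ} (hV : VH V) {p β : ℝ} (hp : 1 ≤ p) (hex : 1/2 + ex m p < 1) (hβ : 0 < β) :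
    ∃ C, 0 ≤ C ∧ ∀ u, UH p u → ∀ K c : ℝ, (∀ x, |u x| ≤ K) → 0 < c → (∀ x, c ≤ Mop u x) → ∀ ε : ℝ, 0 < ε → ε ≤ 1 → ∀ x : Spc m,
      |u x - Tk kap ε u x| ≤ C * ε ^ (1/2 - ex m p) * (nL p (rt V β u) + (1 + K / c) * nL p u) := by
  obtain ⟨C, hC, H⟩ := W_all (m := m) hp (a := 0) (by linarith) GB_kap continuous_kap
  choose C1 hC1 H1 using fun i => W_all (m := m) hp (a := 1/2) hex (GB_kap1 i) (continuous_kap1 i)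
  obtain ⟨C2, hC2, H2⟩ := bb_nL hV hp
  have hS : 0 ≤ ∑ i, C1 i * C2 := Finset.sum_nonneg fun i _ => mul_nonneg (hC1 i) hC2
  refine ⟨β * (C + ∑ i, C1 i * C2), by positivity, fun u hu K c hK hc hcu ε h0 h1 x => ?_⟩
  have hK0 : 0 ≤ K := (abs_nonneg _).trans (hK 0)
  set e := ε ^ (1/2 - ex m p) with he
  have he0 : 0 ≤ e := by positivity
  have hs := star hV hp hex hβ hu h0 h1 x
  have e1 : u x - Tk kap ε u x = β * (∑ i, Wop (1/2) (kap1 i) ε (fun y => bb V u i y * u y) x - Wop 0 kap ε (rt V β u) x) := by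
    linarith
  rw [e1, abs_mul, abs_of_pos hβ, mul_assoc, mul_assoc]
  refine mul_le_mul_of_nonneg_left ?_ hβ.le
  have hw := (H _ (rt_PL hV hp hβ hu) x ε h0 h1).2
  have hw1 : |Wop 0 kap ε (rt V β u) x| ≤ C * e * nL p (rt V β u) := hw.trans (by
    have : ε ^ (1 - 0 - ex m p) ≤ e := Real.rpow_le_rpow_of_exponent_ge h0 h1 (by linarith)
    have := nL_nonneg p (rt V β u)
    gcongr)
  have hw2 : |∑ i, Wop (1/2) (kap1 i) ε (fun y => bb V u i y * u y) x| ≤ (∑ i, C1 i * C2) * e * ((1 + K / c) * nL p u) := by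
    refine (Finset.abs_sum_le_sum_abs _ _).trans ?_
    rw [mul_assoc, Finset.sum_mul]
    refine Finset.sum_le_sum fun i _ => ?_
    have hG := (bb_C1 hV hu i).mul hu.c
    refine (H1 i _ (PL.of_cont hG.per hG.cont hp) x ε h0 h1).2.trans ?_
    have := H2 u hu K c hK hc hcu i
    have e2 : (1:ℝ) - 1/2 - ex m p = 1/2 - ex m p := by ring
    rw [e2]
    calc _ ≤ C1 i * e * (C2 * (1 + K / c) * nL p u) := mul_le_mul_of_nonneg_left this (mul_nonneg (hC1 i) he0)
      _ = _ := by ring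
  have hn1 := nL_nonneg p (rt V β u)
  have hn2 := nL_nonneg p u
  have h3 : 0 ≤ (1 + K/c) * nL p u := by positivity
  have := (abs_sub _ _).trans (add_le_add hw2 hw1)
  refine this.trans ?_
  have p1 : 0 ≤ C * e * ((1 + K/c) * nL p u) := by positivity
  have p2 : 0 ≤ (∑ i, C1 i * C2) * e * nL p (rt V β u) := by positivity
  nlinarith

lemma nL_near {p : ℝ} (hp : 1 ≤ p) {f : ℝ → Spc m → ℝ} {t : ℝ} {I : Set ℝ} (hI : I ∈ 𝓝 t) (hf : ∀ s ∈ I, PL p (f s))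
    (h : Tendsto (fun s => nL p (fun x => f s x - f t x)) (𝓝 t) (𝓝 0)) : ∀ᶠ s in 𝓝 t, nL p (f s) ≤ nL p (f t) + 1 := by
  filter_upwards [hI, h.eventually (gt_mem_nhds one_pos)] with s hs h1
  have := (((hf s hs).sub hp (hf t (mem_of_mem_nhds hI))).add hp (hf t (mem_of_mem_nhds hI))).2
  simp only [sub_add_cancel] at this
  linarith

lemma Tk_sub {p : ℝ} (hp : 1 ≤ p) {g : Spc m → ℝ} (hg : GB g) (hc : Continuous g) {f f' : Spc m → ℝ} (hf : PL p f) (hf' : PL p f')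
    {τ : ℝ} (h0 : 0 < τ) (h1 : τ ≤ 1) (x : Spc m) : Tk g τ (fun y => f y - f' y) x = Tk g τ f x - Tk g τ f' x := by
  obtain ⟨C, _, H⟩ := Tk_PL hp hg hc
  unfold Tk; simp only [mul_sub]
  exact integral_sub (H f hf x τ h0 h1).1 (H f' hf' x τ h0 h1).1

namespace SOL
variable {V : Spc m → ℝ} {β p : ℝ} {I : Set ℝ} {ψ : ℝ → Spc m → ℝ}

lemma pl (h : SOL V β p I ψ) {t} (ht : t ∈ I) : PL p (ψ t) := PL.of_cont (h.u t ht).c.per (h.u t ht).c.cont h.hp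
lemma rpl (h : SOL V β p I ψ) {t} (ht : t ∈ I) : PL p (rt V β (ψ t)) := rt_PL h.hV h.hp h.hβ (h.u t ht)

lemma nears (h : SOL V β p I ψ) {t} (ht : t ∈ I) : ∃ R, 0 < R ∧ ∀ᶠ s in 𝓝 t, s ∈ I ∧ nL p (ψ s) ≤ R ∧ nL p (rt V β (ψ s)) ≤ R := by
  have hI := h.op.mem_nhds ht
  refine ⟨(nL p (ψ t) + 1) + (nL p (rt V β (ψ t)) + 1), by linarith [nL_nonneg p (ψ t), nL_nonneg p (rt V β (ψ t))], ?_⟩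
  filter_upwards [hI, nL_near h.hp hI (fun s hs => h.pl hs) (h.c t ht), nL_near h.hp hI (fun s hs => h.rpl hs) (h.r t ht)] with s h0 h1 h2
  exact ⟨h0, by linarith [nL_nonneg p (rt V β (ψ t))], by linarith [nL_nonneg p (ψ t)]⟩

lemma contM (h : SOL V β p I ψ) {t} (ht : t ∈ I) {η : ℝ} (hη : 0 < η) :
    ∀ᶠ s in 𝓝 t, ∀ x, |Mop (ψ s) x - Mop (ψ t) x| ≤ η := by
  obtain ⟨R, hR, hev⟩ := h.nears ht
  obtain ⟨C, hC, H⟩ := ap1 h.hV h.hp h.hex h.hβ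
  obtain ⟨C', hC', H'⟩ := Tk_PL (m := m) h.hp GB_kap continuous_kap
  refine gen_small (a := 1 - ex m p) (b := ex m p) (A := 2 * C * R) (C := C') (by linarith [h.hex]) hC' (h.c t ht) (fun ε h0 h1 => ?_) hη
  have ht2 := (mem_of_mem_nhds hev : _)
  filter_upwards [hev] with s hs x
  have u1 := h.u s hs.1
  have u0 := h.u t ht
  have a1 := H _ u1 ε h0 h1 x
  have a0 := H _ u0 ε h0 h1 x
  have tc := fun {s} (hs : s ∈ I) => Tk_cont h.hp GB_kap continuous_kap (h.pl hs) h0 h1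
  have tp := fun {s} (hs : s ∈ I) => Tk_per (g := kap) (h.u s hs).c.per ε
  have a2 : |Mop (Tk kap ε (ψ s)) x - Mop (Tk kap ε (ψ t)) x| ≤ C' * ε ^ (-ex m p) * nL p (fun x => ψ s x - ψ t x) := by
    rw [← Mop_sub (tp hs.1) (tc hs.1) (tp ht) (tc ht)]
    refine Mop_le (fun y => ?_) x
    rw [← Tk_sub h.hp GB_kap continuous_kap (h.pl hs.1) (h.pl ht) h0 h1]
    exact (H' _ ((h.pl hs.1).sub h.hp (h.pl ht)) y ε h0 h1).2
  have b1 : C * ε ^ (1 - ex m p) * nL p (rt V β (ψ s)) ≤ C * ε ^ (1 - ex m p) * R := by gcongr; exact hs.2.2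
  have b0 : C * ε ^ (1 - ex m p) * nL p (rt V β (ψ t)) ≤ C * ε ^ (1 - ex m p) * R := by gcongr; exact ht2.2.2
  rw [abs_le] at *
  constructor <;> linarith [a1.1, a1.2, a0.1, a0.2, a2.1, a2.2]

lemma lowM (h : SOL V β p I ψ) {t} (ht : t ∈ I) : ∃ c, 0 < c ∧ ∀ᶠ s in 𝓝 t, ∀ x, c ≤ Mop (ψ s) x := by
  have u0 := h.u t ht
  have hc := Mop_cont u0.c.per u0.c.cont
  obtain ⟨K, hK0, hK⟩ := Per.bounded (f := fun x => (Mop (ψ t) x)⁻¹) (fun i x => by simp only [Mop_per u0.c.per i x])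
    (hc.inv₀ fun x => (u0.pos x).ne')
  have hl : ∀ x, (K+1)⁻¹ ≤ Mop (ψ t) x := fun x => by
    rw [inv_le_comm₀ (by positivity) (u0.pos x)]
    linarith [le_abs_self (Mop (ψ t) x)⁻¹, hK x]
  have hp : 0 < (K+1)⁻¹ := by positivity
  refine ⟨(K+1)⁻¹/2, by positivity, ?_⟩
  filter_upwards [h.contM ht (half_pos hp)] with s hs x
  linarith [hl x, (abs_le.1 (hs x)).1]

lemma locbdd (h : SOL V β p I ψ) {t} (ht : t ∈ I) : ∃ K, 0 ≤ K ∧ ∀ᶠ s in 𝓝 t, ∀ x, |ψ s x| ≤ K := by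
  obtain ⟨R, hR, hev⟩ := h.nears ht
  obtain ⟨c, hc, hl⟩ := h.lowM ht
  obtain ⟨C, hC, H⟩ := ap2 h.hV h.hp h.hex h.hβ
  obtain ⟨C', hC', H'⟩ := Tk_PL (m := m) h.hp GB_kap continuous_kap
  obtain ⟨ε, h0, h1, h2⟩ := small_eps (a := 1/2 - ex m p) (by linarith [h.hex]) (C * R / c) (half_pos one_pos)
  refine ⟨2 * (C' * ε ^ (-ex m p) * R + C * ε ^ (1/2 - ex m p) * (2 * R)), by positivity, ?_⟩
  filter_upwards [hev, hl] with s hs hl x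
  have u1 := h.u s hs.1
  obtain ⟨K0, hK0', hK0⟩ := u1.c.per.bounded u1.c.cont
  have hbd : BddAbove (range fun x => |ψ s x|) := ⟨K0, by rintro _ ⟨x, rfl⟩; exact hK0 x⟩
  set K := ⨆ x, |ψ s x| with hKd
  have hK : ∀ x, |ψ s x| ≤ K := fun x => le_ciSup hbd x
  have hKp : 0 ≤ K := (abs_nonneg _).trans (hK 0)
  have hn := nL_nonneg p (ψ s)
  have : K ≤ C' * ε ^ (-ex m p) * R + C * ε ^ (1/2 - ex m p) * (2 * R) + 1/2 * K := by
    refine ciSup_le fun x => ?_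
    have a1 := H _ u1 K c hK hc hl ε h0 h1 x
    have a2 := (H' _ (h.pl hs.1) x ε h0 h1).2
    have b1 : C' * ε ^ (-ex m p) * nL p (ψ s) ≤ C' * ε ^ (-ex m p) * R := by gcongr; exact hs.2.1
    have b2 : C * ε ^ (1/2 - ex m p) * (nL p (rt V β (ψ s)) + (1 + K / c) * nL p (ψ s)) ≤
      C * ε ^ (1/2 - ex m p) * (R + (1 + K / c) * R) := by gcongr; exacts [hs.2.2, hs.2.1]
    have b3 : C * ε ^ (1/2 - ex m p) * (R + (1 + K / c) * R) =
      C * ε ^ (1/2 - ex m p) * (2 * R) + (C * R / c * ε ^ (1/2 - ex m p)) * K := by field_simp; ring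
    have b4 := mul_le_mul_of_nonneg_right h2 hKp
    have := abs_sub_abs_le_abs_sub (ψ s x) (Tk kap ε (ψ s) x)
    linarith
  linarith [hK x]

lemma contE (h : SOL V β p I ψ) {t} (ht : t ∈ I) {η : ℝ} (hη : 0 < η) :
    ∀ᶠ s in 𝓝 t, ∀ x, |ψ s x - ψ t x| ≤ η := by
  obtain ⟨R, hR, hev⟩ := h.nears ht
  obtain ⟨c, hc, hl⟩ := h.lowM ht
  obtain ⟨K, hK0, hK⟩ := h.locbdd ht
  obtain ⟨C, hC, H⟩ := ap2 h.hV h.hp h.hex h.hβ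
  obtain ⟨C', hC', H'⟩ := Tk_PL (m := m) h.hp GB_kap continuous_kap
  have hall := hev.and (hl.and hK)
  have hb : ∀ s, ((s ∈ I ∧ nL p (ψ s) ≤ R ∧ nL p (rt V β (ψ s)) ≤ R) ∧ (∀ x, c ≤ Mop (ψ s) x) ∧ ∀ x, |ψ s x| ≤ K) →
    ∀ ε : ℝ, 0 < ε → ε ≤ 1 → ∀ x, |ψ s x - Tk kap ε (ψ s) x| ≤ C * ε ^ (1/2 - ex m p) * (R + (1 + K / c) * R) := by
    intro s hs ε h0 h1 x
    refine (H _ (h.u s hs.1.1) K c hs.2.2 hc hs.2.1 ε h0 h1 x).trans ?_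
    have hn := nL_nonneg p (ψ s)
    gcongr
    exacts [hs.1.2.2, hs.1.2.1]
  refine gen_small (a := 1/2 - ex m p) (b := ex m p) (A := 2 * (C * (R + (1 + K / c) * R))) (C := C') (by linarith [h.hex]) hC' (h.c t ht) (fun ε h0 h1 => ?_) hη
  filter_upwards [hall] with s hs x
  have a1 := hb s hs ε h0 h1 x
  have a0 := hb t (mem_of_mem_nhds hall : _) ε h0 h1 x
  have a2 := (H' _ ((h.pl hs.1.1).sub h.hp (h.pl ht)) x ε h0 h1).2
  rw [Tk_sub h.hp GB_kap continuous_kap (h.pl hs.1.1) (h.pl ht) h0 h1] at a2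
  rw [abs_le] at *
  constructor <;> linarith [a1.1, a1.2, a0.1, a0.2, a2.1, a2.2]
end SOL

end

section
set_option linter.all false
variable {m : ℕ}

open scoped Topology BoundedContinuousFunction

section avg
variable {Ω Y Y' : Type*} [MeasurableSpace Ω] [TopologicalSpace Y] [MeasurableSpace Y] [BorelSpace Y]
  [TopologicalSpace Y'] [FirstCountableTopology Y']

structure SG (σ : Ω → Y' → Y) : Prop where
  m : ∀ y, Measurable (fun ω => σ ω y)
  c : ∀ ω, Continuous (σ ω)

lemma SG.int {σ : Ω → Y' → Y} (h : SG σ) {ν : Measure Ω} {k : Ω → ℝ} (hk : Integrable k ν) (u : Y →ᵇ ℝ) (y : Y') :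
    Integrable (fun ω => k ω * u (σ ω y)) ν :=
  hk.mul_bdd (c := ‖u‖) (u.continuous.measurable.comp (h.m y)).aestronglyMeasurable
    (Eventually.of_forall fun ω => u.norm_coe_le_norm _)

lemma SG.bd {σ : Ω → Y' → Y} (h : SG σ) {ν : Measure Ω} {k : Ω → ℝ} (hk : Integrable k ν) (u : Y →ᵇ ℝ) (y : Y') :
    ‖∫ ω, k ω * u (σ ω y) ∂ν‖ ≤ (∫ ω, ‖k ω‖ ∂ν) * ‖u‖ := by
  rw [← integral_mul_const]
  refine norm_integral_le_of_norm_le (hk.norm.mul_const _) (Eventually.of_forall fun ω => ?_)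
  rw [norm_mul]; gcongr; exact u.norm_coe_le_norm _

lemma SG.cont {σ : Ω → Y' → Y} (h : SG σ) {ν : Measure Ω} {k : Ω → ℝ} (hk : Integrable k ν) (u : Y →ᵇ ℝ) :
    Continuous (fun y => ∫ ω, k ω * u (σ ω y) ∂ν) := by
  refine continuous_of_dominated (bound := fun ω => ‖k ω‖ * ‖u‖) (fun y => (h.int hk u y).1) (fun y => ?_) (hk.norm.mul_const _) ?_
  · refine Eventually.of_forall fun ω => ?_
    rw [norm_mul]; gcongr; exact u.norm_coe_le_norm _
  · exact Eventually.of_forall fun ω => continuous_const.mul (u.continuous.comp (h.c ω))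

def avgF (ν : Measure Ω) {σ : Ω → Y' → Y} (h : SG σ) (k : Ω →₁[ν] ℝ) (u : Y →ᵇ ℝ) : Y' →ᵇ ℝ :=
  BoundedContinuousFunction.ofNormedAddCommGroup (fun y => ∫ ω, k ω * u (σ ω y) ∂ν) (h.cont (L1.integrable_coeFn k) u)
    (‖k‖ * ‖u‖) (fun y => by rw [L1.norm_eq_integral_norm]; exact h.bd (L1.integrable_coeFn k) u y)

lemma avgF_apply (ν : Measure Ω) {σ : Ω → Y' → Y} (h : SG σ) (k : Ω →₁[ν] ℝ) (u : Y →ᵇ ℝ) (y : Y') :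
    avgF ν h k u y = ∫ ω, k ω * u (σ ω y) ∂ν := rfl

lemma avgF_norm (ν : Measure Ω) {σ : Ω → Y' → Y} (h : SG σ) (k : Ω →₁[ν] ℝ) (u : Y →ᵇ ℝ) : ‖avgF ν h k u‖ ≤ ‖k‖ * ‖u‖ :=
  BoundedContinuousFunction.norm_ofNormedAddCommGroup_le _ (by positivity)
    (fun y => by rw [L1.norm_eq_integral_norm]; exact h.bd (L1.integrable_coeFn k) u y)

def avg (ν : Measure Ω) {σ : Ω → Y' → Y} (h : SG σ) : (Ω →₁[ν] ℝ) →L[ℝ] (Y →ᵇ ℝ) →L[ℝ] (Y' →ᵇ ℝ) :=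
  LinearMap.mkContinuous₂ (LinearMap.mk₂ ℝ (avgF ν h)
    (fun k k' u => by
      ext y
      simp only [avgF_apply, BoundedContinuousFunction.add_apply]
      rw [← integral_add (h.int (L1.integrable_coeFn k) u y) (h.int (L1.integrable_coeFn k') u y)]
      refine integral_congr_ae ?_
      filter_upwards [Lp.coeFn_add k k'] with ω hω
      rw [hω, Pi.add_apply, add_mul])
    (fun c k u => by
      ext y
      simp only [avgF_apply, BoundedContinuousFunction.smul_apply, smul_eq_mul]
      rw [← integral_const_mul]
      refine integral_congr_ae ?_
      filter_upwards [Lp.coeFn_smul c k] with ω hω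
      rw [hω, Pi.smul_apply, smul_eq_mul, mul_assoc])
    (fun k u u' => by
      ext y
      simp only [avgF_apply, BoundedContinuousFunction.add_apply, mul_add]
      exact integral_add (h.int (L1.integrable_coeFn k) u y) (h.int (L1.integrable_coeFn k) u' y))
    (fun c k u => by
      ext y
      simp only [avgF_apply, BoundedContinuousFunction.smul_apply, smul_eq_mul]
      rw [← integral_const_mul]
      congr 1; funext ω; ring)) 1
    (fun k u => by
      rw [one_mul]
      exact avgF_norm ν h k u)

lemma avg_apply (ν : Measure Ω) {σ : Ω → Y' → Y} (h : SG σ) {k : Ω → ℝ} (hk : Integrable k ν) (u : Y →ᵇ ℝ) (y : Y') :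
    avg ν h (hk.toL1 k) u y = ∫ ω, k ω * u (σ ω y) ∂ν := by
  show avgF ν h (hk.toL1 k) u y = _
  rw [avgF_apply]
  refine integral_congr_ae ?_
  filter_upwards [hk.coeFn_toL1] with ω hω
  rw [hω]
end avg

section ker
variable {Ω : Type*} [MeasurableSpace Ω] {ν : Measure Ω}
abbrev SM : WithTop ℕ∞ := ((⊤ : ℕ∞) : WithTop ℕ∞)

structure GQ (ν : Measure Ω) (q g : Ω → ℝ) : Prop where
  qm : Measurable q
  q0 : ∀ ω, 0 ≤ q ω
  i : ∀ μ, 0 < μ → Integrable (fun ω => g ω * Real.exp (-μ * q ω)) ν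

lemma GQ.mulq {q g : Ω → ℝ} (h : GQ ν q g) : GQ ν q (fun ω => -(q ω * g ω)) where
  qm := h.qm
  q0 := h.q0
  i := fun μ hμ => by
    have h1 := ((h.i (μ/2) (half_pos hμ)).mul_bdd (g := fun ω => -(q ω * Real.exp (-(μ/2) * q ω))) (c := 2/μ)
      (by have := h.qm; fun_prop) (Eventually.of_forall fun ω => ?_))
    · refine h1.congr (Eventually.of_forall fun ω => ?_)
      have : Real.exp (-μ * q ω) = Real.exp (-(μ/2) * q ω) * Real.exp (-(μ/2) * q ω) := by rw [← Real.exp_add]; congr 1; ring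
      simp only [this]; ring
    · rw [norm_neg, norm_mul, Real.norm_of_nonneg (h.q0 ω), Real.norm_of_nonneg (Real.exp_pos _).le]
      have h2 : μ/2 * q ω ≤ Real.exp (μ/2 * q ω) := by linarith [Real.add_one_le_exp (μ/2 * q ω)]
      have h3 : Real.exp (-(μ/2) * q ω) = (Real.exp (μ/2 * q ω))⁻¹ := by rw [← Real.exp_neg]; congr 1; ring
      rw [h3, ← div_eq_mul_inv, div_le_div_iff₀ (Real.exp_pos _) hμ]
      linarith

open Classical in
def Kc (ν : Measure Ω) (q g : Ω → ℝ) (μ : ℝ) : Ω →₁[ν] ℝ :=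
  if h : Integrable (fun ω => g ω * Real.exp (-μ * q ω)) ν then h.toL1 _ else 0

lemma GQ.Kc_eq {q g : Ω → ℝ} (h : GQ ν q g) {μ : ℝ} (hμ : 0 < μ) : Kc ν q g μ = (h.i μ hμ).toL1 _ := by
  rw [Kc, dif_pos (h.i μ hμ)]

lemma exp_quad (x : ℝ) : |Real.exp x - 1 - x| ≤ x ^ 2 * Real.exp |x| := by
  have := Complex.norm_exp_sub_sum_le_norm_mul_exp x 2
  simp only [Finset.sum_range_succ, Finset.range_zero, Finset.sum_empty, pow_zero, pow_one, Nat.factorial, Nat.cast_one, div_one, zero_add] at this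
  norm_num [← sub_sub] at this
  rw [← Complex.ofReal_exp, ← Complex.ofReal_one, ← Complex.ofReal_sub, ← Complex.ofReal_sub, Complex.norm_real, Real.norm_eq_abs] at this
  exact this

lemma GQ.deriv {q g : Ω → ℝ} (h : GQ ν q g) {μ : ℝ} (hμ : 0 < μ) :
    HasDerivAt (Kc ν q g) (Kc ν q (fun ω => -(q ω * g ω)) μ) μ := by
  have h2 := h.mulq.mulq.i (μ/2) (half_pos hμ)
  rw [hasDerivAt_iff_isLittleO_nhds_zero]
  have hO : (fun t : ℝ => Kc ν q g (μ + t) - Kc ν q g μ - t • Kc ν q (fun ω => -(q ω * g ω)) μ) =O[𝓝 0] fun t : ℝ => t ^ 2 := by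
    refine Asymptotics.IsBigO.of_bound (∫ ω, ‖(-(q ω * -(q ω * g ω))) * Real.exp (-(μ/2) * q ω)‖ ∂ν) ?_
    filter_upwards [Metric.ball_mem_nhds (0:ℝ) (half_pos hμ)] with t ht
    rw [mem_ball_zero_iff, Real.norm_eq_abs] at ht
    have ht' := abs_lt.1 ht
    rw [h.Kc_eq hμ, h.Kc_eq (μ := μ + t) (by linarith), h.mulq.Kc_eq hμ, ← Integrable.toL1_smul, ← Integrable.toL1_sub,
      ← Integrable.toL1_sub, L1.norm_of_fun_eq_integral_norm, Real.norm_of_nonneg (sq_nonneg t), ← integral_mul_const]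
    refine integral_mono_of_nonneg (Eventually.of_forall fun ω => norm_nonneg _) (h2.norm.mul_const _) (Eventually.of_forall fun ω => ?_)
    have q0 := h.q0 ω
    have e1 : Real.exp (-(μ + t) * q ω) = Real.exp (-μ * q ω) * Real.exp (-t * q ω) := by rw [← Real.exp_add]; congr 1; ring
    have e2 : g ω * Real.exp (-(μ + t) * q ω) - g ω * Real.exp (-μ * q ω) - t * (-(q ω * g ω) * Real.exp (-μ * q ω)) =
      g ω * Real.exp (-μ * q ω) * (Real.exp (-t * q ω) - 1 - -t * q ω) := by rw [e1]; ring
    simp only [Pi.sub_apply, Pi.smul_apply, smul_eq_mul]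
    rw [e2, norm_mul, norm_mul, norm_mul, Real.norm_of_nonneg (Real.exp_pos _).le, Real.norm_of_nonneg (Real.exp_pos _).le,
      show ‖-(q ω * -(q ω * g ω))‖ = q ω ^ 2 * ‖g ω‖ by
        rw [mul_neg, neg_neg, norm_mul, norm_mul, Real.norm_of_nonneg q0]; ring]
    have e3 := exp_quad (-t * q ω)
    have e4 : Real.exp (-μ * q ω) * Real.exp |-t * q ω| ≤ Real.exp (-(μ/2) * q ω) := by
      rw [← Real.exp_add, Real.exp_le_exp, abs_mul, abs_neg, abs_of_nonneg q0]
      nlinarith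
    calc ‖g ω‖ * Real.exp (-μ * q ω) * ‖Real.exp (-t * q ω) - 1 - -t * q ω‖
        ≤ ‖g ω‖ * Real.exp (-μ * q ω) * ((-t * q ω) ^ 2 * Real.exp |-t * q ω|) := by gcongr; exact e3
      _ = ‖g ω‖ * (q ω ^ 2 * t ^ 2) * (Real.exp (-μ * q ω) * Real.exp |-t * q ω|) := by ring
      _ ≤ ‖g ω‖ * (q ω ^ 2 * t ^ 2) * Real.exp (-(μ/2) * q ω) := by gcongr
      _ = _ := by ring
  refine hO.trans_isLittleO ?_
  simpa [pow_one] using (Asymptotics.isLittleO_pow_pow (𝕜 := ℝ) (m := 1) (n := 2) (by norm_num))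

lemma GQ.smooth_nat {q : Ω → ℝ} (n : ℕ) : ∀ {g : Ω → ℝ}, GQ ν q g → ContDiffOn ℝ n (Kc ν q g) (Ioi 0) := by
  induction n with
  | zero => intro g h; exact contDiffOn_zero.2 fun μ hμ => (h.deriv hμ).continuousAt.continuousWithinAt
  | succ n ih =>
    intro g h
    rw [show ((n+1 : ℕ) : WithTop ℕ∞) = (n : WithTop ℕ∞) + 1 by push_cast; rfl, contDiffOn_succ_iff_deriv_of_isOpen isOpen_Ioi]
    refine ⟨fun μ hμ => (h.deriv hμ).differentiableAt.differentiableWithinAt, by simp, ?_⟩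
    exact (ih h.mulq).congr fun μ hμ => (h.deriv hμ).deriv

lemma GQ.smooth {q g : Ω → ℝ} (h : GQ ν q g) {μ : ℝ} (hμ : 0 < μ) : ContDiffAt ℝ SM (Kc ν q g) μ :=
  (contDiffOn_infty.2 fun n => GQ.smooth_nat n h).contDiffAt (isOpen_Ioi.mem_nhds hμ)
end ker

end

section
set_option linter.all false
variable {m : ℕ}

open scoped Topology BoundedContinuousFunction

lemma ift {U : Type*} [NormedAddCommGroup U] [NormedSpace ℝ U] [CompleteSpace U] {Φ : ℝ × U → U} {c : ℝ → U} {l0 : ℝ}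
    (cd : ContDiffAt ℝ SM Φ (l0, c l0)) (hc : ContinuousAt c l0) (heq : ∀ᶠ l in 𝓝 l0, c l = Φ (l, c l))
    {L : NNReal} (hL : L < 1) {s : Set U} (hs : s ∈ 𝓝 (c l0)) (hlip : LipschitzOnWith L (fun u => Φ (l0, u)) s) :
    ContDiffAt ℝ SM c l0 := by
  set f : ℝ × U → U := fun v => v.2 - Φ v with hf
  have cdf : ContDiffAt ℝ SM f (l0, c l0) := contDiffAt_snd.sub cd
  have hn : SM ≠ 0 := by simp [SM]
  have hd := cd.differentiableAt hn
  set K : U →L[ℝ] U := (fderiv ℝ Φ (l0, c l0)).comp (.inr ℝ ℝ U) with hK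
  have h1 : HasFDerivAt (fun u => Φ (l0, u)) K (c l0) :=
    hd.hasFDerivAt.comp (c l0) (hasFDerivAt_prodMk_right l0 (c l0))
  have h2 : ‖K‖ < 1 := lt_of_le_of_lt (h1.le_of_lipschitzOn hs hlip) (by exact_mod_cast hL)
  have h3 : (fderiv ℝ f (l0, c l0)).comp (.inr ℝ ℝ U) = 1 - K := by
    rw [hf, fderiv_fun_sub differentiableAt_snd hd, fderiv_snd]
    ext u; simp [hK]
  have if2 : ((fderiv ℝ f (l0, c l0)).comp (.inr ℝ ℝ U)).IsInvertible := by
    rw [h3]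
    obtain ⟨e, he⟩ := (isUnit_one_sub_of_norm_lt_one h2)
    exact ⟨ContinuousLinearEquiv.unitsEquiv ℝ U e, by rw [← he]; rfl⟩
  have h4 := cdf.contDiffAt_implicitFunction hn if2
  refine h4.congr_of_eventuallyEq ?_
  have h5 := cdf.eventually_apply_eq_iff_implicitFunction hn if2
  have h6 : Tendsto (fun l => (l, c l)) (𝓝 l0) (𝓝 (l0, c l0)) := (continuousAt_id.prodMk hc).tendsto
  have h7 : f (l0, c l0) = 0 := by simp only [hf]; rw [← mem_of_mem_nhds heq]; exact sub_self _
  filter_upwards [h6.eventually h5, heq] with l h8 h9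
  refine (h8.1 ?_).symm
  rw [h7]; simp only [hf]; rw [← h9, sub_self]

abbrev Yt (m : ℕ) := unitInterval × Spc m
abbrev Om (m : ℕ) := ℝ × Spc m
def nuO (m : ℕ) : Measure (Om m) := (volume.restrict (Ioc (0:ℝ) 1)).prod volume
def sgK (ω : Om m) (y : Yt m) : Yt m := (projIcc 0 1 zero_le_one ((y.1 : ℝ) * (1 - ω.1)), y.2 - √(y.1 * ω.1) • ω.2)
def sgP (z : Spc m) (y : Yt m) : Spc m := y.2 - √(y.1 : ℝ) • z
def sgB (ω : Om m) (x : Spc m) : Spc m := x - √ω.1 • ω.2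
def sgM (w : Fin m → ℝ) (y : Yt m) : Yt m := (y.1, (y.2.1, w))
def sgM0 (w : Fin m → ℝ) (x : Spc m) : Spc m := (x.1, w)

lemma SG_K : SG (sgK (m := m)) where
  m y := by
    have : Continuous fun ω : Om m => sgK ω y := by unfold sgK; exact (continuous_projIcc.comp (by fun_prop)).prodMk (by fun_prop)
    exact this.measurable
  c ω := by unfold sgK; exact (continuous_projIcc.comp (by fun_prop)).prodMk (by fun_prop)
lemma SG_P : SG (sgP (m := m)) where
  m y := by unfold sgP; exact (Continuous.measurable (by fun_prop))
  c ω := by unfold sgP; fun_prop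
lemma SG_B : SG (sgB (m := m)) where
  m y := by unfold sgB; exact (Continuous.measurable (by fun_prop))
  c ω := by unfold sgB; fun_prop
lemma SG_M : SG (sgM (m := m)) where
  m y := by unfold sgM; exact (Continuous.measurable (by fun_prop))
  c ω := by unfold sgM; fun_prop
lemma SG_M0 : SG (sgM0 (m := m)) where
  m y := by unfold sgM0; exact (Continuous.measurable (by fun_prop))
  c ω := by unfold sgM0; fun_prop

def gK (i : Option (Fin m)) (ω : Om m) : ℝ := ω.1 ^ (-(1/2) : ℝ) * co i ω.2

lemma GQ_one : GQ (volume : Measure (Spc m)) qd (fun _ => 1) where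
  qm := continuous_qd.measurable
  q0 := qd_nonneg
  i μ hμ := by simpa using integrable_gauss (m := m) hμ

lemma int_co (i) {μ : ℝ} (hμ : 0 < μ) : Integrable (fun z : Spc m => co i z * Real.exp (-μ * qd z)) := by
  have h1 := (GQ_one (m := m)).i μ hμ
  have h2 := (GQ_one (m := m)).mulq.i μ hμ
  refine (h1.sub h2).mono' (by have := continuous_qd (m := m); exact (Continuous.aestronglyMeasurable (by fun_prop)))
    (Eventually.of_forall fun z => ?_)
  rw [norm_mul, Real.norm_of_nonneg (Real.exp_pos _).le]
  have := mul_le_mul_of_nonneg_right (abs_co_le_qd i z) (Real.exp_pos (-μ * qd z)).le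
  simp only [Pi.sub_apply, Real.norm_eq_abs]
  linarith

lemma int_half (ε : ℝ) (h0 : 0 ≤ ε) : Integrable (fun τ : ℝ => τ ^ (-(1/2) : ℝ)) (volume.restrict (Ioc 0 ε)) := by
  have := intervalIntegral.intervalIntegrable_rpow' (a := 0) (b := ε) (r := -(1/2)) (by norm_num)
  rwa [intervalIntegrable_iff, uIoc_of_le h0] at this

lemma GQ_K (i) : GQ (nuO m) (fun ω => qd ω.2) (gK i) where
  qm := continuous_qd.measurable.comp measurable_snd
  q0 ω := qd_nonneg _
  i μ hμ := by
    have := (int_half 1 zero_le_one).mul_prod (int_co (m := m) i hμ)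
    refine this.congr (Eventually.of_forall fun ω => ?_)
    simp only [gK]; ring

def dP (m : ℕ) (β l : ℝ) : ℝ := c0 m * (√(l/β) ^ (m+1))⁻¹
def dK (m : ℕ) (β l : ℝ) : ℝ := -(c0 m / 2) * l * (√(l/β) ^ (m+3))⁻¹

lemma cv {β l : ℝ} (hβ : 0 < β) (hl : 0 < l) (F : Spc m → ℝ) :
    (√(l/β) ^ (m+1))⁻¹ * ∫ z, F z = ∫ z, F (√(l/β) • z) := by
  have h := Measure.integral_comp_smul (volume : Measure (Spc m)) F (√(l/β))
  have hs : 0 < √(l/β) := Real.sqrt_pos.2 (by positivity)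
  rw [h, finrank_Spc, smul_eq_mul, abs_of_pos (by positivity)]

lemma qd_cv {β l : ℝ} (hβ : 0 < β) (hl : 0 < l) (z : Spc m) : -(β/(4*l)) * qd (√(l/β) • z) = -(1/4) * qd z := by
  rw [qd_smul, Real.sq_sqrt (by positivity)]; field_simp

lemma cvP {β l : ℝ} (hβ : 0 < β) (hl : 0 < l) (F : Spc m → ℝ) :
    dP m β l * ∫ z, 1 * Real.exp (-(β/(4*l)) * qd z) * F z = ∫ z, kap z * F (√(l/β) • z) := by
  rw [dP, mul_assoc, cv hβ hl, ← integral_const_mul]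
  congr 1; funext z; rw [qd_cv hβ hl, kap]; ring

lemma cvK {β l : ℝ} (hβ : 0 < β) (hl : 0 < l) (i) (F : Spc m → ℝ) :
    dK m β l * ∫ z, co i z * Real.exp (-(β/(4*l)) * qd z) * F z = l * (√(l/β))⁻¹ * ∫ z, kap1 i z * F (√(l/β) • z) := by
  have hs : 0 < √(l/β) := Real.sqrt_pos.2 (by positivity)
  have : dK m β l = (-(c0 m / 2) * l * (√(l/β) ^ 2)⁻¹) * (√(l/β) ^ (m+1))⁻¹ := by
    rw [dK, show m + 3 = 2 + (m+1) by ring, pow_add, mul_inv]; ring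
  rw [this, mul_assoc, cv hβ hl, ← integral_const_mul, ← integral_const_mul]
  congr 1; funext z; rw [qd_cv hβ hl, kap1, kap, map_smul, smul_eq_mul]; field_simp

def kP (m : ℕ) (β l : ℝ) : (Spc m) →₁[volume] ℝ := dP m β l • Kc volume qd (fun _ => 1) (β/(4*l))
def kK (m : ℕ) (β l : ℝ) (i : Option (Fin m)) : (Om m) →₁[nuO m] ℝ := dK m β l • Kc (nuO m) (fun ω => qd ω.2) (gK i) (β/(4*l))

lemma sm_aux {β l : ℝ} (hβ : 0 < β) (hl : 0 < l) : ContDiffAt ℝ SM (fun l : ℝ => √(l/β)) l ∧ ContDiffAt ℝ SM (fun l : ℝ => β/(4*l)) l :=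
  ⟨(Real.contDiffAt_sqrt (by positivity : l/β ≠ 0)).comp l (by fun_prop), contDiffAt_const.div (by fun_prop) (by positivity)⟩

lemma kP_smooth {β l : ℝ} (hβ : 0 < β) (hl : 0 < l) : ContDiffAt ℝ SM (kP m β) l := by
  have hs : 0 < √(l/β) := Real.sqrt_pos.2 (by positivity)
  have h1 : ContDiffAt ℝ SM (dP m β) l := contDiffAt_const.mul (((sm_aux hβ hl).1.pow _).inv (by positivity))
  have h2 : ContDiffAt ℝ SM (fun l => Kc (volume : Measure (Spc m)) qd (fun _ => 1) (β/(4*l))) l :=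
    ContDiffAt.comp l (GQ_one.smooth (by positivity : 0 < β/(4*l))) (sm_aux hβ hl).2
  exact h1.smul h2

lemma kK_smooth {β l : ℝ} (hβ : 0 < β) (hl : 0 < l) (i) : ContDiffAt ℝ SM (fun l => kK m β l i) l := by
  have hs : 0 < √(l/β) := Real.sqrt_pos.2 (by positivity)
  have h1 : ContDiffAt ℝ SM (dK m β) l := (contDiffAt_const.mul contDiffAt_id).mul (((sm_aux hβ hl).1.pow _).inv (by positivity))
  have h2 : ContDiffAt ℝ SM (fun l => Kc (nuO m) (fun ω => qd ω.2) (gK i) (β/(4*l))) l :=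
    ContDiffAt.comp l ((GQ_K i).smooth (by positivity : 0 < β/(4*l))) (sm_aux hβ hl).2
  exact h1.smul h2

lemma avgP {β l : ℝ} (hβ : 0 < β) (hl : 0 < l) (u : Spc m →ᵇ ℝ) (y : Yt m) :
    avg volume SG_P (kP m β l) u y = Tk kap (l * y.1 / β) u y.2 := by
  have hμ : 0 < β/(4*l) := by positivity
  rw [kP, map_smul, ContinuousLinearMap.smul_apply, BoundedContinuousFunction.smul_apply, GQ_one.Kc_eq hμ, avg_apply, smul_eq_mul,
    cvP hβ hl, Tk]
  congr 1; funext z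
  rw [sgP, smul_smul, ← Real.sqrt_mul' _ (by positivity), show l * (y.1:ℝ) / β = y.1 * (l/β) by ring]

lemma avgK {β l : ℝ} (hβ : 0 < β) (hl : 0 < l) (i) (u : Yt m →ᵇ ℝ) (y : Yt m) :
    IntervalIntegrable (fun ρ : ℝ => l * (√(l/β))⁻¹ * (ρ ^ (-(1/2) : ℝ) * ∫ z, kap1 i z * u (sgK (ρ, √(l/β) • z) y))) volume 0 1 ∧
    avg (nuO m) SG_K (kK m β l i) u y =
      ∫ ρ in (0:ℝ)..1, l * (√(l/β))⁻¹ * (ρ ^ (-(1/2) : ℝ) * ∫ z, kap1 i z * u (sgK (ρ, √(l/β) • z) y)) := by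
  have hμ : 0 < β/(4*l) := by positivity
  have hI := (SG_K.int ((GQ_K i).i _ hμ) u y).const_mul (dK m β l)
  have e : ∀ ρ : ℝ, (∫ z, dK m β l * (gK i (ρ, z) * Real.exp (-(β/(4*l)) * qd z) * u (sgK (ρ, z) y))) =
      l * (√(l/β))⁻¹ * (ρ ^ (-(1/2) : ℝ) * ∫ z, kap1 i z * u (sgK (ρ, √(l/β) • z) y)) := fun ρ => by
    have := cvK hβ hl i (fun z => u (sgK (ρ, z) y))
    rw [mul_left_comm, ← this, ← integral_const_mul, ← integral_const_mul]
    congr 1; funext z; simp only [gK]; ring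
  constructor
  · have := hI.integral_prod_left
    simp only [e] at this
    rw [intervalIntegrable_iff, uIoc_of_le zero_le_one]
    exact this
  · rw [kK, map_smul, ContinuousLinearMap.smul_apply, BoundedContinuousFunction.smul_apply, (GQ_K i).Kc_eq hμ, avg_apply, smul_eq_mul,
      ← integral_const_mul, intervalIntegral.integral_of_le zero_le_one]
    rw [show nuO m = (volume.restrict (Ioc (0:ℝ) 1)).prod volume from rfl, integral_prod _ hI]
    simp only [e]

lemma avgK_norm {β : ℝ} (hβ : 0 < β) (i) : ∃ C, 0 ≤ C ∧ ∀ l : ℝ, 0 < l → ∀ u : Yt m →ᵇ ℝ,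
    ‖avg (nuO m) SG_K (kK m β l i) u‖ ≤ C * √l * ‖u‖ := by
  have hJ := int_half 1 zero_le_one
  set J := ∫ τ in Ioc (0:ℝ) 1, τ ^ (-(1/2) : ℝ) with hJd
  have hJ0 : 0 ≤ J := integral_nonneg_of_ae ((ae_restrict_iff' measurableSet_Ioc).2 (Eventually.of_forall fun τ hτ => Real.rpow_nonneg hτ.1.le _))
  have hK0 : 0 ≤ ∫ z : Spc m, ‖kap1 i z‖ := integral_nonneg fun _ => norm_nonneg _
  refine ⟨√β * (J * ∫ z : Spc m, ‖kap1 i z‖), by positivity, fun l hl u => ?_⟩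
  rw [BoundedContinuousFunction.norm_le (by positivity)]
  intro y
  rw [(avgK hβ hl i u y).2, intervalIntegral.integral_const_mul, norm_mul]
  have e1 : ‖l * (√(l/β))⁻¹‖ = √β * √l := by
    rw [Real.norm_of_nonneg (by positivity), Real.sqrt_div hl.le, inv_div]
    have : √l ≠ 0 := (Real.sqrt_pos.2 hl).ne'
    field_simp
    rw [Real.sq_sqrt hl.le]
  have e2 : ‖∫ ρ in (0:ℝ)..1, ρ ^ (-(1/2) : ℝ) * ∫ z, kap1 i z * u (sgK (ρ, √(l/β) • z) y)‖ ≤ J * ((∫ z : Spc m, ‖kap1 i z‖) * ‖u‖) := by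
    rw [intervalIntegral.integral_of_le zero_le_one, hJd, ← integral_mul_const]
    refine norm_integral_le_of_norm_le (hJ.mul_const _) ((ae_restrict_iff' measurableSet_Ioc).2 (Eventually.of_forall fun ρ hρ => ?_))
    rw [norm_mul, Real.norm_of_nonneg (Real.rpow_nonneg hρ.1.le _)]
    refine mul_le_mul_of_nonneg_left ?_ (Real.rpow_nonneg hρ.1.le _)
    rw [← integral_mul_const]
    refine norm_integral_le_of_norm_le ((int_kap1 i).norm.mul_const _) (Eventually.of_forall fun z => ?_)
    rw [norm_mul]; gcongr; exact u.norm_coe_le_norm _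
  rw [e1]
  calc _ ≤ √β * √l * (J * ((∫ z : Spc m, ‖kap1 i z‖) * ‖u‖)) := by gcongr
    _ = _ := by ring

end

section
set_option linter.all false
variable {m : ℕ}

open scoped Topology BoundedContinuousFunction

lemma Tk_rt {V u : Spc m → ℝ} (hV : VH V) {p β : ℝ} (hp : 1 ≤ p) (hβ : 0 < β) (hu : UH p u) {τ : ℝ} (h0 : 0 < τ) (h1 : τ ≤ 1) (x : Spc m) :
    Tk kap τ (rt V β u) x = β⁻¹ * ((√τ)⁻¹ * ∑ i, Tk (kap1 i) τ (fun y => pd (ee i) u y + β * (bb V u i y * u y)) x) := by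
  obtain ⟨C, _, H⟩ := Tk_PL (m := m) hp GB_kap continuous_kap
  have hG : ∀ i, C1P _ _ := fun i => (bb_C1 hV hu i).mul hu.c
  have hpl : ∀ i, PL p (fun x => pd (ee i) (pd (ee i) u) x + β *
      (db V u (pd (ee none) u) i i x * u x + bb V u i x * pd (ee i) u x)) := fun i =>
    ((hu.pl i i).add hp ((PL.of_cont ((hG i).peri i) ((hG i).c i) hp).cmul β)).1
  have e : Tk kap τ (rt V β u) x = β⁻¹ * ∑ i, Tk kap τ (fun x => pd (ee i) (pd (ee i) u) x + β *
      (db V u (pd (ee none) u) i i x * u x + bb V u i x * pd (ee i) u x)) x := by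
    unfold Tk
    rw [← integral_finsetSum _ fun i _ => (H _ (hpl i) x τ h0 h1).1, ← integral_const_mul]
    congr 1; funext z
    rw [← Finset.mul_sum, ← rt_eq hV hβ hu]; field_simp
  rw [e]
  congr 1
  rw [Finset.mul_sum]
  refine Finset.sum_congr rfl fun i _ => ?_
  have hJ : LD i (fun y => pd (ee i) u y + β * (bb V u i y * u y)) _ := (hu.l i i).add ((hG i).ld i |>.cmul β)
  have hJc : Continuous fun y => pd (ee i) u y + β * (bb V u i y * u y) := (hu.c.c i).add ((hG i).cont.const_mul β)
  have hJp : Per fun y => pd (ee i) u y + β * (bb V u i y * u y) := fun k y => by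
    have h2 := hu.c.peri i k y
    have h3 := (hG i).per k y
    simp only at h2 h3 ⊢
    rw [h2, h3]
  obtain ⟨K, _, hK⟩ := hJp.bounded hJc
  exact IBP hp AK_kap hJc hK hJ (hpl i) h0 h1 x

lemma Tk_rt_cont {V u : Spc m → ℝ} (hV : VH V) {p β : ℝ} (hp : 1 ≤ p) (hβ : 0 < β) (hu : UH p u) {τ : ℝ} (h0 : 0 < τ) (h1 : τ < 1) (x : Spc m) :
    ContinuousAt (fun τ => Tk kap τ (rt V β u) x) τ := by
  have hG : ∀ i, C1P _ _ := fun i => (bb_C1 hV hu i).mul hu.c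
  have hc : ContinuousAt (fun τ => β⁻¹ * ((√τ)⁻¹ * ∑ i, Tk (kap1 i) τ (fun y => pd (ee i) u y + β * (bb V u i y * u y)) x)) τ := by
    refine continuousAt_const.mul ((Real.continuous_sqrt.continuousAt.inv₀ (Real.sqrt_pos.2 h0).ne').mul (Continuous.continuousAt ?_))
    refine continuous_finsetSum _ fun i _ => ?_
    have hJc : Continuous fun y => pd (ee i) u y + β * (bb V u i y * u y) := (hu.c.c i).add ((hG i).cont.const_mul β)
    have hJp : Per fun y => pd (ee i) u y + β * (bb V u i y * u y) := fun k y => by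
      have h2 := hu.c.peri i k y
      have h3 := (hG i).per k y
      simp only at h2 h3 ⊢
      rw [h2, h3]
    obtain ⟨K, _, hK⟩ := hJp.bounded hJc
    exact (continuous_Tk_tau (AK_kap1 i).int hJc hK).comp (by fun_prop : Continuous fun τ : ℝ => (τ, x))
  refine hc.congr ?_
  filter_upwards [Ioo_mem_nhds h0 h1] with τ hτ
  rw [Tk_rt hV hp hβ hu hτ.1 hτ.2.le]

namespace SOL
variable {V : Spc m → ℝ} {β p : ℝ} {I : Set ℝ} {ψ : ℝ → Spc m → ℝ}

lemma tkd (h : SOL V β p I ψ) {s} (hs : s ∈ I) {τ : ℝ} (h0 : 0 < τ) (h1 : τ < 1) (x : Spc m) {κ : ℝ} (hκ : 0 < κ) :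
    HasDerivAt (fun r => Tk kap (τ + κ * r) (ψ (s - β * κ * r)) x)
      (-(β * κ * ((√τ)⁻¹ * ∑ i, Tk (kap1 i) τ (fun y => bb V (ψ s) i y * ψ s y) x))) 0 := by
  have hu := h.u s hs
  have hβ := h.hβ
  obtain ⟨C, hC, H⟩ := Tk_PL (m := m) h.hp GB_kap continuous_kap
  obtain ⟨K, _, hK⟩ := hu.c.per.bounded hu.c.cont
  choose K' hK0 hK' using fun i => (hu.c.peri i).bounded (hu.c.c i)
  have d1 : HasDerivAt (fun r => Tk kap (τ + κ * r) (ψ s) x) ((√τ)⁻¹ * (∑ i, Tk (kap1 i) τ (pd (ee i) (ψ s)) x) * κ) 0 := by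
    have a := Tk_tau_deriv hu.c.d hK hu.c.c (C' := ∑ i, K' i) (fun i x => (hK' i x).trans (Finset.single_le_sum (fun i _ => hK0 i) (Finset.mem_univ i))) h0 x
    have b : HasDerivAt (fun r : ℝ => τ + κ * r) κ 0 := by simpa using ((hasDerivAt_id (0:ℝ)).const_mul κ).const_add τ
    have := HasDerivAt.comp (0:ℝ) (h₂ := fun τ => Tk kap τ (ψ s) x) (by rw [mul_zero, add_zero]; exact a) b
    exact this
  have ht : Tendsto (fun r : ℝ => τ + κ * r) (𝓝[≠] 0) (𝓝 τ) := by
    have : Continuous fun r : ℝ => τ + κ * r := by fun_prop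
    simpa using (this.tendsto 0).mono_left nhdsWithin_le_nhds
  have hk : Tendsto (fun r : ℝ => -(β * κ * r)) (𝓝[≠] 0) (𝓝[≠] 0) := by
    refine tendsto_nhdsWithin_iff.2 ⟨?_, ?_⟩
    · have : Continuous fun r : ℝ => -(β * κ * r) := by fun_prop
      simpa using (this.tendsto 0).mono_left nhdsWithin_le_nhds
    · filter_upwards [self_mem_nhdsWithin] with r hr
      have : r ≠ 0 := hr
      simp only [mem_compl_iff, mem_singleton_iff, neg_eq_zero]; positivity
  have d2 : HasDerivAt (fun r => Tk kap (τ + κ * r) (fun y => ψ (s - β * κ * r) y - ψ s y) x) (-(β * κ) * Tk kap τ (rt V β (ψ s)) x) 0 := by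
    rw [hasDerivAt_iff_tendsto_slope]
    have t1 : Tendsto (fun r : ℝ => Tk kap (τ + κ * r) (rt V β (ψ s)) x) (𝓝[≠] 0) (𝓝 (Tk kap τ (rt V β (ψ s)) x)) :=
      (Tk_rt_cont h.hV h.hp hβ hu h0 h1 x).tendsto.comp ht
    have t2 : Tendsto (fun r : ℝ => Tk kap (τ + κ * r) (fun y => (ψ (s + -(β * κ * r)) y - ψ s y) / (-(β * κ * r)) - rt V β (ψ s) y) x) (𝓝[≠] 0) (𝓝 0) := by
      have e := (h.e s hs).comp hk
      have q : Tendsto (fun r : ℝ => C * (τ + κ * r) ^ (-ex m p)) (𝓝[≠] 0) (𝓝 (C * τ ^ (-ex m p))) :=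
        ((Real.continuousAt_rpow_const τ _ (Or.inl h0.ne')).tendsto.comp ht).const_mul C
      have z := q.mul e
      rw [mul_zero] at z
      refine squeeze_zero_norm' ?_ z
      have hI : ∀ᶠ r in 𝓝[≠] (0:ℝ), s + -(β * κ * r) ∈ I := by
        have : Tendsto (fun r : ℝ => s + -(β * κ * r)) (𝓝[≠] 0) (𝓝 s) := by simpa using (hk.mono_right nhdsWithin_le_nhds).const_add s
        exact this.eventually (h.op.mem_nhds hs)
      filter_upwards [ht.eventually (Ioo_mem_nhds h0 h1), hI] with r hr hrI
      refine (H _ ?_ x _ hr.1 hr.2.le).2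
      have := (((h.pl hrI).sub h.hp (h.pl hs)).cmul (-(β * κ * r))⁻¹).sub h.hp (h.rpl hs)
      simp only [div_eq_inv_mul]; exact this
    have t3 := (t2.add t1).const_mul (-(β * κ))
    rw [zero_add] at t3
    refine t3.congr' ?_
    have hI : ∀ᶠ r in 𝓝[≠] (0:ℝ), s + -(β * κ * r) ∈ I := by
      have : Tendsto (fun r : ℝ => s + -(β * κ * r)) (𝓝[≠] 0) (𝓝 s) := by simpa using (hk.mono_right nhdsWithin_le_nhds).const_add s
      exact this.eventually (h.op.mem_nhds hs)
    filter_upwards [ht.eventually (Ioo_mem_nhds h0 h1), hI, self_mem_nhdsWithin] with r hr hrI hr0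
    have hr0 : r ≠ 0 := hr0
    have hpl : PL p (fun y => (ψ (s + -(β * κ * r)) y - ψ s y) / (-(β * κ * r))) := by
      simp only [div_eq_inv_mul]; exact ((h.pl hrI).sub h.hp (h.pl hs)).cmul (-(β * κ * r))⁻¹
    rw [Tk_sub h.hp GB_kap continuous_kap hpl (h.rpl hs) hr.1 hr.2.le, sub_add_cancel, slope_def_field]
    simp only [mul_zero, sub_zero, sub_self]
    have e0 : Tk kap (τ + 0) (fun y => (0:ℝ)) x = 0 := by simp [Tk]
    rw [e0, sub_zero, Tk, Tk, ← integral_const_mul, ← integral_div]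
    congr 1; funext z
    rw [← sub_eq_add_neg]
    field_simp
  have d3 := d2.add d1
  refine (d3.congr_of_eventuallyEq ?_).congr_deriv ?_
  · have ht' : Tendsto (fun r : ℝ => τ + κ * r) (𝓝 0) (𝓝 τ) := by
      have : Continuous fun r : ℝ => τ + κ * r := by fun_prop
      simpa using (this.tendsto 0)
    have hI : ∀ᶠ r in 𝓝 (0:ℝ), s - β * κ * r ∈ I := by
      have : Continuous fun r : ℝ => s - β * κ * r := by fun_prop
      have := this.tendsto 0
      simp only [mul_zero, sub_zero] at this
      exact this.eventually (h.op.mem_nhds hs)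
    filter_upwards [ht'.eventually (Ioo_mem_nhds h0 h1), hI] with r hr hrI
    simp only [Pi.add_apply]
    rw [Tk_sub h.hp GB_kap continuous_kap (h.pl hrI) (h.pl hs) hr.1 hr.2.le, sub_add_cancel]
  · have e1 : ∀ i, Tk (kap1 i) τ (fun y => pd (ee i) (ψ s) y + β * (bb V (ψ s) i y * ψ s y)) x =
        Tk (kap1 i) τ (pd (ee i) (ψ s)) x + β * Tk (kap1 i) τ (fun y => bb V (ψ s) i y * ψ s y) x := fun i => by
      obtain ⟨C, hC, H⟩ := Tk_PL (m := m) h.hp (GB_kap1 i) (continuous_kap1 i)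
      have hG := (bb_C1 h.hV hu i).mul hu.c
      unfold Tk
      rw [← integral_const_mul, ← integral_add (H _ (PL.of_cont (hu.c.peri i) (hu.c.c i) h.hp) x τ h0 h1.le).1 ((H _ (PL.of_cont hG.per hG.cont h.hp) x τ h0 h1.le).1.const_mul β)]
      congr 1; funext z; ring
    rw [Tk_rt h.hV h.hp hβ hu h0 h1.le]
    simp only [e1, Finset.sum_add_distrib, ← Finset.mul_sum]
    field_simp
    ring
end SOL

end

section
set_option linter.all false
variable {m : ℕ}

open scoped Topology BoundedContinuousFunction

section
variable {Y : Type*} [TopologicalSpace Y]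
open Classical in
def ofF (f : Y → ℝ) : Y →ᵇ ℝ :=
  if h : Continuous f ∧ ∃ C, ∀ x, |f x| ≤ C then BoundedContinuousFunction.ofNormedAddCommGroup f h.1 h.2.choose h.2.choose_spec else 0

lemma ofF_apply {f : Y → ℝ} (hc : Continuous f) {C : ℝ} (hb : ∀ x, |f x| ≤ C) (x : Y) : ofF f x = f x := by
  have h : Continuous f ∧ ∃ C, ∀ x, |f x| ≤ C := ⟨hc, C, hb⟩
  rw [ofF, dif_pos h]; rfl

lemma inv_BCF (f : Y →ᵇ ℝ) {c : ℝ} (hc : 0 < c) (hf : ∀ y, c ≤ f y) : IsUnit f ∧ ∀ y, Ring.inverse f y = (f y)⁻¹ := by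
  have hc' : Continuous fun y => (f y)⁻¹ := f.continuous.inv₀ fun y => (hc.trans_le (hf y)).ne'
  have hb : ∀ y, |(f y)⁻¹| ≤ c⁻¹ := fun y => by
    rw [abs_inv, abs_of_pos (hc.trans_le (hf y))]; exact inv_anti₀ hc (hf y)
  have e : f * ofF (fun y => (f y)⁻¹) = 1 := by
    ext y; simp [ofF_apply hc' hb, mul_inv_cancel₀ (hc.trans_le (hf y)).ne']
  have e' : ofF (fun y => (f y)⁻¹) * f = 1 := by rw [mul_comm]; exact e
  let U : (Y →ᵇ ℝ)ˣ := ⟨f, _, e, e'⟩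
  refine ⟨⟨U, rfl⟩, fun y => ?_⟩
  have : Ring.inverse f = ofF (fun y => (f y)⁻¹) := Ring.inverse_unit U
  rw [this, ofF_apply hc' hb]

def bY (M : (Y →ᵇ ℝ) →L[ℝ] (Y →ᵇ ℝ)) (v : Option (Fin m) → (Y →ᵇ ℝ)) : Option (Fin m) → (Y →ᵇ ℝ) → (Y →ᵇ ℝ)
  | none => fun u => v none - M (v none * u) * Ring.inverse (M u)
  | some i => fun _ => v (some i)

lemma bY_smooth (M : (Y →ᵇ ℝ) →L[ℝ] (Y →ᵇ ℝ)) (v : Option (Fin m) → (Y →ᵇ ℝ)) (i) {u : Y →ᵇ ℝ} (hu : IsUnit (M u)) :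
    ContDiffAt ℝ SM (bY M v i) u := by
  rcases i with _ | i
  · have h1 : ContDiffAt ℝ SM (fun u => M (v none * u)) u := M.contDiff.contDiffAt.comp u (contDiffAt_const.mul contDiffAt_id)
    have h2 : ContDiffAt ℝ SM (fun u => Ring.inverse (M u)) u := by
      obtain ⟨U, hU⟩ := hu
      have := contDiffAt_ringInverse ℝ (n := SM) U
      rw [hU] at this
      exact ContDiffAt.comp u this M.contDiff.contDiffAt
    exact contDiffAt_const.sub (h1.mul h2)
  · exact contDiffAt_const
end

lemma hC1 : Integrable (fun _ : Fin m → ℝ => (1:ℝ)) (volume.restrict (cube1 m)) := integrable_const 1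
def Mt (m : ℕ) : (Yt m →ᵇ ℝ) →L[ℝ] (Yt m →ᵇ ℝ) := avg (volume.restrict (cube1 m)) SG_M (hC1.toL1 _)
def M0 (m : ℕ) : (Spc m →ᵇ ℝ) →L[ℝ] (Spc m →ᵇ ℝ) := avg (volume.restrict (cube1 m)) SG_M0 (hC1.toL1 _)

lemma Mt_apply (u : Yt m →ᵇ ℝ) (y) : Mt m u y = Mop (fun x => u (y.1, x)) y.2 := by
  rw [Mt, avg_apply]; simp only [one_mul]; rfl
lemma M0_apply (u : Spc m →ᵇ ℝ) (x) : M0 m u x = Mop u x := by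
  rw [M0, avg_apply]; simp only [one_mul]; rfl

def vE (V : Spc m → ℝ) (i : Option (Fin m)) : Spc m →ᵇ ℝ := ofF (pd (ee i) V)
def vT (V : Spc m → ℝ) (i : Option (Fin m)) : Yt m →ᵇ ℝ := ofF (fun y : Yt m => pd (ee i) V y.2)
lemma vE_apply {V : Spc m → ℝ} (hV : VH V) (i x) : vE V i x = pd (ee i) V x := by
  obtain ⟨K, _, hK⟩ := (hV.c0.peri i).bounded (hV.c0.c i)
  exact ofF_apply (hV.c0.c i) hK x
lemma vT_apply {V : Spc m → ℝ} (hV : VH V) (i y) : vT V i y = pd (ee i) V y.2 := by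
  obtain ⟨K, _, hK⟩ := (hV.c0.peri i).bounded (hV.c0.c i)
  exact ofF_apply (f := fun y : Yt m => pd (ee i) V y.2) ((hV.c0.c i).comp continuous_snd) (fun y => hK y.2) y

lemma bE_apply {V : Spc m → ℝ} (hV : VH V) {u : Spc m →ᵇ ℝ} {c : ℝ} (hc : 0 < c) (hl : ∀ x, c ≤ Mop u x) (i) (x : Spc m) :
    bY (M0 m) (vE V) i u x = bb V u i x := by
  rcases i with _ | i
  · simp only [bY, BoundedContinuousFunction.sub_apply, BoundedContinuousFunction.mul_apply,
      (inv_BCF (M0 m u) hc (fun x => by rw [M0_apply]; exact hl x)).2, M0_apply, vE_apply hV, bb, phi, div_eq_mul_inv]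
    rw [show (⇑(vE V none * u) : Spc m → ℝ) = fun y => pd (ee none) V y * u y from funext fun y => by
      rw [BoundedContinuousFunction.mul_apply, vE_apply hV]]
  · exact vE_apply hV _ x

lemma bT_apply {V : Spc m → ℝ} (hV : VH V) {u : Yt m →ᵇ ℝ} {c : ℝ} (hc : 0 < c) (hl : ∀ y : Yt m, c ≤ Mop (fun x => u (y.1, x)) y.2) (i) (y : Yt m) :
    bY (Mt m) (vT V) i u y = bb V (fun x => u (y.1, x)) i y.2 := by
  rcases i with _ | i
  · simp only [bY, BoundedContinuousFunction.sub_apply, BoundedContinuousFunction.mul_apply,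
      (inv_BCF (Mt m u) hc (fun x => by rw [Mt_apply]; exact hl x)).2, Mt_apply, vT_apply hV, bb, phi, div_eq_mul_inv]
  · exact vT_apply hV _ y

def sgT (z : Spc m) (y : ℝ × Spc m) : Spc m := y.2 - √y.1 • z
lemma SG_T : SG (sgT (m := m)) where
  m y := by unfold sgT; exact (Continuous.measurable (by fun_prop))
  c ω := by unfold sgT; fun_prop
def TT {g : Spc m → ℝ} (hg : Integrable g) : (Spc m →ᵇ ℝ) →L[ℝ] (ℝ × Spc m →ᵇ ℝ) := avg volume SG_T (hg.toL1 g)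
lemma TT_apply {g : Spc m → ℝ} (hg : Integrable g) (u) (y : ℝ × Spc m) : TT hg u y = Tk g y.1 u y.2 := by
  rw [TT, avg_apply]; rfl

def wT (m : ℕ) : Yt m →ᵇ ℝ := ofF (fun y : Yt m => √(y.1 : ℝ))
lemma wT_apply (y : Yt m) : wT m y = √(y.1 : ℝ) :=
  ofF_apply (f := fun y : Yt m => √(y.1 : ℝ)) (by fun_prop) (C := 1) (fun y => by
    rw [abs_of_nonneg (Real.sqrt_nonneg _), Real.sqrt_le_one]; exact y.1.2.2) y

def Phi (V : Spc m → ℝ) (β : ℝ) (g : Spc m →ᵇ ℝ) (q : ℝ × (Yt m →ᵇ ℝ)) : Yt m →ᵇ ℝ :=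
  avg volume SG_P (kP m β q.1) g + ∑ i, wT m * avg (nuO m) SG_K (kK m β q.1 i) (bY (Mt m) (vT V) i q.2 * q.2)

lemma Phi_smooth {V : Spc m → ℝ} {β : ℝ} (hβ : 0 < β) (g : Spc m →ᵇ ℝ) {l : ℝ} (hl : 0 < l) {u : Yt m →ᵇ ℝ} (hu : IsUnit (Mt m u)) :
    ContDiffAt ℝ SM (Phi V β g) (l, u) := by
  have h1 : ContDiffAt ℝ SM (fun q : ℝ × (Yt m →ᵇ ℝ) => kP m β q.1) (l, u) := ContDiffAt.comp (g := kP m β) _ (kP_smooth hβ hl) contDiffAt_fst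
  have h2 : ∀ i, ContDiffAt ℝ SM (fun q : ℝ × (Yt m →ᵇ ℝ) => kK m β q.1 i) (l, u) := fun i =>
    ContDiffAt.comp (g := fun l => kK m β l i) _ (kK_smooth hβ hl i) contDiffAt_fst
  have h3 : ∀ i, ContDiffAt ℝ SM (fun q : ℝ × (Yt m →ᵇ ℝ) => bY (Mt m) (vT V) i q.2 * q.2) (l, u) := fun i =>
    (ContDiffAt.comp (g := bY (Mt m) (vT V) i) _ (bY_smooth _ _ i hu) contDiffAt_snd).mul contDiffAt_snd
  have h4 : ContDiffAt ℝ SM (fun q : ℝ × (Yt m →ᵇ ℝ) => avg volume SG_P (kP m β q.1)) (l, u) :=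
    ContDiffAt.comp (g := avg volume SG_P) _ (ContinuousLinearMap.contDiff _).contDiffAt h1
  have h5 : ∀ i, ContDiffAt ℝ SM (fun q : ℝ × (Yt m →ᵇ ℝ) => avg (nuO m) SG_K (kK m β q.1 i)) (l, u) := fun i =>
    ContDiffAt.comp (g := avg (nuO m) SG_K) _ (ContinuousLinearMap.contDiff _).contDiffAt (h2 i)
  exact (h4.clm_apply contDiffAt_const).add (ContDiffAt.sum fun i _ => contDiffAt_const.mul ((h5 i).clm_apply (h3 i)))

namespace SOL
variable {V : Spc m → ℝ} {β p : ℝ} {I : Set ℝ} {ψ : ℝ → Spc m → ℝ}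

lemma E_apply (h : SOL V β p I ψ) {t} (ht : t ∈ I) (x) : ofF (ψ t) x = ψ t x := by
  obtain ⟨K, _, hK⟩ := (h.u t ht).c.per.bounded (h.u t ht).c.cont
  exact ofF_apply (h.u t ht).c.cont hK x

lemma E_cont (h : SOL V β p I ψ) : ContinuousOn (fun t => ofF (ψ t)) I := by
  intro t ht
  refine ContinuousAt.continuousWithinAt ?_
  rw [Metric.continuousAt_iff']
  intro η hη
  filter_upwards [h.contE ht (half_pos hη), h.op.mem_nhds ht] with s hs hsI
  refine lt_of_le_of_lt ((BoundedContinuousFunction.dist_le (half_pos hη).le).2 fun x => ?_) (half_lt_self hη)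
  rw [h.E_apply hsI, h.E_apply ht]; exact hs x

lemma duh (h : SOL V β p I ψ) {a l : ℝ} (hl : 0 < l) (hlβ : l < β) (hI : ∀ s ∈ Icc a (a+l), s ∈ I) {u : Yt m →ᵇ ℝ}
    (hu : ∀ y : Yt m, u y = ψ (a + l * y.1) y.2) {c : ℝ} (hc : 0 < c) (hlow : ∀ s ∈ Icc a (a+l), ∀ x, c ≤ Mop (ψ s) x) :
    u = Phi V β (ofF (ψ a)) (l, u) := by
  have hβ := h.hβ
  have haI : a ∈ I := hI a ⟨le_rfl, by linarith⟩
  have hmem : ∀ θ : unitInterval, a + l * θ ∈ Icc a (a+l) := fun θ => ⟨by nlinarith [θ.2.1], by nlinarith [θ.2.2]⟩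
  have hus : ∀ θ : unitInterval, (fun x => u (θ, x)) = ψ (a + l * θ) := fun θ => funext fun x => hu (θ, x)
  have hb : ∀ i y, bY (Mt m) (vT V) i u y = bb V (ψ (a + l * y.1)) i y.2 := fun i y => by
    rw [bT_apply h.hV hc (fun y => by rw [hus]; exact hlow _ (hmem _) _), hus]
  ext y
  obtain ⟨θ, x⟩ := y
  simp only [Phi, BoundedContinuousFunction.add_apply, BoundedContinuousFunction.sum_apply, BoundedContinuousFunction.mul_apply, wT_apply,
    avgP hβ hl]
  have hEa : (ofF (ψ a) : Spc m → ℝ) = ψ a := funext fun x => h.E_apply haI x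
  rw [hEa, hu]
  rcases eq_or_lt_of_le θ.2.1 with h0 | h0
  · simp only [← h0, mul_zero, zero_div, Real.sqrt_zero, zero_mul, Finset.sum_const_zero, add_zero]
    rw [Tk_zero]
  set κ : ℝ := l * θ / β with hκ
  have hκ0 : 0 < κ := by positivity
  have hκ1 : κ < 1 := by rw [hκ, div_lt_one hβ]; nlinarith [θ.2.2]
  have hβκ : β * κ = l * θ := by rw [hκ]; field_simp
  set F : Option (Fin m) → ℝ → ℝ := fun i ρ => l * (√(l/β))⁻¹ * (ρ ^ (-(1/2) : ℝ) * ∫ z, kap1 i z * (bY (Mt m) (vT V) i u * u) (sgK (ρ, √(l/β) • z) (θ, x))) with hF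
  have hK := fun i => avgK hβ hl i (bY (Mt m) (vT V) i u * u) (θ, x)
  have key := intervalIntegral.integral_eq_sub_of_hasDerivAt_of_le (a := 0) (b := 1) (f := fun ρ => Tk kap (κ * ρ) (ψ (a + l * θ - β * κ * ρ)) x)
    (f' := fun ρ => - ∑ i, √(θ:ℝ) * F i ρ) zero_le_one ?_ ?_ ?_
  · rw [intervalIntegral.integral_neg, intervalIntegral.integral_finset_sum fun i _ => (hK i).1.const_mul _] at key
    simp only [intervalIntegral.integral_const_mul] at key
    simp only [mul_zero, mul_one, sub_zero, Tk_zero, hβκ, add_sub_cancel_right] at key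
    have e : ∀ i, avg (nuO m) SG_K (kK m β l i) (bY (Mt m) (vT V) i u * u) (θ, x) = ∫ ρ in (0:ℝ)..1, F i ρ := fun i => (hK i).2
    simp only [e]
    simp only [hF, intervalIntegral.integral_const_mul] at key ⊢
    linarith
  · have hc1 : ContinuousOn (fun ρ => ofF (ψ (a + l * θ - β * κ * ρ))) (Icc 0 1) := by
      refine h.E_cont.comp (f := fun ρ => a + l * θ - β * κ * ρ) (by fun_prop) fun ρ hρ => hI _ ?_
      rw [hβκ]
      exact ⟨by nlinarith [hρ.2, mul_pos hl h0], by nlinarith [hρ.1, mul_pos hl h0, θ.2.2]⟩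
    have hc2 : ContinuousOn (fun ρ : ℝ => TT (int_kap (m := m)) (ofF (ψ (a + l * θ - β * κ * ρ))) (κ * ρ, x)) (Icc 0 1) :=
      continuous_eval.comp_continuousOn (((TT int_kap).continuous.comp_continuousOn hc1).prodMk (by fun_prop))
    refine hc2.congr fun ρ hρ => ?_
    simp only [TT_apply]
    have : (ofF (ψ (a + l * θ - β * κ * ρ)) : Spc m → ℝ) = ψ (a + l * θ - β * κ * ρ) := funext fun x => h.E_apply (hI _ (by
      rw [hβκ]
      exact ⟨by nlinarith [hρ.2, mul_pos hl h0], by nlinarith [hρ.1, mul_pos hl h0, θ.2.2]⟩)) x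
    rw [this]
  · intro ρ hρ
    have hs : a + l * θ - β * κ * ρ ∈ I := hI _ (by
      rw [hβκ]
      exact ⟨by nlinarith [hρ.2, mul_pos hl h0], by nlinarith [hρ.1, mul_pos hl h0, θ.2.2]⟩)
    have hτ : 0 < κ * ρ := mul_pos hκ0 hρ.1
    have hd := h.tkd hs hτ (by nlinarith [hρ.2]) x hκ0
    have hd' := HasDerivAt.comp_sub_const (f := fun r => Tk kap (κ * ρ + κ * r) (ψ (a + l * θ - β * κ * ρ - β * κ * r)) x) ρ ρ (by rw [sub_self]; exact hd)
    refine (hd'.congr_of_eventuallyEq (Eventually.of_forall fun r => ?_)).congr_deriv ?_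
    · show Tk kap (κ * r) (ψ (a + l * θ - β * κ * r)) x = Tk kap (κ * ρ + κ * (r - ρ)) (ψ (a + l * θ - β * κ * ρ - β * κ * (r - ρ))) x
      congr 2 <;> ring
    · rw [Finset.mul_sum, Finset.mul_sum]
      congr 1
      refine Finset.sum_congr rfl fun i _ => ?_
      have e1 : ∀ z, (bY (Mt m) (vT V) i u * u) (sgK (ρ, √(l/β) • z) (θ, x)) =
          bb V (ψ (a + l * θ - β * κ * ρ)) i (x - √(κ * ρ) • z) * ψ (a + l * θ - β * κ * ρ) (x - √(κ * ρ) • z) := fun z => by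
        rw [BoundedContinuousFunction.mul_apply, hb, hu]
        have e2 : (projIcc 0 1 zero_le_one ((θ:ℝ) * (1 - ρ)) : ℝ) = θ * (1 - ρ) := by
          rw [projIcc_of_mem zero_le_one ⟨by nlinarith [hρ.2], by nlinarith [hρ.1, θ.2.2]⟩]
        simp only [sgK, e2]
        rw [smul_smul, ← Real.sqrt_mul' _ (by positivity), show (θ:ℝ) * ρ * (l/β) = κ * ρ by rw [hκ]; ring,
          show a + l * (θ * (1 - ρ)) = a + l * θ - β * κ * ρ by rw [hβκ]; ring]
      simp only [hF, e1]
      rw [show (∫ z, kap1 i z * (bb V (ψ (a + l * θ - β * κ * ρ)) i (x - √(κ * ρ) • z) * ψ (a + l * θ - β * κ * ρ) (x - √(κ * ρ) • z))) =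
        Tk (kap1 i) (κ * ρ) (fun y => bb V (ψ (a + l * θ - β * κ * ρ)) i y * ψ (a + l * θ - β * κ * ρ) y) x from rfl]
      rw [hβκ, ← mul_assoc, ← mul_assoc, ← mul_assoc, ← mul_assoc]
      congr 1
      have e3 : √(κ * ρ) = √(θ:ℝ) * √(l/β) * √ρ := by
        rw [hκ, show l * θ / β * ρ = θ * (l/β) * ρ by ring, Real.sqrt_mul (by positivity), Real.sqrt_mul h0.le]
      have e4 : ρ ^ (-(1/2) : ℝ) = (√ρ)⁻¹ := by rw [Real.rpow_neg hρ.1.le, Real.sqrt_eq_rpow]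
      rw [e3, e4]
      have s1 : 0 < √(θ:ℝ) := Real.sqrt_pos.2 h0
      have s2 : 0 < √ρ := Real.sqrt_pos.2 hρ.1
      have s3 : 0 < √(l/β) := Real.sqrt_pos.2 (by positivity)
      have s4 : (θ:ℝ) = √(θ:ℝ) * √(θ:ℝ) := (Real.mul_self_sqrt h0.le).symm
      field_simp
      rw [Real.sq_sqrt h0.le]
  · refine IntervalIntegrable.neg ?_
    have := IntervalIntegrable.sum (μ := volume) (a := 0) (b := 1) Finset.univ (f := fun i ρ => √(θ:ℝ) * F i ρ) fun i _ => (hK i).1.const_mul _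
    refine this.congr fun ρ _ => ?_
    simp
end SOL

end

section
set_option linter.all false
variable {m : ℕ}

open scoped Topology BoundedContinuousFunction

def unc (F : C(unitInterval, Spc m →ᵇ ℝ)) : Yt m →ᵇ ℝ :=
  BoundedContinuousFunction.ofNormedAddCommGroup (fun y : Yt m => F y.1 y.2)
    (continuous_eval.comp (f := fun y : Yt m => (F y.1, y.2)) (by fun_prop)) ‖F‖
    (fun y => ((F y.1).norm_coe_le_norm _).trans (F.norm_coe_le_norm _))
lemma unc_apply (F : C(unitInterval, Spc m →ᵇ ℝ)) (y) : unc F y = F y.1 y.2 := rfl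

lemma unc_cont : Continuous (unc (m := m)) := by
  refine LipschitzWith.continuous (K := 1) (LipschitzWith.of_dist_le_mul fun F G => ?_)
  rw [NNReal.coe_one, one_mul, BoundedContinuousFunction.dist_le dist_nonneg]
  intro y
  exact (BoundedContinuousFunction.dist_coe_le_dist (f := F y.1) (g := G y.1) y.2).trans (ContinuousMap.dist_apply_le_dist _)

def ev1 (m : ℕ) : (Yt m →ᵇ ℝ) →L[ℝ] (Spc m →ᵇ ℝ) :=
  LinearMap.mkContinuous
    { toFun := fun u => u.compContinuous ⟨fun x => (1, x), by fun_prop⟩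
      map_add' := fun _ _ => rfl
      map_smul' := fun _ _ => rfl } 1 (fun u => by
      rw [one_mul]
      exact (BoundedContinuousFunction.norm_le (norm_nonneg _)).2 fun x => u.norm_coe_le_norm _)
lemma ev1_apply (u : Yt m →ᵇ ℝ) (x) : ev1 m u x = u (1, x) := rfl

lemma Phi_lip {V : Spc m → ℝ} {β : ℝ} (g : Spc m →ᵇ ℝ) {l : ℝ} (C : Option (Fin m) → ℝ) (hC : ∀ i, ∀ u : Yt m →ᵇ ℝ,
    ‖avg (nuO m) SG_K (kK m β l i) u‖ ≤ C i * ‖u‖) (hC0 : ∀ i, 0 ≤ C i) {K : Option (Fin m) → NNReal} {s : Set (Yt m →ᵇ ℝ)}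
    (hK : ∀ i, LipschitzOnWith (K i) (fun u => bY (Mt m) (vT V) i u * u) s) {L : NNReal} (hL : ∑ i, C i * K i ≤ L) :
    LipschitzOnWith L (fun u => Phi V β g (l, u)) s := by
  refine LipschitzOnWith.of_dist_le_mul fun u hu v hv => ?_
  have e : Phi V β g (l, u) - Phi V β g (l, v) =
      ∑ i, wT m * avg (nuO m) SG_K (kK m β l i) (bY (Mt m) (vT V) i u * u - bY (Mt m) (vT V) i v * v) := by
    simp only [Phi, map_sub, mul_sub, Finset.sum_sub_distrib]; abel
  have hw : ‖wT m‖ ≤ 1 := (BoundedContinuousFunction.norm_le zero_le_one).2 fun y => by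
    rw [wT_apply, Real.norm_of_nonneg (Real.sqrt_nonneg _), Real.sqrt_le_one]; exact y.1.2.2
  rw [dist_eq_norm, e]
  calc _ ≤ ∑ i, C i * K i * dist u v := by
        refine norm_sum_le_of_le _ fun i _ => (norm_mul_le _ _).trans ?_
        have h1 := hC i (bY (Mt m) (vT V) i u * u - bY (Mt m) (vT V) i v * v)
        have h2 := (hK i).dist_le_mul u hu v hv
        rw [dist_eq_norm] at h2
        have h3 := mul_le_mul_of_nonneg_left h2 (hC0 i)
        have h4 := mul_le_of_le_one_left (norm_nonneg (avg (nuO m) SG_K (kK m β l i) (bY (Mt m) (vT V) i u * u - bY (Mt m) (vT V) i v * v))) hw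
        rw [mul_assoc]
        exact h4.trans (h1.trans h3)
    _ = (∑ i, C i * K i) * dist u v := by rw [Finset.sum_mul]
    _ ≤ L * dist u v := by gcongr

namespace SOL
variable {V : Spc m → ℝ} {β p : ℝ} {I : Set ℝ} {ψ : ℝ → Spc m → ℝ}

theorem smooth (h : SOL V β p I ψ) {t0} (ht : t0 ∈ I) : ContDiffAt ℝ SM (fun t => ofF (ψ t)) t0 := by
  have hβ := h.hβ
  obtain ⟨c, hc, hlow⟩ := h.lowM ht
  set us : Yt m →ᵇ ℝ := unc (ContinuousMap.const _ (ofF (ψ t0))) with hus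
  have husa : ∀ y, us y = ψ t0 y.2 := fun y => by rw [hus, unc_apply, ContinuousMap.const_apply, h.E_apply ht]
  have low0 := (mem_of_mem_nhds hlow : ∀ x, c ≤ Mop (ψ t0) x)
  have hU : IsUnit (Mt m us) := (inv_BCF _ hc fun y => by rw [Mt_apply]; simp only [husa]; exact low0 _).1
  have hL : ∀ i, ∃ K : NNReal, ∃ s ∈ 𝓝 us, LipschitzOnWith K (fun u => bY (Mt m) (vT V) i u * u) s := fun i =>
    ContDiffAt.exists_lipschitzOnWith (((bY_smooth (Mt m) (vT V) i hU).mul contDiffAt_id).of_le (n := SM) (m := 1) (by simp [SM]))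
  choose K s hs hK using hL
  choose C hC0 hC using fun i => avgK_norm (m := m) hβ i
  obtain ⟨r, hr, hrs⟩ := Metric.mem_nhds_iff.1 (iInter_mem.2 hs)
  have hev := (h.E_cont.continuousAt (h.op.mem_nhds ht)).eventually (Metric.ball_mem_nhds _ (by positivity : 0 < r / 4))
  have hIe : ∀ᶠ s in 𝓝 t0, s ∈ I := h.op.mem_nhds ht
  obtain ⟨δ, hδ, hball⟩ := Metric.mem_nhds_iff.1 ((hIe.and hlow).and hev)
  have hsq : ∀ᶠ l : ℝ in 𝓝[>] 0, ∑ i, C i * √l * K i < 1/2 := by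
    have : Continuous fun l : ℝ => ∑ i, C i * √l * K i := by fun_prop
    have := (this.tendsto 0)
    simp only [Real.sqrt_zero, mul_zero, zero_mul, Finset.sum_const_zero] at this
    exact (this.mono_left nhdsWithin_le_nhds).eventually (gt_mem_nhds (by norm_num))
  obtain ⟨l0, hl1, hl0, hl2⟩ := (hsq.and (Ioo_mem_nhdsGT (show (0:ℝ) < min (β/2) (δ/2) by positivity))).exists
  have hlβ : l0 < β/2 := hl2.trans_le (min_le_left _ _)
  have hlδ : l0 < δ/2 := hl2.trans_le (min_le_right _ _)
  set a := t0 - l0 with ha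
  have hIcc : ∀ s ∈ Icc (t0 - l0) (t0 + l0), (s ∈ I ∧ ∀ x, c ≤ Mop (ψ s) x) ∧ dist (ofF (ψ s)) (ofF (ψ t0)) < r / 4 := fun s hs => by
    refine @hball s ?_
    rw [Metric.mem_ball, Real.dist_eq, abs_lt]
    constructor <;> linarith [hs.1, hs.2]
  have hle : t0 - l0 ≤ t0 + l0 := by linarith
  have hXc : Continuous fun s : ℝ => ofF (ψ (projIcc (t0 - l0) (t0 + l0) hle s)) :=
    h.E_cont.comp_continuous (by fun_prop) fun s => (hIcc _ (projIcc _ _ hle s).2).1.1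
  let F : C(ℝ × unitInterval, Spc m →ᵇ ℝ) :=
    ⟨fun q => ofF (ψ (projIcc (t0 - l0) (t0 + l0) hle (a + q.1 * q.2))), hXc.comp (by fun_prop)⟩
  let cu : ℝ → Yt m →ᵇ ℝ := fun l => unc (F.curry l)
  have hcu : Continuous cu := unc_cont.comp F.curry.continuous
  have hm : ∀ l ∈ Icc 0 (2*l0), ∀ θ : unitInterval, a + l * θ ∈ Icc (t0 - l0) (t0 + l0) := fun l hl θ =>
    ⟨by nlinarith [mul_nonneg hl.1 θ.2.1], by nlinarith [mul_le_of_le_one_right hl.1 θ.2.2, hl.2]⟩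
  have hcua : ∀ l ∈ Icc 0 (2*l0), ∀ y : Yt m, cu l y = ψ (a + l * y.1) y.2 := fun l hl y => by
    show ofF (ψ (projIcc (t0 - l0) (t0 + l0) hle (a + l * y.1))) y.2 = _
    rw [projIcc_of_mem hle (hm l hl y.1), h.E_apply (hIcc _ (hm l hl y.1)).1.1]
  have hl0m : l0 ∈ Icc 0 (2*l0) := ⟨hl0.le, by linarith⟩
  have hdist : dist (cu l0) us ≤ r / 4 := by
    refine (BoundedContinuousFunction.dist_le (by positivity)).2 fun y => ?_
    rw [hcua l0 hl0m, husa, ← h.E_apply (hIcc _ (hm l0 hl0m y.1)).1.1, ← h.E_apply ht]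
    exact (BoundedContinuousFunction.dist_coe_le_dist _).trans (hIcc _ (hm l0 hl0m y.1)).2.le
  have hU0 : IsUnit (Mt m (cu l0)) := (inv_BCF _ hc fun y => by
    rw [Mt_apply]; simp only [hcua l0 hl0m]; exact (hIcc _ (hm l0 hl0m y.1)).1.2 _).1
  have hlip : LipschitzOnWith (1/2 : NNReal) (fun u => Phi V β (ofF (ψ a)) (l0, u)) (Metric.ball (cu l0) (r/4)) := by
    refine Phi_lip _ (fun i => C i * √l0) (fun i u => hC i l0 hl0 u) (fun i => mul_nonneg (hC0 i) (Real.sqrt_nonneg _)) (K := K)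
      (fun i => (hK i).mono fun u hu => ?_) (by push_cast; exact hl1.le)
    refine mem_iInter.1 (hrs ?_) i
    rw [Metric.mem_ball] at hu ⊢
    linarith [dist_triangle u (cu l0) us]
  have hcd := ift (Phi_smooth hβ (ofF (ψ a)) hl0 hU0) hcu.continuousAt ?_ (by norm_num : (1/2 : NNReal) < 1)
    (Metric.ball_mem_nhds _ (by positivity)) hlip
  · have h1 : ContDiffAt ℝ SM (fun t => ev1 m (cu (t - a))) t0 := by
      refine (ev1 m).contDiff.contDiffAt.comp t0 (ContDiffAt.comp (g := cu) t0 ?_ (by fun_prop))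
      rw [ha, _root_.sub_sub_cancel]; exact hcd
    refine h1.congr_of_eventuallyEq ?_
    filter_upwards [Ioo_mem_nhds (show t0 - l0 < t0 by linarith) (show t0 < t0 + l0 by linarith)] with t htt
    ext x
    rw [ev1_apply, hcua (t - a) ⟨by linarith [htt.1], by linarith [htt.2]⟩, h.E_apply (hIcc t ⟨htt.1.le, htt.2.le⟩).1.1]
    simp
  · filter_upwards [Ioo_mem_nhds hl0 (show l0 < 2 * l0 by linarith)] with l hl
    have hl' : l ∈ Icc 0 (2*l0) := ⟨hl.1.le, hl.2.le⟩
    have hs : ∀ s ∈ Icc a (a + l), s ∈ Icc (t0 - l0) (t0 + l0) := fun s hs => ⟨hs.1, by linarith [hs.2, hl.2]⟩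
    exact h.duh hl.1 (by linarith [hl.2]) (fun s h' => (hIcc s (hs s h')).1.1) (hcua l hl') hc (fun s h' => (hIcc s (hs s h')).1.2)
end SOL

end

section
set_option linter.all false
variable {m : ℕ}

open scoped Topology BoundedContinuousFunction

def sgE (ε : ℝ) (z : Spc m) (x : Spc m) : Spc m := x - √ε • z
lemma SG_E (ε : ℝ) : SG (sgE (m := m) ε) where
  m y := by unfold sgE; exact (Continuous.measurable (by fun_prop))
  c ω := by unfold sgE; fun_prop
def TE {g : Spc m → ℝ} (hg : Integrable g) (ε : ℝ) : (Spc m →ᵇ ℝ) →L[ℝ] (Spc m →ᵇ ℝ) := avg volume (SG_E ε) (hg.toL1 g)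
lemma TE_apply {g : Spc m → ℝ} (hg : Integrable g) (ε : ℝ) (u) (x : Spc m) : TE hg ε u x = Tk g ε u x := by
  rw [TE, avg_apply]; rfl

lemma kB_int (ε : ℝ) (i) : Integrable (fun ω : Om m => (max 0 ω.1) ^ (-(1/2) : ℝ) * kap1 i ω.2) ((volume.restrict (Ioc 0 (max 0 ε))).prod volume) := by
  have h := (int_half (max 0 ε) (le_max_left _ _))
  have h' : Integrable (fun τ : ℝ => (max 0 τ) ^ (-(1/2) : ℝ)) (volume.restrict (Ioc 0 (max 0 ε))) := by
    refine h.congr ((ae_restrict_iff' measurableSet_Ioc).2 (Eventually.of_forall fun τ hτ => ?_))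
    simp only [max_eq_right hτ.1.le]
  exact h'.mul_prod (int_kap1 i)
def Bop (ε : ℝ) (i : Option (Fin m)) : (Spc m →ᵇ ℝ) →L[ℝ] (Spc m →ᵇ ℝ) :=
  avg ((volume.restrict (Ioc 0 (max 0 ε))).prod volume) SG_B ((kB_int ε i).toL1 _)

lemma Bop_apply {ε : ℝ} (h0 : 0 < ε) (i) (u : Spc m →ᵇ ℝ) (x) : Bop ε i u x = Wop (1/2) (kap1 i) ε u x := by
  rw [Bop, avg_apply, integral_prod _ (SG_B.int (kB_int ε i) u x), max_eq_right h0.le, Wop, intervalIntegral.integral_of_le h0.le]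
  refine setIntegral_congr_fun measurableSet_Ioc fun τ hτ => ?_
  simp only [max_eq_right hτ.1.le, Tk]
  rw [← integral_const_mul]
  congr 1; funext z; rw [mul_assoc]; rfl

lemma Bop_norm (i : Option (Fin m)) : ∃ C, 0 ≤ C ∧ ∀ ε : ℝ, 0 < ε → ‖Bop ε i‖ ≤ C * ε ^ (1/2 : ℝ) := by
  refine ⟨2 * ∫ z : Spc m, |kap1 i z|, mul_nonneg zero_le_two (integral_nonneg fun _ => abs_nonneg _), fun ε h0 => ?_⟩
  refine ContinuousLinearMap.opNorm_le_bound _ (mul_nonneg (mul_nonneg zero_le_two (integral_nonneg fun _ => abs_nonneg _)) (Real.rpow_nonneg h0.le _)) fun u => ?_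
  have hK : 0 ≤ ∫ z : Spc m, |kap1 i z| := integral_nonneg fun _ => abs_nonneg _
  refine (BoundedContinuousFunction.norm_le (by positivity)).2 fun x => ?_
  rw [Bop_apply h0, Wop]
  have h1 := intervalIntegral.norm_integral_le_of_norm_le (f := fun τ : ℝ => τ ^ (-(1/2) : ℝ) * Tk (kap1 i) τ u x) (μ := volume) h0.le
    (g := fun τ : ℝ => τ ^ (-(1/2) : ℝ) * ((∫ z : Spc m, |kap1 i z|) * ‖u‖))
    (Eventually.of_forall fun τ hτ => by
      rw [norm_mul, Real.norm_of_nonneg (Real.rpow_nonneg hτ.1.le _)]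
      exact mul_le_mul_of_nonneg_left (Tk_bound (int_kap1 i) u.continuous.measurable (fun x => u.norm_coe_le_norm x) τ x) (Real.rpow_nonneg hτ.1.le _))
    ((intervalIntegral.intervalIntegrable_rpow' (by norm_num)).mul_const _)
  refine h1.trans (le_of_eq ?_)
  rw [intervalIntegral.integral_mul_const, integral_rpow (Or.inl (by norm_num))]
  norm_num
  ring

section
variable {A ι : Type*} [NormedCommRing A] [NormedAlgebra ℝ A] [Fintype ι]
lemma LamB (β : ℝ) (B : ι → A →L[ℝ] A) (b X : ι → A) : ‖fun j => β • ∑ i, B i (b i * X j - b j * X i)‖ ≤ (|β| * ∑ i, ‖B i‖ * 2) * ‖b‖ * ‖X‖ := by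
  refine (pi_norm_le_iff_of_nonneg (by positivity)).2 fun j => ?_
  rw [norm_smul, Real.norm_eq_abs, mul_assoc |β|, mul_assoc |β|]
  refine mul_le_mul_of_nonneg_left ?_ (abs_nonneg β)
  rw [Finset.sum_mul, Finset.sum_mul]
  refine norm_sum_le_of_le _ fun i _ => ((B i).le_opNorm _).trans ?_
  rw [mul_assoc, mul_assoc]
  refine mul_le_mul_of_nonneg_left ?_ (norm_nonneg _)
  refine (norm_sub_le _ _).trans ?_
  have h1 := (norm_mul_le (b i) (X j)).trans (mul_le_mul (norm_le_pi_norm b i) (norm_le_pi_norm X j) (norm_nonneg _) (norm_nonneg _))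
  have h2 := (norm_mul_le (b j) (X i)).trans (mul_le_mul (norm_le_pi_norm b j) (norm_le_pi_norm X i) (norm_nonneg _) (norm_nonneg _))
  linarith
def Lam (β : ℝ) (B : ι → A →L[ℝ] A) : (ι → A) →L[ℝ] (ι → A) →L[ℝ] (ι → A) :=
  LinearMap.mkContinuous₂ (LinearMap.mk₂ ℝ (fun b X j => β • ∑ i, B i (b i * X j - b j * X i))
    (fun b b' X => by
      funext j; simp only [Pi.add_apply, ← smul_add, ← Finset.sum_add_distrib, ← map_add]
      congr 1; refine Finset.sum_congr rfl fun i _ => ?_; congr 1; ring)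
    (fun c b X => by
      funext j; simp only [Pi.smul_apply, smul_mul_assoc]
      rw [smul_comm c β]
      congr 1; rw [Finset.smul_sum]; refine Finset.sum_congr rfl fun i _ => ?_; rw [← map_smul, smul_sub])
    (fun b X X' => by
      funext j; simp only [Pi.add_apply, ← smul_add, ← Finset.sum_add_distrib, ← map_add]
      congr 1; refine Finset.sum_congr rfl fun i _ => ?_; congr 1; ring)
    (fun c b X => by
      funext j; simp only [Pi.smul_apply, mul_smul_comm]
      rw [smul_comm c β]
      congr 1; rw [Finset.smul_sum]; refine Finset.sum_congr rfl fun i _ => ?_; rw [← map_smul, smul_sub])) (|β| * ∑ i, ‖B i‖ * 2) (LamB β B)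

lemma Lam_apply (β : ℝ) (B : ι → A →L[ℝ] A) (b X : ι → A) (j : ι) : Lam β B b X j = β • ∑ i, B i (b i * X j - b j * X i) := rfl

lemma Lam_norm (β : ℝ) (B : ι → A →L[ℝ] A) (b) : ‖Lam β B b‖ ≤ (|β| * ∑ i, ‖B i‖ * 2) * ‖b‖ :=
  ContinuousLinearMap.opNorm_le_bound _ (by positivity) (LamB β B b)

lemma LIN0 {U : Type*} [NormedAddCommGroup U] [NormedSpace ℝ U] [CompleteSpace U] {L : ℝ → U →L[ℝ] U} {R X : ℝ → U} {t0 : ℝ}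
    (hL : ContDiffAt ℝ SM L t0) (hR : ContDiffAt ℝ SM R t0) (h1 : ‖L t0‖ < 1)
    (heq : ∀ᶠ t in 𝓝 t0, X t = R t + L t (X t)) : ContDiffAt ℝ SM X t0 := by
  have h2 : ContDiffAt ℝ SM (fun t => Ring.inverse (1 - L t)) t0 := by
    obtain ⟨U, hU⟩ := isUnit_one_sub_of_norm_lt_one h1
    have := contDiffAt_ringInverse ℝ (n := SM) U
    rw [hU] at this
    exact ContDiffAt.comp (f := fun t => 1 - L t) t0 this (contDiffAt_const.sub hL)
  refine (h2.clm_apply hR).congr_of_eventuallyEq ?_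
  filter_upwards [heq, (hL.continuousAt.norm.eventually_lt continuousAt_const h1)] with t ht hn
  have e : R t = (1 - L t) (X t) := by
    rw [ContinuousLinearMap.sub_apply, ContinuousLinearMap.one_apply]; nth_rewrite 1 [ht]; abel
  rw [e, ← ContinuousLinearMap.mul_apply, Ring.inverse_mul_cancel _ (isUnit_one_sub_of_norm_lt_one hn), ContinuousLinearMap.one_apply]

lemma LIN [CompleteSpace A] {β : ℝ} {B : ι → A →L[ℝ] A} {b R X : ℝ → ι → A} {t0 : ℝ}
    (hb : ContDiffAt ℝ SM b t0) (hR : ContDiffAt ℝ SM R t0) (hs : (|β| * ∑ i, ‖B i‖ * 2) * ‖b t0‖ < 1)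
    (heq : ∀ᶠ t in 𝓝 t0, X t = R t + Lam β B (b t) (X t)) : ContDiffAt ℝ SM X t0 :=
  LIN0 (ContDiffAt.comp (g := Lam β B) t0 (ContinuousLinearMap.contDiff _).contDiffAt hb) hR ((Lam_norm β B _).trans_lt hs) heq
end

lemma LD_deriv {f fk : ℝ → Spc m →ᵇ ℝ} {t : ℝ} {f' fk' : Spc m →ᵇ ℝ} (hf : HasDerivAt f f' t) (hfk : HasDerivAt fk fk' t) {k}
    (h : ∀ᶠ s in 𝓝 t, LD k (f s) (fk s)) : LD k f' fk' := by
  intro x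
  rw [hasDerivAt_iff_tendsto_slope_zero] at hf hfk
  have hsh : Tendsto (fun r : ℝ => t + r) (𝓝[≠] 0) (𝓝 t) := by
    have : Continuous fun r : ℝ => t + r := by fun_prop
    simpa using (this.tendsto 0).mono_left nhdsWithin_le_nhds
  have h0 := mem_of_mem_nhds h
  have key := hasDerivAt_of_tendstoUniformly (l := 𝓝[≠] (0:ℝ)) (f := fun r (s : ℝ) => (r⁻¹ • (f (t + r) - f t)) (x + s • ee k))
    (f' := fun r (s : ℝ) => (r⁻¹ • (fk (t + r) - fk t)) (x + s • ee k)) (g := fun s : ℝ => f' (x + s • ee k)) (g' := fun s : ℝ => fk' (x + s • ee k)) ?_ ?_ ?_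
  · have := key 0
    simpa using this
  · exact (BoundedContinuousFunction.tendsto_iff_tendstoUniformly.1 hfk).comp (fun s : ℝ => x + s • ee k)
  · filter_upwards [hsh.eventually h] with r hr s
    exact ((shift_hasDerivAt hr x s).sub (shift_hasDerivAt h0 x s)).const_mul r⁻¹
  · intro s
    exact ((BoundedContinuousFunction.tendsto_iff_tendstoUniformly.1 hf).tendsto_at _)

end

section
set_option linter.all false
variable {m : ℕ}

open scoped Topology BoundedContinuousFunction

lemma W_sub {p : ℝ} (hp : 1 ≤ p) {a : ℝ} (ha : a + ex m p < 1) {g : Spc m → ℝ} (hg : GB g) (hc : Continuous g)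
    {f f' : Spc m → ℝ} (hf : PL p f) (hf' : PL p f') {ε : ℝ} (h0 : 0 < ε) (h1 : ε ≤ 1) (x : Spc m) :
    Wop a g ε (fun y => f y - f' y) x = Wop a g ε f x - Wop a g ε f' x := by
  obtain ⟨C, _, hC⟩ := W_all hp ha hg hc
  rw [Wop, Wop, Wop, ← intervalIntegral.integral_sub (hC f hf x ε h0 h1).1 (hC f' hf' x ε h0 h1).1]
  refine intervalIntegral.integral_congr_ae (Eventually.of_forall fun τ hτ => ?_)
  rw [uIoc_of_le h0.le] at hτ
  rw [Tk_sub hp hg hc hf hf' hτ.1 (hτ.2.trans h1), mul_sub]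

lemma W_eqz {p : ℝ} (hp : 1 ≤ p) {a : ℝ} (ha : a + ex m p < 1) {g : Spc m → ℝ} (hg : GB g) (hc : Continuous g)
    {f f' : Spc m → ℝ} (hf : PL p f) (hf' : PL p f') (hz : nL p (fun y => f y - f' y) = 0) {ε : ℝ} (h0 : 0 < ε) (h1 : ε ≤ 1) (x : Spc m) :
    Wop a g ε f x = Wop a g ε f' x := by
  obtain ⟨C, _, hC⟩ := W_all hp ha hg hc
  have := (hC _ (hf.sub hp hf') x ε h0 h1).2
  rw [hz, mul_zero, W_sub hp ha hg hc hf hf' h0 h1] at this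
  exact sub_eq_zero.1 (abs_nonpos_iff.1 this)

section
variable {V u : Spc m → ℝ} {p β : ℝ} {d : Spc m → ℝ} {ε : ℝ}

def HB (V u : Spc m → ℝ) (i k : Option (Fin m)) (x : Spc m) : ℝ := db V u (pd (ee none) u) i k x * u x + bb V u i x * pd (ee k) u x

lemma bu_C1 (hV : VH V) (hu : UH p u) (i) : C1P (fun x => bb V u i x * u x) (HB V u i) := (bb_C1 hV hu i).mul hu.c

lemma eq1 (hV : VH V) (hp : 1 ≤ p) (hex : 1/2 + ex m p < 1) (hβ : 0 < β) (hu : UH p u) (hdp : Per d) (hdc : Continuous d)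
    (hz : nL p (fun y => d y - rt V β u y) = 0) (h0 : 0 < ε) (h1 : ε ≤ 1) (j) (x : Spc m) :
    pd (ee j) u x = (√ε)⁻¹ * Tk (kap1 j) ε u x - β * Wop (1/2) (kap1 j) ε d x +
      β * (Tk kap ε (fun y => bb V u j y * u y) x - bb V u j x * u x) +
      β * ∑ i, Wop (1/2) (kap1 i) ε (fun y => bb V u i y * pd (ee j) u y - bb V u j y * pd (ee i) u y) x := by
  obtain ⟨K, _, hK⟩ := hu.c.per.bounded hu.c.cont
  obtain ⟨Kd, _, hKd⟩ := hdp.bounded hdc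
  have hPd : PL p d := PL.of_cont hdp hdc hp
  have hb := bu_C1 hV hu
  have hPB : ∀ i k, PL p (HB V u i k) := fun i k => PL.of_cont ((hb i).peri k) ((hb i).c k) hp
  have hs : LD j u (fun x => (√ε)⁻¹ * Tk (kap1 j) ε u x - β * Wop (1/2) (kap1 j) ε d x +
      β * ∑ i, Wop (1/2) (kap1 i) ε (HB V u i j) x) := by
    have e : ∀ x, u x = Tk kap ε u x - β * Wop 0 kap ε d x + β * ∑ i, Wop (1/2) (kap1 i) ε (fun y => bb V u i y * u y) x := fun x => by
      rw [W_eqz hp (by linarith) GB_kap continuous_kap hPd (rt_PL hV hp hβ hu) hz h0 h1]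
      exact star hV hp hex hβ hu h0 h1 x
    refine fun x => HasDerivAt.congr_of_eventuallyEq ?_ (Eventually.of_forall fun s => e _)
    refine ((LD.sub (fun x => DK0 AK_kap hu.c.cont.measurable hK h0 x j) ((A_LD hdc.measurable hKd h0 j).cmul β)).add
      ((LD.sum fun i => ?_).cmul β)) x
    obtain ⟨Kb, _, hKb⟩ := (hb i).per.bounded (hb i).cont
    exact W_LD hp hex (GB_kap1 i) (continuous_kap1 i) (hb i).cont hKb (PL.of_cont (hb i).per (hb i).cont hp) ((hb i).ld j) (hPB i j) h0 h1
  rw [(hu.c.ld j x).unique (hs x), R0 (hb j) hp hex (hPB j) h0 h1 x, add_assoc, ← mul_add, ← Finset.sum_add_distrib]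
  beta_reduce; congr 2
  refine Finset.sum_congr rfl fun i _ => ?_
  rw [← sub_eq_iff_eq_add', ← W_sub hp hex (GB_kap1 i) (continuous_kap1 i) (hPB i j) (hPB j i) h0 h1]
  congr 1; funext y
  simp only [HB, db_symm hV i j]; ring

lemma eq2 (hV : VH V) (hp : 1 ≤ p) (hex : 1/2 + ex m p < 1) (hβ : 0 < β) (hu : UH p u) {dk} (hd : C1P d dk)
    (hz : nL p (fun y => d y - rt V β u y) = 0) (h0 : 0 < ε) (h1 : ε ≤ 1) (j k) :
    (∀ x : Spc m, pd (ee k) (pd (ee j) u) x = (√ε)⁻¹ * Tk (kap1 j) ε (pd (ee k) u) x - β * Wop (1/2) (kap1 j) ε (dk k) x +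
      β * (Tk kap ε (HB V u j k) x - HB V u j k x) +
      β * ∑ i, Wop (1/2) (kap1 i) ε (fun y => (db V u (pd (ee none) u) i k y * pd (ee j) u y + bb V u i y * pd (ee k) (pd (ee j) u) y) -
        (db V u (pd (ee none) u) j k y * pd (ee i) u y + bb V u j y * pd (ee k) (pd (ee i) u) y)) x) ∧
      Continuous (pd (ee k) (pd (ee j) u)) := by
  have hb := bu_C1 hV hu
  have hPB : ∀ i k, PL p (HB V u i k) := fun i k => PL.of_cont ((hb i).peri k) ((hb i).c k) hp
  have hPu := fun k => PL.of_cont (hu.c.peri k) (hu.c.c k) hp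
  have hPd := PL.of_cont (hd.peri k) (hd.c k) hp
  obtain ⟨K, _, hK⟩ := hu.c.per.bounded hu.c.cont
  obtain ⟨Kd, _, hKd⟩ := hd.per.bounded hd.cont
  obtain ⟨Kb, _, hKb⟩ := (hb j).per.bounded (hb j).cont
  have hP : ∀ i j, PL p (fun y => db V u (pd (ee none) u) i k y * pd (ee j) u y + bb V u i y * pd (ee k) (pd (ee j) u) y) := fun i j =>
    (((hPu j).cbmul ((bb_C1 hV hu i).peri k) ((bb_C1 hV hu i).c k)).add hp ((hu.pl j k).cbmul (bb_C1 hV hu i).per (bb_C1 hV hu i).cont)).1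
  have hD : ∀ i j, LD k (fun y => bb V u i y * pd (ee j) u y) (fun y => db V u (pd (ee none) u) i k y * pd (ee j) u y + bb V u i y * pd (ee k) (pd (ee j) u) y) :=
    fun i j => ((bb_C1 hV hu i).ld k).mul (hu.l j k)
  have hC : ∀ i j, Continuous (fun y => bb V u i y * pd (ee j) u y) := fun i j => (bb_C1 hV hu i).cont.mul (hu.c.c j)
  have hPr : ∀ i j, Per (fun y => bb V u i y * pd (ee j) u y) := fun i j l x => by
    simp only [(bb_C1 hV hu i).per l x, hu.c.peri j l x]
  have hs : LD k (pd (ee j) u) (fun x => (√ε)⁻¹ * Tk (kap1 j) ε (pd (ee k) u) x - β * Wop (1/2) (kap1 j) ε (dk k) x +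
      β * (Tk kap ε (HB V u j k) x - HB V u j k x) +
      β * ∑ i, Wop (1/2) (kap1 i) ε (fun y => (db V u (pd (ee none) u) i k y * pd (ee j) u y + bb V u i y * pd (ee k) (pd (ee j) u) y) -
        (db V u (pd (ee none) u) j k y * pd (ee i) u y + bb V u j y * pd (ee k) (pd (ee i) u) y)) x) := by
    refine fun x => HasDerivAt.congr_of_eventuallyEq ?_ (Eventually.of_forall fun s => eq1 hV hp hex hβ hu hd.per hd.cont hz h0 h1 j _)
    refine (((((LCd hp (GB_kap1 j) (continuous_kap1 j) hu.c.cont hK (hu.c.ld k) (hPu k) h0 h1).cmul _).sub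
      ((W_LD hp hex (GB_kap1 j) (continuous_kap1 j) hd.cont hKd (PL.of_cont hd.per hd.cont hp) (hd.ld k) hPd h0 h1).cmul β)).add
      (((LCd hp GB_kap continuous_kap (hb j).cont hKb ((hb j).ld k) (hPB j k) h0 h1).sub ((hb j).ld k)).cmul β)).add
      ((LD.sum fun i => ?_).cmul β)) x
    have hc' := (hC i j).sub (hC j i)
    have hp' : Per (fun y => bb V u i y * pd (ee j) u y - bb V u j y * pd (ee i) u y) := fun l x => by
      have e1 := hPr i j l x; have e2 := hPr j i l x; simp only at e1 e2; simp only [e1, e2]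
    obtain ⟨K', _, hK'⟩ := hp'.bounded hc'
    exact W_LD hp hex (GB_kap1 i) (continuous_kap1 i) hc' hK' (PL.of_cont hp' hc' hp) ((hD i j).sub (hD j i)) ((hP i j).sub hp (hP j i)) h0 h1
  have e := fun x => (hu.l j k x).unique (hs x)
  refine ⟨e, ?_⟩
  rw [funext e]
  exact ((((Tk_cont hp (GB_kap1 j) (continuous_kap1 j) (hPu k) h0 h1).const_mul _).sub ((W_cont hp hex (GB_kap1 j) (continuous_kap1 j) hPd h0 h1).const_mul _)).add
    (((Tk_cont hp GB_kap continuous_kap (hPB j k) h0 h1).sub ((hb j).c k)).const_mul _)).add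
    ((continuous_finsetSum _ fun i _ => W_cont hp hex (GB_kap1 i) (continuous_kap1 i) ((hP i j).sub hp (hP j i)) h0 h1).const_mul _)
end

end

section
set_option linter.all false
variable {m : ℕ}

open scoped Topology BoundedContinuousFunction

lemma eps_b (m : ℕ) (β N : ℝ) (hN : 0 ≤ N) : ∃ ε : ℝ, 0 < ε ∧ ε ≤ 1 ∧ (|β| * ∑ i, ‖Bop (m := m) ε i‖ * 2) * N < 1 := by
  choose C hC0 hC using Bop_norm (m := m)
  obtain ⟨ε, h0, h1, h2⟩ := small_eps (a := 1/2) (by norm_num) (|β| * (∑ i, C i * 2) * N) (η := 1/2) (by norm_num)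
  refine ⟨ε, h0, h1, lt_of_le_of_lt ?_ (show (1/2:ℝ) < 1 by norm_num)⟩
  refine le_trans ?_ h2
  have : ∑ i, ‖Bop (m := m) ε i‖ * 2 ≤ (∑ i, C i * 2) * ε ^ (1/2:ℝ) := by
    rw [Finset.sum_mul]
    exact Finset.sum_le_sum fun i _ => by linarith [hC i ε h0]
  calc (|β| * ∑ i, ‖Bop (m := m) ε i‖ * 2) * N ≤ (|β| * ((∑ i, C i * 2) * ε ^ (1/2:ℝ))) * N := by gcongr
    _ = _ := by ring

lemma sm_deriv {U : Type*} [NormedAddCommGroup U] [NormedSpace ℝ U] {f : ℝ → U} {t : ℝ} (h : ContDiffAt ℝ SM f t) :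
    ContDiffAt ℝ SM (deriv f) t ∧ HasDerivAt f (deriv f t) t :=
  ⟨(h.fderiv_right (m := SM) (by decide)).clm_apply (contDiffAt_const (c := (1:ℝ))), (h.differentiableAt (by simp [SM])).hasDerivAt⟩

lemma ofF_per {f : Spc m → ℝ} (hp : Per f) (hc : Continuous f) : (⇑(ofF f) : Spc m → ℝ) = f := by
  obtain ⟨K, _, hK⟩ := hp.bounded hc
  exact funext (ofF_apply hc hK)

def wE (V : Spc m → ℝ) (i k : Option (Fin m)) : Spc m →ᵇ ℝ := ofF (pd (ee k) (pd (ee i) V))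
lemma wE_coe {V : Spc m → ℝ} (hV : VH V) (i k) : ⇑(wE V i k) = pd (ee k) (pd (ee i) V) := ofF_per ((hV.c1 i).peri k) ((hV.c1 i).c k)
lemma vE_coe {V : Spc m → ℝ} (hV : VH V) (i) : ⇑(vE V i) = pd (ee i) V := funext (vE_apply hV i)

def dE (V : Spc m → ℝ) (u u1 : Spc m →ᵇ ℝ) : Option (Fin m) → Option (Fin m) → Spc m →ᵇ ℝ
  | none, none => wE V none none - (M0 m (wE V none none * u + vE V none * u1) * M0 m u - M0 m (vE V none * u) * M0 m u1) * (Ring.inverse (M0 m u)) ^ 2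
  | i, k => wE V i k

lemma dE_coe {V : Spc m → ℝ} (hV : VH V) {u : Spc m →ᵇ ℝ} (u1) {c : ℝ} (hc : 0 < c) (hl : ∀ x, c ≤ Mop u x) (i k) :
    ⇑(dE V u u1 i k) = db V u u1 i k := by
  funext x
  rcases i with _ | i
  · rcases k with _ | k
    · simp only [dE, BoundedContinuousFunction.sub_apply, BoundedContinuousFunction.mul_apply, BoundedContinuousFunction.pow_apply,
        (inv_BCF (M0 m u) hc (fun x => by rw [M0_apply]; exact hl x)).2, M0_apply, wE_coe hV, db, phi1, div_eq_mul_inv, inv_pow]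
      rw [BoundedContinuousFunction.coe_add, BoundedContinuousFunction.coe_mul, BoundedContinuousFunction.coe_mul, BoundedContinuousFunction.coe_mul,
        wE_coe hV, vE_coe hV]
      rfl
    · simp only [dE, db, wE_coe hV]
  · simp only [dE, db, wE_coe hV]

lemma dE_smooth (V : Spc m → ℝ) {u u1 : ℝ → Spc m →ᵇ ℝ} {t : ℝ} (hu : ContDiffAt ℝ SM u t) (hu1 : ContDiffAt ℝ SM u1 t) (hU : IsUnit (M0 m (u t))) (i k) :
    ContDiffAt ℝ SM (fun s => dE V (u s) (u1 s) i k) t := by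
  have hM : ∀ {f : ℝ → Spc m →ᵇ ℝ}, ContDiffAt ℝ SM f t → ContDiffAt ℝ SM (fun s => M0 m (f s)) t := fun hf => (M0 m).contDiff.contDiffAt.comp t hf
  have h2 : ContDiffAt ℝ SM (fun s => Ring.inverse (M0 m (u s))) t := by
    obtain ⟨U, hU⟩ := hU
    have := contDiffAt_ringInverse ℝ (n := SM) U
    rw [hU] at this
    exact ContDiffAt.comp (g := Ring.inverse) (f := fun s => M0 m (u s)) t this (hM hu)
  rcases i with _ | i
  · rcases k with _ | k
    · exact contDiffAt_const.sub ((((hM ((contDiffAt_const.mul hu).add (contDiffAt_const.mul hu1))).mul (hM hu)).sub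
        ((hM (contDiffAt_const.mul hu)).mul (hM hu1))).mul (h2.pow 2))
    · exact contDiffAt_const
  · exact contDiffAt_const

namespace SOL
variable {V : Spc m → ℝ} {β p : ℝ} {I : Set ℝ} {ψ : ℝ → Spc m → ℝ}

def Q (ψ : ℝ → Spc m → ℝ) (t : ℝ) : Spc m →ᵇ ℝ := ofF (ψ t)
def Q1 (ψ : ℝ → Spc m → ℝ) (t : ℝ) (j : Option (Fin m)) : Spc m →ᵇ ℝ := ofF (pd (ee j) (ψ t))
def Q2 (ψ : ℝ → Spc m → ℝ) (k : Option (Fin m)) (t : ℝ) (j : Option (Fin m)) : Spc m →ᵇ ℝ := ofF (pd (ee k) (pd (ee j) (ψ t)))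
def D (ψ : ℝ → Spc m → ℝ) : ℝ → Spc m →ᵇ ℝ := deriv (Q ψ)
def D1 (ψ : ℝ → Spc m → ℝ) (k : Option (Fin m)) : ℝ → Spc m →ᵇ ℝ := deriv (fun s => Q1 ψ s k)
def bc (V : Spc m → ℝ) (ψ : ℝ → Spc m → ℝ) (t : ℝ) (j : Option (Fin m)) : Spc m →ᵇ ℝ := bY (M0 m) (vE V) j (Q ψ t)

lemma Q_coe (h : SOL V β p I ψ) {t} (ht : t ∈ I) : ⇑(Q ψ t) = ψ t := funext (h.E_apply ht)
lemma Q1_coe (h : SOL V β p I ψ) {t} (ht : t ∈ I) (j) : ⇑(Q1 ψ t j) = pd (ee j) (ψ t) := ofF_per ((h.u t ht).c.peri j) ((h.u t ht).c.c j)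
lemma low (h : SOL V β p I ψ) {t} (ht : t ∈ I) : ∃ c, 0 < c ∧ ∀ x, c ≤ Mop (Q ψ t) x := by
  obtain ⟨c, hc, hl⟩ := h.lowM ht
  exact ⟨c, hc, fun x => by rw [h.Q_coe ht]; exact mem_of_mem_nhds hl x⟩
lemma unit (h : SOL V β p I ψ) {t} (ht : t ∈ I) : IsUnit (M0 m (Q ψ t)) := by
  obtain ⟨c, hc, hl⟩ := h.low ht
  exact (inv_BCF _ hc fun x => by rw [M0_apply]; exact hl x).1
lemma bc_coe (h : SOL V β p I ψ) {t} (ht : t ∈ I) (j) : ⇑(bc V ψ t j) = bb V (ψ t) j := by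
  obtain ⟨c, hc, hl⟩ := h.low ht
  funext x; rw [bc, bE_apply h.hV hc hl, h.Q_coe ht]
lemma dc_coe (h : SOL V β p I ψ) {t} (ht : t ∈ I) (i k) : ⇑(dE V (Q ψ t) (Q1 ψ t none) i k) = db V (ψ t) (pd (ee none) (ψ t)) i k := by
  obtain ⟨c, hc, hl⟩ := h.low ht
  rw [dE_coe h.hV _ hc hl, h.Q_coe ht, h.Q1_coe ht]
lemma bc_smooth (h : SOL V β p I ψ) {t} (ht : t ∈ I) : ContDiffAt ℝ SM (bc V ψ) t :=
  contDiffAt_pi.2 fun j => ContDiffAt.comp (g := bY (M0 m) (vE V) j) t (bY_smooth _ _ j (h.unit ht)) (h.smooth ht)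
lemma D_smooth (h : SOL V β p I ψ) {t} (ht : t ∈ I) : ContDiffAt ℝ SM (D ψ) t := (sm_deriv (h.smooth ht)).1
lemma D_has (h : SOL V β p I ψ) {t} (ht : t ∈ I) : HasDerivAt (Q ψ) (D ψ t) t := (sm_deriv (h.smooth ht)).2

lemma D_per (h : SOL V β p I ψ) {t} (ht : t ∈ I) : Per (D ψ t) := by
  intro i x
  have e : ∀ y, HasDerivAt (fun s => Q ψ s y) (D ψ t y) t := fun y =>
    (BoundedContinuousFunction.evalCLM (β := ℝ) ℝ y).hasFDerivAt.comp_hasDerivAt t (h.D_has ht)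
  refine (e _).unique ((e x).congr_of_eventuallyEq ?_)
  filter_upwards [h.op.mem_nhds ht] with s hs
  rw [h.Q_coe hs, (h.u s hs).c.per i x]

lemma D_z (h : SOL V β p I ψ) {t} (ht : t ∈ I) : nL p (fun y => D ψ t y - rt V β (ψ t) y) = 0 := by
  refine le_antisymm (le_of_forall_pos_le_add fun η hη => ?_) (nL_nonneg _ _)
  have hd := h.D_has ht
  rw [hasDerivAt_iff_tendsto_slope_zero, Metric.tendsto_nhds] at hd
  have hsh : Tendsto (fun r : ℝ => t + r) (𝓝[≠] 0) (𝓝 t) := by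
    have : Continuous fun r : ℝ => t + r := by fun_prop
    simpa using (this.tendsto 0).mono_left nhdsWithin_le_nhds
  obtain ⟨r, hr1, hr2, hr3⟩ := ((hd _ (half_pos hη)).and ((hsh.eventually (h.op.mem_nhds ht)).and
    ((h.e t ht).eventually_lt_const (half_pos hη)))).exists
  have hq : PL p (fun x => (ψ (t + r) x - ψ t x) / r) := by
    have := ((h.pl hr2).sub h.hp (h.pl ht)).cmul r⁻¹
    simpa only [div_eq_inv_mul] using this
  have h2 : PL p (fun x => D ψ t x - (ψ (t + r) x - ψ t x) / r) ∧ nL p (fun x => D ψ t x - (ψ (t + r) x - ψ t x) / r) ≤ η / 2 := by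
    refine PL.of_bdd (fun i x => ?_) ((D ψ t).continuous.measurable.sub hq.meas) (fun x => ?_) h.hp
    · have := hq.per i x; rw [Pi.sub_apply, Pi.sub_apply, h.D_per ht i x]; linarith
    · have := (BoundedContinuousFunction.dist_coe_le_dist (f := r⁻¹ • (Q ψ (t + r) - Q ψ t)) (g := D ψ t) x).trans hr1.le
      rw [dist_comm, Real.dist_eq, BoundedContinuousFunction.smul_apply, BoundedContinuousFunction.sub_apply, h.Q_coe ht, h.Q_coe hr2, smul_eq_mul, ← div_eq_inv_mul] at this
      exact this
  have h3 := (PL.add h.hp h2.1 (hq.sub h.hp (h.rpl ht))).2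
  rw [show (fun x => D ψ t x - (ψ (t + r) x - ψ t x) / r + ((ψ (t + r) x - ψ t x) / r - rt V β (ψ t) x)) = fun y => D ψ t y - rt V β (ψ t) y from funext fun x => by ring] at h3
  linarith [h2.2]

lemma Q1_smooth (h : SOL V β p I ψ) {t0} (ht0 : t0 ∈ I) : ContDiffAt ℝ SM (Q1 ψ) t0 := by
  obtain ⟨ε, h0, h1, hs⟩ := eps_b m β ‖bc V ψ t0‖ (norm_nonneg _)
  have hb := contDiffAt_pi.1 (h.bc_smooth ht0)
  have hQ : ContDiffAt ℝ SM (Q ψ) t0 := h.smooth ht0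
  have hL : ∀ (L : (Spc m →ᵇ ℝ) →L[ℝ] (Spc m →ᵇ ℝ)) {f : ℝ → Spc m →ᵇ ℝ}, ContDiffAt ℝ SM f t0 → ContDiffAt ℝ SM (fun s => L (f s)) t0 :=
    fun L _ hf => L.contDiff.contDiffAt.comp t0 hf
  refine LIN (b := bc V ψ) (R := fun t j => (√ε)⁻¹ • TE (int_kap1 j) ε (Q ψ t) - β • Bop ε j (D ψ t) +
    β • (TE int_kap ε (bc V ψ t j * Q ψ t) - bc V ψ t j * Q ψ t)) (h.bc_smooth ht0) (contDiffAt_pi.2 fun j => ?_) hs ?_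
  · exact (((hL _ hQ).const_smul _).sub ((hL _ (h.D_smooth ht0)).const_smul _)).add (((hL _ ((hb j).mul hQ)).sub ((hb j).mul hQ)).const_smul _)
  · filter_upwards [h.op.mem_nhds ht0] with t ht
    funext j; ext x
    rw [h.Q1_coe ht, eq1 h.hV h.hp h.hex h.hβ (h.u t ht) (h.D_per ht) (D ψ t).continuous (h.D_z ht) h0 h1 j x]
    simp only [Pi.add_apply, Lam_apply, BoundedContinuousFunction.add_apply, BoundedContinuousFunction.sub_apply, BoundedContinuousFunction.smul_apply,
      BoundedContinuousFunction.sum_apply, smul_eq_mul, TE_apply, Bop_apply h0, BoundedContinuousFunction.coe_mul, BoundedContinuousFunction.coe_sub,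
      h.Q_coe ht, h.bc_coe ht, h.Q1_coe ht]
    rfl

lemma Q1_LD (h : SOL V β p I ψ) {t} (ht : t ∈ I) (k) : LD k (D ψ t) (D1 ψ k t) := by
  refine LD_deriv (h.D_has ht) (sm_deriv (contDiffAt_pi.1 (h.Q1_smooth ht) k)).2 ?_
  filter_upwards [h.op.mem_nhds ht] with s hs
  rw [h.Q_coe hs, h.Q1_coe hs]; exact (h.u s hs).c.ld k
lemma D_C1 (h : SOL V β p I ψ) {t} (ht : t ∈ I) : C1P (D ψ t) (fun k => D1 ψ k t) :=
  C1P.of_LD (h.D_per ht) (h.Q1_LD ht) fun k => BoundedContinuousFunction.continuous _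

lemma Q2_cont (h : SOL V β p I ψ) {t} (ht : t ∈ I) (j k) : Continuous (pd (ee k) (pd (ee j) (ψ t))) :=
  (eq2 h.hV h.hp h.hex h.hβ (h.u t ht) (h.D_C1 ht) (h.D_z ht) one_pos le_rfl j k).2
lemma Q2_coe (h : SOL V β p I ψ) {t} (ht : t ∈ I) (j k) : ⇑(Q2 ψ k t j) = pd (ee k) (pd (ee j) (ψ t)) :=
  ofF_per ((h.u t ht).pl j k).per (h.Q2_cont ht j k)

lemma Q2_smooth (h : SOL V β p I ψ) {t0} (ht0 : t0 ∈ I) (k) : ContDiffAt ℝ SM (Q2 ψ k) t0 := by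
  obtain ⟨ε, h0, h1, hs⟩ := eps_b m β ‖bc V ψ t0‖ (norm_nonneg _)
  have hb := contDiffAt_pi.1 (h.bc_smooth ht0)
  have hQ : ContDiffAt ℝ SM (Q ψ) t0 := h.smooth ht0
  have hQ1 := contDiffAt_pi.1 (h.Q1_smooth ht0)
  have hE := dE_smooth V hQ (hQ1 none) (h.unit ht0)
  have hL : ∀ (L : (Spc m →ᵇ ℝ) →L[ℝ] (Spc m →ᵇ ℝ)) {f : ℝ → Spc m →ᵇ ℝ}, ContDiffAt ℝ SM f t0 → ContDiffAt ℝ SM (fun s => L (f s)) t0 :=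
    fun L _ hf => L.contDiff.contDiffAt.comp t0 hf
  have hH : ∀ j, ContDiffAt ℝ SM (fun t => dE V (Q ψ t) (Q1 ψ t none) j k * Q ψ t + bc V ψ t j * Q1 ψ t k) t0 := fun j =>
    ((hE j k).mul hQ).add ((hb j).mul (hQ1 k))
  refine LIN (b := bc V ψ) (R := fun t j => (√ε)⁻¹ • TE (int_kap1 j) ε (Q1 ψ t k) - β • Bop ε j (D1 ψ k t) +
    β • (TE int_kap ε (dE V (Q ψ t) (Q1 ψ t none) j k * Q ψ t + bc V ψ t j * Q1 ψ t k) - (dE V (Q ψ t) (Q1 ψ t none) j k * Q ψ t + bc V ψ t j * Q1 ψ t k)) +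
    β • ∑ i, Bop ε i (dE V (Q ψ t) (Q1 ψ t none) i k * Q1 ψ t j - dE V (Q ψ t) (Q1 ψ t none) j k * Q1 ψ t i))
    (h.bc_smooth ht0) (contDiffAt_pi.2 fun j => ?_) hs ?_
  · exact ((((hL _ (hQ1 k)).const_smul _).sub ((hL _ (sm_deriv (hQ1 k)).1).const_smul _)).add (((hL _ (hH j)).sub (hH j)).const_smul _)).add
      ((ContDiffAt.sum fun i _ => hL _ (((hE i k).mul (hQ1 j)).sub ((hE j k).mul (hQ1 i)))).const_smul _)
  · filter_upwards [h.op.mem_nhds ht0] with t ht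
    funext j; ext x
    rw [h.Q2_coe ht, (eq2 h.hV h.hp h.hex h.hβ (h.u t ht) (h.D_C1 ht) (h.D_z ht) h0 h1 j k).1 x]
    rw [Pi.add_apply, Lam_apply, add_assoc (_ + _), ← smul_add, ← Finset.sum_add_distrib]
    simp only [← map_add, BoundedContinuousFunction.add_apply, BoundedContinuousFunction.sub_apply, BoundedContinuousFunction.smul_apply,
      BoundedContinuousFunction.sum_apply, smul_eq_mul, TE_apply, Bop_apply h0, BoundedContinuousFunction.coe_mul, BoundedContinuousFunction.coe_sub, BoundedContinuousFunction.coe_add,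
      h.Q_coe ht, h.bc_coe ht, h.Q1_coe ht, h.Q2_coe ht, h.dc_coe ht]
    congr 2
    refine Finset.sum_congr rfl fun i _ => ?_
    congr 1; funext y
    simp only [Pi.add_apply, Pi.mul_apply, Pi.sub_apply]; ring
end SOL

end

section
set_option linter.all false
variable {m : ℕ}

open scoped Topology BoundedContinuousFunction

abbrev ZZ (m : ℕ) := (Spc m →ᵇ ℝ) × (Option (Fin m) → Spc m →ᵇ ℝ) × (Option (Fin m) → Option (Fin m) → Spc m →ᵇ ℝ)
structure CZ (z : ZZ m) : Prop where
  a : ∀ i, LD i z.1 (z.2.1 i)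
  b : ∀ i k, LD k (z.2.1 i) (z.2.2 k i)

lemma CZ.sub {z w : ZZ m} (h : CZ z) (h' : CZ w) : CZ (z - w) := ⟨fun i => (h.a i).sub (h'.a i), fun i k => (h.b i k).sub (h'.b i k)⟩
lemma CZ.smul {z : ZZ m} (h : CZ z) (c : ℝ) : CZ (c • z) := ⟨fun i => (h.a i).cmul c, fun i k => (h.b i k).cmul c⟩

lemma norm_co (i : Option (Fin m)) : ‖(co i : Spc m →L[ℝ] ℝ)‖ ≤ 1 := by
  refine ContinuousLinearMap.opNorm_le_bound _ zero_le_one fun x => ?_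
  rw [one_mul]
  rcases i with _ | i
  · exact norm_fst_le x
  · exact (norm_le_pi_norm x.2 i).trans (norm_snd_le x)

lemma CZ.main {z : ZZ m} (h : CZ z) : ContDiff ℝ 2 z.1 ∧
    C2Norm z.1 ≤ ENNReal.ofReal ((1 + ((m:ℝ) + 1) + ((m:ℝ) + 1) * ((m:ℝ) + 1)) * ‖z‖) := by
  have f1 : ∀ x, HasFDerivAt z.1 (∑ i, z.2.1 i x • (co i : Spc m →L[ℝ] ℝ)) x := fd_of_LD h.a fun i => (z.2.1 i).continuous
  have f2 : ∀ i x, HasFDerivAt (z.2.1 i) (∑ k, z.2.2 k i x • (co k : Spc m →L[ℝ] ℝ)) x := fun i => fd_of_LD (h.b i) fun k => (z.2.2 k i).continuous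
  have e1 : fderiv ℝ z.1 = fun x => ∑ i, z.2.1 i x • (co i : Spc m →L[ℝ] ℝ) := funext fun x => (f1 x).fderiv
  have f3 : ∀ x, HasFDerivAt (fderiv ℝ z.1) (∑ i, (∑ k, z.2.2 k i x • (co k : Spc m →L[ℝ] ℝ)).smulRight (co i : Spc m →L[ℝ] ℝ)) x := fun x => by
    rw [e1]; exact HasFDerivAt.fun_sum fun i _ => (f2 i x).smul_const (co i : Spc m →L[ℝ] ℝ)
  have n0 : ∀ x, |z.1 x| ≤ ‖z‖ := fun x => (z.1.norm_coe_le_norm x).trans (norm_fst_le z)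
  have n1 : ∀ i x, |z.2.1 i x| ≤ ‖z‖ := fun i x => ((z.2.1 i).norm_coe_le_norm x).trans ((norm_le_pi_norm z.2.1 i).trans ((norm_fst_le z.2).trans (norm_snd_le z)))
  have n2 : ∀ k i x, |z.2.2 k i x| ≤ ‖z‖ := fun k i x => ((z.2.2 k i).norm_coe_le_norm x).trans ((norm_le_pi_norm (z.2.2 k) i).trans
    ((norm_le_pi_norm z.2.2 k).trans ((norm_snd_le z.2).trans (norm_snd_le z))))
  have card : ∀ {U : Type} [NormedAddCommGroup U] (F : Option (Fin m) → U) (c : ℝ), (∀ i, ‖F i‖ ≤ c) → ‖∑ i, F i‖ ≤ ((m:ℝ) + 1) * c := by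
    intro U _ F c hF
    refine (norm_sum_le_of_le _ fun i _ => hF i).trans (le_of_eq ?_)
    simp
  have m1 : ∀ {a η : ℝ} (i : Option (Fin m)), |a| ≤ η → ‖a • (co i : Spc m →L[ℝ] ℝ)‖ ≤ η := fun {a η} i ha => by
    rw [norm_smul, Real.norm_eq_abs]
    have := mul_le_mul ha (norm_co i) (norm_nonneg _) ((abs_nonneg _).trans ha)
    rwa [mul_one] at this
  have hN := norm_nonneg z
  refine ⟨?_, ?_⟩
  · have : (2 : WithTop ℕ∞) = 1 + 1 := by norm_num
    rw [this, contDiff_succ_iff_fderiv]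
    refine ⟨fun x => (f1 x).differentiableAt, by simp, ?_⟩
    rw [contDiff_one_iff_fderiv]
    refine ⟨fun x => (f3 x).differentiableAt, ?_⟩
    rw [funext fun x => (f3 x).fderiv]
    refine continuous_finsetSum _ fun i _ => ?_
    have hc : Continuous fun x => ∑ k, z.2.2 k i x • (co k : Spc m →L[ℝ] ℝ) := continuous_finsetSum _ fun k _ => (z.2.2 k i).continuous.smul continuous_const
    exact ((ContinuousLinearMap.smulRightL ℝ (Spc m) (Spc m →L[ℝ] ℝ)).flip (co i)).continuous.comp hc
  · rw [add_mul, add_mul, one_mul, ENNReal.ofReal_add (by positivity) (by positivity), ENNReal.ofReal_add (by positivity) (by positivity)]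
    refine add_le_add (add_le_add ?_ ?_) ?_
    · exact iSup_le fun x => ENNReal.ofReal_le_ofReal (n0 x)
    · refine iSup_le fun x => ENNReal.ofReal_le_ofReal ?_
      rw [grd, (f1 x).fderiv]
      exact card _ _ fun i => m1 i (n1 i x)
    · refine iSup_le fun x => ENNReal.ofReal_le_ofReal ?_
      rw [← norm_iteratedFDeriv_fderiv, norm_iteratedFDeriv_one, (f3 x).fderiv, mul_assoc]
      refine card _ _ fun i => ?_
      rw [ContinuousLinearMap.norm_smulRight_apply]
      have := mul_le_mul (card _ _ fun k => m1 k (n2 k i x)) (norm_co i) (norm_nonneg _) (by positivity)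
      rwa [mul_one] at this

namespace SOL
variable {V : Spc m → ℝ} {β p : ℝ} {T : ℝ≥0∞} {I : Set ℝ} {ψ : ℝ → Spc m → ℝ}
def Z (ψ : ℝ → Spc m → ℝ) (t : ℝ) : ZZ m := (Q ψ t, Q1 ψ t, fun k => Q2 ψ k t)

lemma Z_smooth (h : SOL V β p I ψ) {t} (ht : t ∈ I) : ContDiffAt ℝ SM (Z ψ) t :=
  ContDiffAt.prodMk (h.smooth ht) ((h.Q1_smooth ht).prodMk (contDiffAt_pi.2 fun k => h.Q2_smooth ht k))
lemma Z_CZ (h : SOL V β p I ψ) {t} (ht : t ∈ I) : CZ (Z ψ t) where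
  a i := by show LD i (Q ψ t) (Q1 ψ t i); rw [h.Q_coe ht, h.Q1_coe ht]; exact (h.u t ht).c.ld i
  b i k := by show LD k (Q1 ψ t i) (Q2 ψ k t i); rw [h.Q1_coe ht, h.Q2_coe ht]; exact (h.u t ht).l i k
lemma dZ_CZ (h : SOL V β p I ψ) {t} (ht : t ∈ I) : CZ (deriv (Z ψ) t) := by
  have hd := (sm_deriv (h.Z_smooth ht)).2
  have c1 : ∀ i, HasDerivAt (fun s => (Z ψ s).2.1 i) ((deriv (Z ψ) t).2.1 i) t := fun i =>
    hasDerivAt_pi.1 ((ContinuousLinearMap.fst ℝ _ _ ∘L ContinuousLinearMap.snd ℝ _ _).hasFDerivAt.comp_hasDerivAt t hd) i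
  have c2 : ∀ k i, HasDerivAt (fun s => (Z ψ s).2.2 k i) ((deriv (Z ψ) t).2.2 k i) t := fun k i =>
    hasDerivAt_pi.1 (hasDerivAt_pi.1 ((ContinuousLinearMap.snd ℝ _ _ ∘L ContinuousLinearMap.snd ℝ _ _).hasFDerivAt.comp_hasDerivAt t hd) k) i
  have c0 : HasDerivAt (fun s => (Z ψ s).1) (deriv (Z ψ) t).1 t := (ContinuousLinearMap.fst ℝ (Spc m →ᵇ ℝ) ((Option (Fin m) → Spc m →ᵇ ℝ) × (Option (Fin m) → Option (Fin m) → Spc m →ᵇ ℝ))).hasFDerivAt.comp_hasDerivAt t hd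
  refine ⟨fun i => LD_deriv c0 (c1 i) ?_, fun i k => LD_deriv (c1 i) (c2 k i) ?_⟩
  · filter_upwards [h.op.mem_nhds ht] with s hs using (h.Z_CZ hs).a i
  · filter_upwards [h.op.mem_nhds ht] with s hs using (h.Z_CZ hs).b i k

lemma final (h : SOL V β p (Ioo0 T) ψ) : IsC1intoC2 T ψ := by
  have hQ : ∀ {t}, t ∈ Ioo0 T → ⇑(Z ψ t).1 = ψ t := fun ht => h.Q_coe ht
  refine ⟨fun t ht => ?_, fun t => (deriv (Z ψ) t).1, fun t ht => (h.dZ_CZ ht).main.2.trans_lt ENNReal.ofReal_lt_top, fun t ht => ?_, fun t ht ε hε => ?_⟩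
  · have := (h.Z_CZ ht).main
    rw [hQ ht] at this
    exact ⟨this.1, this.2.trans_lt ENNReal.ofReal_lt_top⟩
  · have hd := (sm_deriv (h.Z_smooth ht)).2
    rw [hasDerivAt_iff_tendsto_slope_zero, tendsto_iff_norm_sub_tendsto_zero] at hd
    have hb := ENNReal.tendsto_ofReal (hd.const_mul (1 + ((m:ℝ) + 1) + ((m:ℝ) + 1) * ((m:ℝ) + 1)))
    rw [mul_zero, ENNReal.ofReal_zero] at hb
    have hsh : Tendsto (fun r : ℝ => t + r) (𝓝[≠] 0) (𝓝 t) := by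
      have : Continuous fun r : ℝ => t + r := by fun_prop
      simpa using (this.tendsto 0).mono_left nhdsWithin_le_nhds
    refine tendsto_of_tendsto_of_tendsto_of_le_of_le' tendsto_const_nhds hb (Eventually.of_forall fun _ => zero_le) ?_
    filter_upwards [hsh.eventually (h.op.mem_nhds ht)] with r hr
    have := ((((h.Z_CZ hr).sub (h.Z_CZ ht)).smul r⁻¹).sub (h.dZ_CZ ht)).main.2
    refine le_trans (le_of_eq ?_) this
    congr 1; funext x
    rw [← hQ ht, ← hQ hr, div_eq_inv_mul]; rfl
  · have hc := (sm_deriv (h.Z_smooth ht)).1.continuousAt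
    have hK : (0:ℝ) < 1 + ((m:ℝ) + 1) + ((m:ℝ) + 1) * ((m:ℝ) + 1) := by positivity
    obtain ⟨δ, hδ, H⟩ := Metric.continuousAt_iff.1 hc (ε / (1 + ((m:ℝ) + 1) + ((m:ℝ) + 1) * ((m:ℝ) + 1))) (by positivity)
    refine ⟨δ, hδ, fun t' ht' hlt => ?_⟩
    have h1 := H (x := t') (by rwa [Real.dist_eq])
    rw [dist_eq_norm, lt_div_iff₀ hK, mul_comm] at h1
    exact ((h.dZ_CZ ht').sub (h.dZ_CZ ht)).main.2.trans_lt ((ENNReal.ofReal_lt_ofReal_iff hε).2 h1)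
end SOL

end

/-- **Classical regularity (Theorem `loc` (iv)).** Assume `[H₁]` and `[H₂]` and let `ψ` be the
maximal `L^p`-solution on `(0,T_max)`. Then `ψ` is a classical solution:
`ψ ∈ C¹((0,T_max), C²(𝕋ⁿ))`. -/
theorem fokkerPlanck_classical_solution
    (m : ℕ) (V : Spc m → ℝ) (β σ p : ℝ) (ψ0 : Spc m → ℝ)
    (Tmax : ℝ≥0∞) (ψ : ℝ → Spc m → ℝ)
    (hV : ContDiff ℝ 2 V) (hVper : IsPeriodic V) (hβ : 0 < β)
    (h1 : Hyp1 σ p ψ0) (h2 : Hyp2 m σ p)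
    (hψ : IsMaximalLpSolution V β σ p ψ0 Tmax ψ) :
    IsC1intoC2 Tmax ψ := by
  exact (SOL.mk' hV hVper hβ h2 hψ.1).final
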